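/- Let l ≥ 1 and t ≥ 1 be integers. Every (l-span-wheel, K_t)-free graph G in the class 𝒞 has treewidth at most (t−1)·(R(t, l+2)−1)^3 − 1, where R(t, l+2) is the Ramsey number. -/

import Mathlib

open SimpleGraph

variable {V : Type} [Fintype V] [DecidableEq V]

/-- `p` is a chordless (induced) path in `G`: a path such that the only edges of `G`
between its vertices are the edges of the path. -/
def IsInducedPathW (G : SimpleGraph V) {a b : V} (p : G.Walk a b) : Prop :=
  p.IsPath ∧ ∀ u v : V, u ∈ p.support → v ∈ p.support → G.Adj u v → p.toSubgraph.Adj u v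

/-- A hole of length `n` in `G`: an induced (chordless) cycle of length `n ≥ 4`,
given by an injection of `ZMod n` into `G` whose adjacencies are exactly the consecutive ones. -/
def IsHoleEmb (G : SimpleGraph V) (n : ℕ) (f : ZMod n → V) : Prop :=
  4 ≤ n ∧ Function.Injective f ∧
    ∀ i j : ZMod n, G.Adj (f i) (f j) ↔ (j = i + 1 ∨ i = j + 1)

/-- `G` contains an even hole (induced even cycle of length at least 4). -/
def ContainsEvenHole (G : SimpleGraph V) : Prop :=
  ∃ (n : ℕ) (f : ZMod n → V), IsHoleEmb G n f ∧ Even n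

/-- `G` contains a square (hole of length 4). -/
def ContainsSquare (G : SimpleGraph V) : Prop :=
  ∃ f : ZMod 4 → V, IsHoleEmb G 4 f

/-- `G` contains a theta as an induced subgraph: three internally vertex-disjoint chordless
paths from `a` to `b`, each of length at least 2, with no edges between the paths other than
those incident to `a` or `b` specified by the paths. -/
def ContainsTheta (G : SimpleGraph V) : Prop :=
  ∃ (a b : V) (p₁ p₂ p₃ : G.Walk a b),
    (IsInducedPathW G p₁ ∧ IsInducedPathW G p₂ ∧ IsInducedPathW G p₃) ∧
    (2 ≤ p₁.length ∧ 2 ≤ p₂.length ∧ 2 ≤ p₃.length) ∧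
    (∀ w : V, ((w ∈ p₁.support ∧ w ∈ p₂.support) ∨ (w ∈ p₁.support ∧ w ∈ p₃.support) ∨
          (w ∈ p₂.support ∧ w ∈ p₃.support)) → (w = a ∨ w = b)) ∧
    (∀ u w : V, u ≠ a → u ≠ b → w ≠ a → w ≠ b →
      ((u ∈ p₁.support ∧ w ∈ p₂.support) ∨ (u ∈ p₁.support ∧ w ∈ p₃.support) ∨
       (u ∈ p₂.support ∧ w ∈ p₃.support)) → ¬G.Adj u w)

/-- `G` contains a prism as an induced subgraph. -/
def ContainsPrism (G : SimpleGraph V) : Prop :=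
  ∃ (a₁ b₁ a₂ b₂ a₃ b₃ : V) (p₁ : G.Walk a₁ b₁) (p₂ : G.Walk a₂ b₂) (p₃ : G.Walk a₃ b₃),
    (IsInducedPathW G p₁ ∧ IsInducedPathW G p₂ ∧ IsInducedPathW G p₃) ∧
    (1 ≤ p₁.length ∧ 1 ≤ p₂.length ∧ 1 ≤ p₃.length) ∧
    (G.Adj a₁ a₂ ∧ G.Adj a₂ a₃ ∧ G.Adj a₁ a₃) ∧
    (G.Adj b₁ b₂ ∧ G.Adj b₂ b₃ ∧ G.Adj b₁ b₃) ∧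
    (∀ w : V, ¬(w ∈ p₁.support ∧ w ∈ p₂.support) ∧ ¬(w ∈ p₁.support ∧ w ∈ p₃.support) ∧
          ¬(w ∈ p₂.support ∧ w ∈ p₃.support)) ∧
    (∀ u w : V, u ∈ p₁.support → w ∈ p₂.support → G.Adj u w →
      (u = a₁ ∧ w = a₂) ∨ (u = b₁ ∧ w = b₂)) ∧
    (∀ u w : V, u ∈ p₁.support → w ∈ p₃.support → G.Adj u w →
      (u = a₁ ∧ w = a₃) ∨ (u = b₁ ∧ w = b₃)) ∧
    (∀ u w : V, u ∈ p₂.support → w ∈ p₃.support → G.Adj u w →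
      (u = a₂ ∧ w = a₃) ∨ (u = b₂ ∧ w = b₃))

/-- `G` contains a pyramid as an induced subgraph. -/
def ContainsPyramid (G : SimpleGraph V) : Prop :=
  ∃ (a b₁ b₂ b₃ : V) (p₁ : G.Walk a b₁) (p₂ : G.Walk a b₂) (p₃ : G.Walk a b₃),
    (IsInducedPathW G p₁ ∧ IsInducedPathW G p₂ ∧ IsInducedPathW G p₃) ∧
    (1 ≤ p₁.length ∧ 1 ≤ p₂.length ∧ 1 ≤ p₃.length) ∧
    ((2 ≤ p₁.length ∧ 2 ≤ p₂.length) ∨ (2 ≤ p₁.length ∧ 2 ≤ p₃.length) ∨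
     (2 ≤ p₂.length ∧ 2 ≤ p₃.length)) ∧
    (G.Adj b₁ b₂ ∧ G.Adj b₂ b₃ ∧ G.Adj b₁ b₃) ∧
    (∀ w : V, ((w ∈ p₁.support ∧ w ∈ p₂.support) ∨ (w ∈ p₁.support ∧ w ∈ p₃.support) ∨
          (w ∈ p₂.support ∧ w ∈ p₃.support)) → w = a) ∧
    (∀ u w : V, u ∈ p₁.support → w ∈ p₂.support → u ≠ a → w ≠ a → G.Adj u w →
      u = b₁ ∧ w = b₂) ∧
    (∀ u w : V, u ∈ p₁.support → w ∈ p₃.support → u ≠ a → w ≠ a → G.Adj u w →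
      u = b₁ ∧ w = b₃) ∧
    (∀ u w : V, u ∈ p₂.support → w ∈ p₃.support → u ≠ a → w ≠ a → G.Adj u w →
      u = b₂ ∧ w = b₃)

/-- `G` contains the cube as an induced subgraph: a hole of length 6 together with
two non-adjacent vertices `u, v` outside it, `u` adjacent to the even positions and
`v` adjacent to the odd positions. -/
def ContainsCube (G : SimpleGraph V) : Prop :=
  ∃ (f : ZMod 6 → V) (u v : V), IsHoleEmb G 6 f ∧
    u ∉ Set.range f ∧ v ∉ Set.range f ∧ ¬G.Adj u v ∧
    (∀ m : ZMod 6, G.Adj u (f m) ↔ (m = 0 ∨ m = 2 ∨ m = 4)) ∧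
    (∀ m : ZMod 6, G.Adj v (f m) ↔ (m = 1 ∨ m = 3 ∨ m = 5))

/-- `G` contains an even wheel: a hole plus a vertex outside it having at least 3 and
an even number of neighbors on the hole. -/
def ContainsEvenWheel (G : SimpleGraph V) : Prop :=
  ∃ (n : ℕ) (f : ZMod n → V) (u : V), IsHoleEmb G n f ∧ u ∉ Set.range f ∧
    3 ≤ {m : ZMod n | G.Adj u (f m)}.ncard ∧ Even {m : ZMod n | G.Adj u (f m)}.ncard

/-- `G` contains a butterfly: a wheel `(H,v)` with `N_H(v) = {a,b,c,d}`,
`ab, cd ∈ E(G)` and `bc, da ∉ E(G)`. -/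
def ContainsButterfly (G : SimpleGraph V) : Prop :=
  ∃ (n : ℕ) (f : ZMod n → V) (u : V), IsHoleEmb G n f ∧ u ∉ Set.range f ∧
    ∃ i j : ZMod n, i ≠ j ∧ i ≠ j + 1 ∧ i + 1 ≠ j ∧ i + 1 ≠ j + 1 ∧
      ¬G.Adj (f (i + 1)) (f j) ∧ ¬G.Adj (f (j + 1)) (f i) ∧
      (∀ m : ZMod n, G.Adj u (f m) ↔ (m = i ∨ m = i + 1 ∨ m = j ∨ m = j + 1))

/-- A 2-wheel in `G`: a hole `f` together with two distinct centers `u, v` outside the hole,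
each having at least three neighbors on the hole. -/
def Is2WheelCfg (G : SimpleGraph V) (n : ℕ) (f : ZMod n → V) (u v : V) : Prop :=
  IsHoleEmb G n f ∧ u ≠ v ∧ u ∉ Set.range f ∧ v ∉ Set.range f ∧
  3 ≤ {m : ZMod n | G.Adj u (f m)}.ncard ∧ 3 ≤ {m : ZMod n | G.Adj v (f m)}.ncard

/-- The 2-wheel `(f, {u,v})` is nested: the hole splits at `f i` and `f (i+d)` into two arcs,
with all neighbors of `u` on one arc and all neighbors of `v` on the other. -/
def NestedCfg (G : SimpleGraph V) (n : ℕ) (f : ZMod n → V) (u v : V) : Prop :=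
  ∃ (i : ZMod n) (d : ℕ), 1 ≤ d ∧ d < n ∧
    (∀ m : ZMod n, G.Adj u (f m) → ∃ e : ℕ, e ≤ d ∧ m = i + (e : ZMod n)) ∧
    (∀ m : ZMod n, G.Adj v (f m) → ∃ e : ℕ, e ≤ n - d ∧ m = i + (d : ZMod n) + (e : ZMod n))

/-- The 2-wheel `(f, {u,v})` is the cube. -/
def CubeCfg (G : SimpleGraph V) (n : ℕ) (f : ZMod n → V) (u v : V) : Prop :=
  n = 6 ∧ ∃ i : ZMod n,
    (∀ m : ZMod n, G.Adj u (f m) ↔ (m = i ∨ m = i + 2 ∨ m = i + 4)) ∧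
    (∀ m : ZMod n, G.Adj v (f m) ↔ (m = i + 1 ∨ m = i + 3 ∨ m = i + 5))

/-- The 2-wheel `(f, {u,v})` is a cousin wheel: `N_H(u) = {h₁,h₂,h₃}` and
`N_H(v) = {h₂,h₃,h₄}` for four consecutive vertices of the hole (or with `u, v` swapped). -/
def CousinCfg (G : SimpleGraph V) (n : ℕ) (f : ZMod n → V) (u v : V) : Prop :=
  (∃ i : ZMod n,
    (∀ m : ZMod n, G.Adj u (f m) ↔ (m = i ∨ m = i + 1 ∨ m = i + 2)) ∧
    (∀ m : ZMod n, G.Adj v (f m) ↔ (m = i + 1 ∨ m = i + 2 ∨ m = i + 3))) ∨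
  (∃ i : ZMod n,
    (∀ m : ZMod n, G.Adj v (f m) ↔ (m = i ∨ m = i + 1 ∨ m = i + 2)) ∧
    (∀ m : ZMod n, G.Adj u (f m) ↔ (m = i + 1 ∨ m = i + 2 ∨ m = i + 3)))

/-- A `u`-sector of the hole `f`: a subpath from `f i` to `f (i+d)` (`1 ≤ d < n`)
whose two ends are adjacent to `u` and whose internal vertices are not. -/
def IsSector (G : SimpleGraph V) (n : ℕ) (f : ZMod n → V) (u : V) (i : ZMod n) (d : ℕ) : Prop :=
  1 ≤ d ∧ d < n ∧ G.Adj u (f i) ∧ G.Adj u (f (i + (d : ZMod n))) ∧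
    ∀ m : ℕ, 0 < m → m < d → ¬G.Adj u (f (i + (m : ZMod n)))

/-- The class 𝒞: (theta, prism, pyramid, butterfly)-free graphs in which every 2-wheel
with non-adjacent centers is a nested wheel or a cousin wheel. -/
def InClassC (G : SimpleGraph V) : Prop :=
  ¬ContainsTheta G ∧ ¬ContainsPrism G ∧ ¬ContainsPyramid G ∧ ¬ContainsButterfly G ∧
  ∀ (n : ℕ) (f : ZMod n → V) (u v : V), Is2WheelCfg G n f u v → ¬G.Adj u v →
    (NestedCfg G n f u v ∨ CousinCfg G n f u v)

/-- `G` contains `S_{k,k,k}` as an induced subgraph: a root `r` and three legs of `k` edges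
each, with no other adjacencies among these vertices. -/
def ContainsSpider (G : SimpleGraph V) (k : ℕ) : Prop :=
  ∃ (r : V) (f : Fin 3 → Fin k → V),
    (∀ (j : Fin 3) (m : Fin k), f j m ≠ r) ∧
    (∀ (j₁ : Fin 3) (m₁ : Fin k) (j₂ : Fin 3) (m₂ : Fin k),
      f j₁ m₁ = f j₂ m₂ → j₁ = j₂ ∧ m₁ = m₂) ∧
    (∀ (j : Fin 3) (m : Fin k), G.Adj r (f j m) ↔ (m : ℕ) = 0) ∧
    (∀ (j₁ : Fin 3) (m₁ : Fin k) (j₂ : Fin 3) (m₂ : Fin k),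
      G.Adj (f j₁ m₁) (f j₂ m₂) ↔
        (j₁ = j₂ ∧ ((m₁ : ℕ) + 1 = (m₂ : ℕ) ∨ (m₂ : ℕ) + 1 = (m₁ : ℕ))))

/-- A `k`-span-wheel in `G`: a hole `f` of length `n`, with `x = f 0` and `y = f p`
non-adjacent, the two paths `P_A = f 0, f 1, …, f p` and `P_B = f 0, f (n-1), …, f p`,
and centers `c 0, …, c (k-1)` outside the hole such that `{c i} ∪ {x,y}` is independent,
every center has at least three neighbors on the hole and neighbors in the interiors of
both `P_A` and `P_B`, and the neighbors of the centers appear along both `P_A` and `P_B`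
(from `x` to `y`) in the order of the centers. -/
def IsSpanWheel (G : SimpleGraph V) (k n p : ℕ) (f : ZMod n → V) (c : Fin k → V) : Prop :=
  IsHoleEmb G n f ∧
  2 ≤ p ∧ p ≤ n - 2 ∧
  ¬G.Adj (f 0) (f (p : ZMod n)) ∧
  Function.Injective c ∧
  (∀ i : Fin k, c i ∉ Set.range f) ∧
  (∀ i j : Fin k, i ≠ j → ¬G.Adj (c i) (c j)) ∧
  (∀ i : Fin k, ¬G.Adj (c i) (f 0)) ∧
  (∀ i : Fin k, ¬G.Adj (c i) (f (p : ZMod n))) ∧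
  (∀ i : Fin k, 3 ≤ {m : ZMod n | G.Adj (c i) (f m)}.ncard) ∧
  (∀ i : Fin k, ∃ a : ℕ, 0 < a ∧ a < p ∧ G.Adj (c i) (f (a : ZMod n))) ∧
  (∀ i : Fin k, ∃ b : ℕ, p < b ∧ b < n ∧ G.Adj (c i) (f (b : ZMod n))) ∧
  (∀ i j : Fin k, i < j → ∀ a₁ a₂ : ℕ, a₁ ≤ p → a₂ ≤ p →
    G.Adj (c i) (f (a₁ : ZMod n)) → G.Adj (c j) (f (a₂ : ZMod n)) → a₁ ≤ a₂) ∧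
  (∀ i j : Fin k, i < j → ∀ b₁ b₂ : ℕ, p ≤ b₁ → b₁ ≤ n → p ≤ b₂ → b₂ ≤ n →
    G.Adj (c i) (f (b₁ : ZMod n)) → G.Adj (c j) (f (b₂ : ZMod n)) → b₂ ≤ b₁)

/-- `X` separates `s` from `t` in `G`: neither is in `X` and every walk from `s` to `t`
meets `X`. -/
def Separates (G : SimpleGraph V) (X : Set V) (s t : V) : Prop :=
  s ∉ X ∧ t ∉ X ∧ ∀ p : G.Walk s t, ∃ w ∈ p.support, w ∈ X

/-- `X` is a minimal separator of `G`: for some pair `s, t` it is an inclusion-wise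
minimal `st`-separator. -/
def MinSeparator (G : SimpleGraph V) (X : Set V) : Prop :=
  ∃ s t : V, Separates G X s t ∧ ∀ Y ⊆ X, Separates G Y s t → Y = X

/-- `A` is a connected component of `G ∖ C` that is full to `C`. -/
def IsFullComponent (G : SimpleGraph V) (C A : Set V) : Prop :=
  A.Nonempty ∧ Disjoint A C ∧ (G.induce A).Connected ∧
  (∀ a ∈ A, ∀ w : V, G.Adj a w → w ∈ A ∪ C) ∧
  (∀ x ∈ C, ∃ a ∈ A, G.Adj x a)

/-- A tree decomposition of `G` with tree `T` and bags `B`. -/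
def IsTreeDecomp (G : SimpleGraph V) {ι : Type} (T : SimpleGraph ι) (B : ι → Finset V) : Prop :=
  T.IsTree ∧
  (∀ v : V, ∃ i, v ∈ B i) ∧
  (∀ u v : V, G.Adj u v → ∃ i, u ∈ B i ∧ v ∈ B i) ∧
  (∀ (v : V) (i j : ι), v ∈ B i → v ∈ B j →
    ∀ (p : T.Walk i j), p.IsPath → ∀ x ∈ p.support, v ∈ B x)

/-- The treewidth of a finite graph: the least `w` such that `G` has a tree decomposition
all of whose bags have size at most `w + 1`. -/
noncomputable def treewidth (G : SimpleGraph V) : ℕ :=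
  sInf {w : ℕ | ∃ (m : ℕ) (T : SimpleGraph (Fin m)) (B : Fin m → Finset V),
    IsTreeDecomp G T B ∧ ∀ i, (B i).card ≤ w + 1}

/-- A graph is chordal iff it has no hole. -/
def IsChordal (G : SimpleGraph V) : Prop :=
  ¬∃ (n : ℕ) (f : ZMod n → V), IsHoleEmb G n f

/-- `H` is obtained from `G` by a minimal fill-in (minimal chordal completion). -/
def IsMinimalChordalCompletion (G H : SimpleGraph V) : Prop :=
  G ≤ H ∧ IsChordal H ∧ ∀ H' : SimpleGraph V, G ≤ H' → H' ≤ H → IsChordal H' → H' = H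

/-- `Ω` is a potential maximal clique of `G`: a maximal clique of some minimal chordal
completion of `G`. -/
def IsPMC (G : SimpleGraph V) (Ω : Set V) : Prop :=
  ∃ H : SimpleGraph V, IsMinimalChordalCompletion G H ∧ H.IsClique Ω ∧
    ∀ Ω' : Set V, H.IsClique Ω' → Ω ⊆ Ω' → Ω' = Ω

/-- `n` satisfies the Ramsey property for `(t, k)`: every graph on `n` vertices has a
clique of size `t` or an independent set of size `k`. -/
def RamseyProp (n t k : ℕ) : Prop :=
  ∀ G : SimpleGraph (Fin n),
    (∃ S : Finset (Fin n), G.IsNClique t S) ∨ (∃ S : Finset (Fin n), Gᶜ.IsNClique k S)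

/-- The Ramsey number `R(t, k)`. -/
noncomputable def ramseyNumber (t k : ℕ) : ℕ := sInf {n : ℕ | RamseyProp n t k}


/-- List version of induced path. -/
def IndP {U : Type} (G : SimpleGraph U) : List U → Prop
  | [] => True
  | a :: l => (∀ b ∈ l, a ≠ b) ∧ (∀ b ∈ l, (G.Adj a b ↔ l.head? = some b)) ∧ IndP G l

section lists
variable {U : Type} {G : SimpleGraph U}

theorem indP_nil : IndP G [] := trivial

theorem indP_cons {a : U} {l : List U} : IndP G (a :: l) ↔
    (∀ b ∈ l, a ≠ b) ∧ (∀ b ∈ l, (G.Adj a b ↔ l.head? = some b)) ∧ IndP G l := Iff.rfl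

theorem indP_single (a : U) : IndP G [a] := by simp [IndP]

theorem indP_append {L1 L2 : List U} : IndP G (L1 ++ L2) ↔ IndP G L1 ∧ IndP G L2 ∧
    ∀ a ∈ L1, ∀ b ∈ L2, a ≠ b ∧ (G.Adj a b ↔ L1.getLast? = some a ∧ L2.head? = some b) := by
  induction L1 with
  | nil => simp [IndP]
  | cons a l ih =>
    rw [List.cons_append, indP_cons, indP_cons, ih]
    rcases l with _ | ⟨c, l⟩
    · simp only [List.nil_append, List.mem_nil_iff]
      constructor
      · rintro ⟨h1, h2, -, h3, -⟩
        refine ⟨by simp [IndP], h3, ?_⟩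
        intro x hx b hb
        simp only [List.mem_singleton] at hx
        subst hx
        refine ⟨h1 b hb, ?_⟩
        simp [h2 b hb]
      · rintro ⟨_, h3, h4⟩
        refine ⟨fun b hb => (h4 a (by simp) b hb).1, fun b hb => ?_, trivial, h3, by simp⟩
        simp [(h4 a (by simp) b hb).2]
    · constructor
      · rintro ⟨h1, h2, h3, h4, h5⟩
        refine ⟨⟨fun b hb => h1 b (by simp at hb ⊢; tauto), fun b hb => ?_, h3⟩, h4, ?_⟩
        · rw [h2 b (by simp at hb ⊢; tauto)]; simp
        · intro x hx b hb
          rcases List.mem_cons.1 hx with rfl | hx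
          · refine ⟨h1 b (by simp; tauto), ?_⟩
            rw [h2 b (by simp; tauto), List.getLast?_cons_cons]
            have h6 := h5 c (by simp) b hb
            constructor
            · intro h; simp at h; exact absurd h h6.1
            · rintro ⟨h, -⟩
              have := List.mem_of_getLast? h
              exact absurd rfl (h1 x (by simp only [List.mem_append]; tauto))
          · rw [List.getLast?_cons_cons]
            exact h5 x hx b hb
      · rintro ⟨⟨h1, h2, h3⟩, h4, h5⟩
        refine ⟨?_, ?_, h3, h4, ?_⟩
        · intro b hb
          rcases List.mem_append.1 hb with hb | hb
          · exact h1 b hb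
          · exact (h5 a (by simp) b hb).1
        · intro b hb
          rcases List.mem_append.1 hb with hb | hb
          · rw [h2 b hb]; simp
          · rw [(h5 a (by simp) b hb).2, List.getLast?_cons_cons]
            have h6 := h5 c (by simp) b hb
            constructor
            · rintro ⟨h, -⟩
              have := List.mem_of_getLast? h
              exact absurd rfl (h1 a this)
            · intro h; simp at h; exact absurd h h6.1
        · intro x hx b hb
          have := h5 x (List.mem_cons_of_mem _ hx) b hb
          rwa [List.getLast?_cons_cons] at this

theorem indP_append_left {L1 L2 : List U} (h : IndP G (L1 ++ L2)) : IndP G L1 :=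
  (indP_append.1 h).1
theorem indP_append_right {L1 L2 : List U} (h : IndP G (L1 ++ L2)) : IndP G L2 :=
  (indP_append.1 h).2.1

theorem indP_reverse {L : List U} (h : IndP G L) : IndP G L.reverse := by
  induction L with
  | nil => simp [IndP]
  | cons a l ih =>
    rw [List.reverse_cons, indP_append]
    refine ⟨ih h.2.2, indP_single a, ?_⟩
    intro x hx b hb
    simp only [List.mem_singleton] at hb
    subst hb
    rw [List.mem_reverse] at hx
    refine ⟨(h.1 x hx).symm, ?_⟩
    rw [G.adj_comm, h.2.1 x hx]; simp

theorem indP_nodup {L : List U} (h : IndP G L) : L.Nodup := by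
  induction L with
  | nil => simp
  | cons a l ih => 
    rw [List.nodup_cons]
    exact ⟨fun ha => h.1 a ha rfl, ih h.2.2⟩

theorem indP_walk {L : List U} (h : IndP G L) {a b : U} (ha : L.head? = some a)
    (hb : L.getLast? = some b) : ∃ p : G.Walk a b, IsInducedPathW G p ∧ p.support = L := by
  induction L generalizing a with
  | nil => simp at ha
  | cons c l ih =>
    simp at ha; subst ha
    rcases l with _ | ⟨d, l⟩
    · simp at hb; subst hb
      exact ⟨Walk.nil, ⟨by simp, by intro u v hu hv huv; simp at hu hv; subst hu hv; simp at huv⟩, rfl⟩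
    · rw [List.getLast?_cons_cons] at hb
      obtain ⟨p, ⟨hp1, hp2⟩, hp3⟩ := ih h.2.2 (a := d) rfl hb
      have hcd : G.Adj c d := (h.2.1 d (by simp)).2 rfl
      refine ⟨Walk.cons hcd p, ⟨?_, ?_⟩, by simp [hp3]⟩
      · rw [Walk.cons_isPath_iff]
        refine ⟨hp1, ?_⟩
        rw [hp3]; intro hc; exact h.1 c hc rfl
      · intro u v hu hv huv
        simp only [Walk.support_cons, List.mem_cons, hp3] at hu hv
        simp only [Walk.toSubgraph, Subgraph.sup_adj, subgraphOfAdj_adj]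
        have key : ∀ v, v ∈ d :: l → G.Adj c v → v = d := by
          intro v hv hcv
          have := (h.2.1 v hv).1 hcv
          simpa using this.symm
        rw [hp3] at hp2
        rcases hu with rfl | hu
        · rcases hv with rfl | hv
          · simp at huv
          · left; rw [key v (by simpa using hv) huv]
        · rcases hv with rfl | hv
          · left; rw [key u (by simpa using hu) huv.symm, Sym2.eq_swap]
          · right; exact hp2 u v (by simpa using hu) (by simpa using hv) huv

theorem theta_false (hG : ¬ContainsTheta G) {a b : U} {L1 L2 L3 : List U}
    (h1 : IndP G L1) (h2 : IndP G L2) (h3 : IndP G L3)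
    (a1 : L1.head? = some a) (a2 : L2.head? = some a) (a3 : L3.head? = some a)
    (b1 : L1.getLast? = some b) (b2 : L2.getLast? = some b) (b3 : L3.getLast? = some b)
    (l1 : 3 ≤ L1.length) (l2 : 3 ≤ L2.length) (l3 : 3 ≤ L3.length)
    (x12 : ∀ u ∈ L1, ∀ v ∈ L2, u ≠ a → u ≠ b → v ≠ a → v ≠ b → u ≠ v ∧ ¬G.Adj u v)
    (x13 : ∀ u ∈ L1, ∀ v ∈ L3, u ≠ a → u ≠ b → v ≠ a → v ≠ b → u ≠ v ∧ ¬G.Adj u v)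
    (x23 : ∀ u ∈ L2, ∀ v ∈ L3, u ≠ a → u ≠ b → v ≠ a → v ≠ b → u ≠ v ∧ ¬G.Adj u v) : False := by
  obtain ⟨p1, i1, rfl⟩ := indP_walk h1 a1 b1
  obtain ⟨p2, i2, rfl⟩ := indP_walk h2 a2 b2
  obtain ⟨p3, i3, rfl⟩ := indP_walk h3 a3 b3
  rw [Walk.length_support] at l1 l2 l3
  refine hG ⟨a, b, p1, p2, p3, ⟨i1, i2, i3⟩, ⟨by omega, by omega, by omega⟩, ?_, ?_⟩
  · intro w hw
    by_contra hc
    push Not at hc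
    rcases hw with hw | hw | hw
    · exact (x12 w hw.1 w hw.2 hc.1 hc.2 hc.1 hc.2).1 rfl
    · exact (x13 w hw.1 w hw.2 hc.1 hc.2 hc.1 hc.2).1 rfl
    · exact (x23 w hw.1 w hw.2 hc.1 hc.2 hc.1 hc.2).1 rfl
  · intro u w ua ub wa wb hw
    rcases hw with hw | hw | hw
    · exact (x12 u hw.1 w hw.2 ua ub wa wb).2
    · exact (x13 u hw.1 w hw.2 ua ub wa wb).2
    · exact (x23 u hw.1 w hw.2 ua ub wa wb).2

theorem pyramid_false (hG : ¬ContainsPyramid G) {a b1 b2 b3 : U} {L1 L2 L3 : List U}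
    (h1 : IndP G L1) (h2 : IndP G L2) (h3 : IndP G L3)
    (a1 : L1.head? = some a) (a2 : L2.head? = some a) (a3 : L3.head? = some a)
    (e1 : L1.getLast? = some b1) (e2 : L2.getLast? = some b2) (e3 : L3.getLast? = some b3)
    (l1 : 2 ≤ L1.length) (l2 : 2 ≤ L2.length) (l3 : 2 ≤ L3.length)
    (ll : (3 ≤ L1.length ∧ 3 ≤ L2.length) ∨ (3 ≤ L1.length ∧ 3 ≤ L3.length) ∨
      (3 ≤ L2.length ∧ 3 ≤ L3.length))
    (b12 : G.Adj b1 b2) (b23 : G.Adj b2 b3) (b13 : G.Adj b1 b3)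
    (x12 : ∀ u ∈ L1, ∀ v ∈ L2, u ≠ a → v ≠ a → u ≠ v ∧ (G.Adj u v → u = b1 ∧ v = b2))
    (x13 : ∀ u ∈ L1, ∀ v ∈ L3, u ≠ a → v ≠ a → u ≠ v ∧ (G.Adj u v → u = b1 ∧ v = b3))
    (x23 : ∀ u ∈ L2, ∀ v ∈ L3, u ≠ a → v ≠ a → u ≠ v ∧ (G.Adj u v → u = b2 ∧ v = b3)) :
    False := by
  obtain ⟨p1, i1, rfl⟩ := indP_walk h1 a1 e1
  obtain ⟨p2, i2, rfl⟩ := indP_walk h2 a2 e2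
  obtain ⟨p3, i3, rfl⟩ := indP_walk h3 a3 e3
  rw [Walk.length_support] at l1 l2 l3
  simp only [Walk.length_support] at ll
  refine hG ⟨a, b1, b2, b3, p1, p2, p3, ⟨i1, i2, i3⟩, ⟨by omega, by omega, by omega⟩, by omega,
    ⟨b12, b23, b13⟩, ?_, ?_, ?_, ?_⟩
  · intro w hw
    by_contra hc
    rcases hw with hw | hw | hw
    · exact (x12 w hw.1 w hw.2 hc hc).1 rfl
    · exact (x13 w hw.1 w hw.2 hc hc).1 rfl
    · exact (x23 w hw.1 w hw.2 hc hc).1 rfl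
  · intro u w hu hw ha hb; exact (x12 u hu w hw ha hb).2
  · intro u w hu hw ha hb; exact (x13 u hu w hw ha hb).2
  · intro u w hu hw ha hb; exact (x23 u hu w hw ha hb).2

theorem prism_false (hG : ¬ContainsPrism G) {a1 a2 a3 b1 b2 b3 : U} {L1 L2 L3 : List U}
    (h1 : IndP G L1) (h2 : IndP G L2) (h3 : IndP G L3)
    (d1 : L1.head? = some a1) (d2 : L2.head? = some a2) (d3 : L3.head? = some a3)
    (e1 : L1.getLast? = some b1) (e2 : L2.getLast? = some b2) (e3 : L3.getLast? = some b3)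
    (l1 : 2 ≤ L1.length) (l2 : 2 ≤ L2.length) (l3 : 2 ≤ L3.length)
    (a12 : G.Adj a1 a2) (a23 : G.Adj a2 a3) (a13 : G.Adj a1 a3)
    (b12 : G.Adj b1 b2) (b23 : G.Adj b2 b3) (b13 : G.Adj b1 b3)
    (x12 : ∀ u ∈ L1, ∀ v ∈ L2, u ≠ v ∧ (G.Adj u v → (u = a1 ∧ v = a2) ∨ (u = b1 ∧ v = b2)))
    (x13 : ∀ u ∈ L1, ∀ v ∈ L3, u ≠ v ∧ (G.Adj u v → (u = a1 ∧ v = a3) ∨ (u = b1 ∧ v = b3)))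
    (x23 : ∀ u ∈ L2, ∀ v ∈ L3, u ≠ v ∧ (G.Adj u v → (u = a2 ∧ v = a3) ∨ (u = b2 ∧ v = b3))) :
    False := by
  obtain ⟨p1, i1, rfl⟩ := indP_walk h1 d1 e1
  obtain ⟨p2, i2, rfl⟩ := indP_walk h2 d2 e2
  obtain ⟨p3, i3, rfl⟩ := indP_walk h3 d3 e3
  rw [Walk.length_support] at l1 l2 l3
  refine hG ⟨a1, b1, a2, b2, a3, b3, p1, p2, p3, ⟨i1, i2, i3⟩, ⟨by omega, by omega, by omega⟩,
    ⟨a12, a23, a13⟩, ⟨b12, b23, b13⟩, ?_, ?_, ?_, ?_⟩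
  · intro w
    exact ⟨fun hw => (x12 w hw.1 w hw.2).1 rfl, fun hw => (x13 w hw.1 w hw.2).1 rfl,
      fun hw => (x23 w hw.1 w hw.2).1 rfl⟩
  · intro u w hu hw; exact (x12 u hu w hw).2
  · intro u w hu hw; exact (x13 u hu w hw).2
  · intro u w hu hw; exact (x23 u hu w hw).2

/-- Join two induced paths ending at the same vertex. -/
theorem indP_join {E E' : List U} {i : U} (h : IndP G E) (h' : IndP G E')
    (hl : E.getLast? = some i) (hl' : E'.getLast? = some i)
    (x : ∀ u ∈ E, ∀ v ∈ E', u ≠ i → v ≠ i → u ≠ v ∧ ¬G.Adj u v) :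
    ∃ J, IndP G J ∧ J.head? = E.head? ∧ J.getLast? = E'.head? ∧
      (∀ u, u ∈ J ↔ u ∈ E ∨ u ∈ E') ∧ J.length + 1 = E.length + E'.length := by
  obtain ⟨E1, rfl⟩ : ∃ E1, E = E1 ++ [i] := by
    obtain ⟨ys, hy⟩ := List.getLast?_eq_some_iff.1 hl; exact ⟨ys, hy⟩
  obtain ⟨E2, rfl⟩ : ∃ E1, E' = E1 ++ [i] := by
    obtain ⟨ys, hy⟩ := List.getLast?_eq_some_iff.1 hl'; exact ⟨ys, hy⟩
  have hr := indP_reverse h'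
  rw [List.reverse_append] at hr
  have hr1 := indP_append.1 hr
  have h1 := indP_append.1 h
  refine ⟨E1 ++ [i] ++ E2.reverse, ?_, by simp [List.head?_append], ?_, ?_, ?_⟩
  · rw [indP_append]
    refine ⟨h, hr1.2.1, ?_⟩
    intro a ha b hb
    have hbi : b ≠ i := fun hbi => (hr1.2.2 i (by simp) b hb).1 hbi.symm
    rcases List.mem_append.1 ha with ha | ha
    · have hai : a ≠ i := (h1.2.2 a ha i (by simp)).1
      have := x a (by simp [ha]) b (by simpa using Or.inl (List.mem_reverse.1 hb)) hai hbi
      refine ⟨this.1, ?_⟩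
      constructor
      · intro h; exact absurd h this.2
      · rintro ⟨h, -⟩; simp at h; exact absurd h.symm hai
    · simp at ha; subst ha
      refine ⟨hbi.symm, ?_⟩
      rw [(hr1.2.2 a (by simp) b hb).2]; simp
  · simp only [List.getLast?_append, List.getLast?_reverse, List.head?_append]; simp
  · intro u; simp; tauto
  · simp; omega

end lists


section holes
variable {U : Type} {G : SimpleGraph U}

theorem indP_idx {L : List U} (h : IndP G L) {i j : ℕ} (hij : i < j) (hj : j < L.length) :
    L[i] ≠ L[j] ∧ (G.Adj L[i] L[j] ↔ j = i + 1) := by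
  induction L generalizing i j with
  | nil => simp at hj
  | cons a l ih =>
    obtain ⟨j, rfl⟩ : ∃ k, j = k + 1 := ⟨j - 1, by omega⟩
    have hj' : j < l.length := by simpa using hj
    rcases i with _ | i
    · simp only [List.getElem_cons_zero, List.getElem_cons_succ]
      have hm : l[j] ∈ l := List.getElem_mem _
      refine ⟨h.1 _ hm, ?_⟩
      rw [h.2.1 _ hm, List.head?_eq_getElem?]
      rw [List.getElem?_eq_getElem (by omega)]
      simp only [Option.some.injEq]
      rw [(indP_nodup h.2.2).getElem_inj_iff]; omega
    · simp only [List.getElem_cons_succ]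
      have := ih h.2.2 (i := i) (j := j) (by omega) hj'
      refine ⟨this.1, this.2.trans (by omega)⟩

theorem indP_adj_idx {L : List U} (h : IndP G L) {i j : ℕ} (hi : i < L.length) (hj : j < L.length) :
    (G.Adj L[i] L[j] ↔ j = i + 1 ∨ i = j + 1) := by
  rcases lt_trichotomy i j with hij | rfl | hij
  · rw [(indP_idx h hij hj).2]; omega
  · simp
  · rw [G.adj_comm, (indP_idx h hij hi).2]; omega

theorem zcast_eq {n a b : ℕ} (ha : a < n) (hb : b < n) : ((a : ZMod n) = b) ↔ a = b := by
  rw [ZMod.natCast_eq_natCast_iff', Nat.mod_eq_of_lt ha, Nat.mod_eq_of_lt hb]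

theorem zcast_succ {n a b : ℕ} (ha : a < n) (hb : b < n) :
    ((b : ZMod n) = a + 1) ↔ (b = a + 1 ∨ (b = 0 ∧ a + 1 = n)) := by
  rcases Nat.lt_or_ge (a + 1) n with h | h
  · rw [show ((a : ZMod n) + 1) = ((a + 1 : ℕ) : ZMod n) by push_cast; rfl, zcast_eq hb h]; omega
  · have : a + 1 = n := by omega
    rw [show ((a : ZMod n) + 1) = ((a + 1 : ℕ) : ZMod n) by push_cast; rfl, this]
    rw [show ((n : ℕ) : ZMod n) = ((0 : ℕ) : ZMod n) by simp, zcast_eq hb (by omega)]; omega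

theorem zrep {n : ℕ} (hn : 0 < n) (m : ZMod n) : ∃ k : ℕ, k < n ∧ m = (k : ZMod n) := by
  have : NeZero n := ⟨by omega⟩
  exact ⟨m.val, ZMod.val_lt m, by simp⟩

/-- `a :: l` is a chordless cycle. -/
def CycL (G : SimpleGraph U) (a : U) (l : List U) : Prop :=
  IndP G l ∧ 3 ≤ l.length ∧ a ∉ l ∧ ∀ b ∈ l, (G.Adj a b ↔ l.head? = some b ∨ l.getLast? = some b)

theorem hole_of_list {a : U} {l : List U} (h : CycL G a l) {n : ℕ} (hn : n = l.length + 1) :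
    ∃ f : ZMod n → U, IsHoleEmb G n f ∧
      ∀ k (hk : k < (a :: l).length), f (k : ZMod n) = (a :: l)[k] := by
  obtain ⟨h1, h2, h3, h4⟩ := h
  have : NeZero n := ⟨by omega⟩
  refine ⟨fun m => (a :: l)[m.val]'(by simpa [← hn] using ZMod.val_lt m), ?_, ?_⟩
  swap
  · intro k hk
    have : ((k : ZMod n)).val = k := ZMod.val_natCast_of_lt (by simpa [hn] using hk)
    simp [this]
  have hnd : (a :: l).Nodup := List.nodup_cons.2 ⟨h3, indP_nodup h1⟩
  have adj0 : ∀ j (hj : j < l.length), G.Adj a l[j] ↔ (j = 0 ∨ j + 1 = l.length) := by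
    intro j hj
    rw [h4 _ (List.getElem_mem _), List.head?_eq_getElem?, List.getLast?_eq_getElem?,
      List.getElem?_eq_getElem (by omega), List.getElem?_eq_getElem (by omega)]
    simp only [Option.some.injEq]
    rw [(indP_nodup h1).getElem_inj_iff, (indP_nodup h1).getElem_inj_iff]
    omega
  refine ⟨by omega, ?_, ?_⟩
  · intro i j hij
    rw [hnd.getElem_inj_iff] at hij
    exact ZMod.val_injective n hij
  · intro i j
    obtain ⟨i, hi, rfl⟩ := zrep (by omega) i
    obtain ⟨j, hj, rfl⟩ := zrep (by omega) j
    rw [zcast_succ hi hj, zcast_succ hj hi]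
    simp only [ZMod.val_natCast_of_lt hi, ZMod.val_natCast_of_lt hj]
    rcases i with _ | i
    · rcases j with _ | j
      · simp; omega
      · simp only [List.getElem_cons_zero, List.getElem_cons_succ]
        rw [adj0 j (by omega)]; simp; omega
    · rcases j with _ | j
      · simp only [List.getElem_cons_zero, List.getElem_cons_succ]
        rw [G.adj_comm, adj0 i (by omega)]; simp; omega
      · simp only [List.getElem_cons_succ]
        rw [indP_adj_idx h1 (by omega) (by omega)]; omega

theorem head_getElem {L : List U} {x : U} (h : L.head? = some x) :
    ∃ h0 : 0 < L.length, L[0] = x := by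
  cases L with
  | nil => simp at h
  | cons a l => simp at h; exact ⟨by simp, by simp [h]⟩

theorem last_getElem {L : List U} {x : U} (h : L.getLast? = some x) :
    ∃ h0 : L.length - 1 < L.length, L[L.length - 1] = x := by
  rw [List.getLast?_eq_getElem?] at h
  obtain ⟨h1, h2⟩ := List.getElem?_eq_some_iff.1 h
  exact ⟨h1, h2⟩

theorem butterfly_false (hG : ¬ContainsButterfly G) {k x1 x2 y1 y2 : U} {X Y : List U}
    (hX : IndP G X) (hY : IndP G Y) (hx1 : X.head? = some x1) (hx2 : X.getLast? = some x2)
    (hy1 : Y.head? = some y1) (hy2 : Y.getLast? = some y2) (lX : 3 ≤ X.length) (lY : 3 ≤ Y.length)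
    (cross : ∀ u ∈ X, ∀ v ∈ Y, u ≠ v ∧ (G.Adj u v ↔ (u = x1 ∧ v = y1) ∨ (u = x2 ∧ v = y2)))
    (kX : ∀ u ∈ X, k ≠ u ∧ (G.Adj k u ↔ u = x1 ∨ u = x2))
    (kY : ∀ u ∈ Y, k ≠ u ∧ (G.Adj k u ↔ u = y1 ∨ u = y2)) : False := by
  obtain ⟨X', rfl⟩ : ∃ X', X = x1 :: X' := by
    cases X with
    | nil => simp at hx1
    | cons a l => simp at hx1; subst hx1; exact ⟨l, rfl⟩
  have hX' : X' ≠ [] := by rintro rfl; simp at lX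
  have hx2' : X'.getLast? = some x2 := by
    cases X' with
    | nil => exact absurd rfl hX'
    | cons b l => rwa [List.getLast?_cons_cons] at hx2
  have hx12 : x1 ≠ x2 := hX.1 x2 (List.mem_of_getLast? hx2')
  have hyr : Y.reverse.getLast? = some y1 := by simp [hy1]
  have hyr2 : Y.reverse.head? = some y2 := by simp [hy2]
  have hy12 : y1 ≠ y2 := by
    obtain ⟨h0, e0⟩ := head_getElem hy1
    obtain ⟨h1, e1⟩ := last_getElem hy2
    have := (indP_idx hY (i := 0) (j := Y.length - 1) (by omega) h1).1
    rwa [e0, e1] at this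
  have hcyc : CycL G x1 (X' ++ Y.reverse) := by
    refine ⟨?_, by simp; omega, ?_, ?_⟩
    · rw [indP_append]
      refine ⟨hX.2.2, indP_reverse hY, ?_⟩
      intro a ha b hb
      rw [List.mem_reverse] at hb
      have := cross a (List.mem_cons_of_mem _ ha) b hb
      refine ⟨this.1, this.2.trans ?_⟩
      rw [hx2', hyr2]
      have := hX.1 a ha
      simp only [Option.some.injEq]
      constructor
      · rintro (h | h)
        · exact absurd h.1.symm this
        · exact ⟨h.1.symm, h.2.symm⟩
      · intro h; right; exact ⟨h.1.symm, h.2.symm⟩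
    · intro h
      rcases List.mem_append.1 h with h | h
      · exact hX.1 _ h rfl
      · exact (cross x1 (by simp) x1 (List.mem_reverse.1 h)).1 rfl
    · intro b hb
      have e1 : (X' ++ Y.reverse).head? = X'.head? := by
        cases X' with
        | nil => exact absurd rfl hX'
        | cons c l => rfl
      have e2 : (X' ++ Y.reverse).getLast? = some y1 := by
        rw [List.getLast?_append, hyr]; rfl
      rw [e1, e2]
      rcases List.mem_append.1 hb with hb | hb
      · rw [hX.2.1 b hb]
        constructor
        · intro h; left; exact h
        · rintro (h | h)
          · exact h
          · simp at h; subst h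
            exact absurd rfl (cross y1 (List.mem_cons_of_mem _ hb) y1 (List.mem_of_head? hy1)).1
      · rw [List.mem_reverse] at hb
        rw [(cross x1 (by simp) b hb).2]
        constructor
        · rintro (h | h)
          · right; rw [h.2]
          · exact absurd h.1 hx12
        · rintro (h | h)
          · exact absurd rfl (cross b (List.mem_cons_of_mem _ (List.mem_of_head? h)) b hb).1
          · left; simp at h; exact ⟨rfl, h.symm⟩
  obtain ⟨n, hn'⟩ : ∃ n, n = X'.length + Y.length + 1 := ⟨_, rfl⟩
  obtain ⟨f, hf, hfk⟩ := hole_of_list hcyc (n := n) (by simp [hn'])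
  simp only [List.length_cons] at lX
  have ha := zcast_succ (n := n) (a := X'.length) (b := X'.length + 1) (by omega) (by omega)
  have hfX : ∀ k (hk : k < (x1 :: X').length), f (k : ZMod n) = (x1 :: X')[k] := by
    intro k hk
    rw [hfk k (by simp at hk ⊢; omega)]
    rw [← List.getElem_append_left (as := x1 :: X') (bs := Y.reverse)]; rfl
  have hfY : ∀ k (hk : k < Y.length), f ((X'.length + 1 + k : ℕ) : ZMod n) = Y[Y.length - 1 - k] := by
    intro k hk
    rw [hfk _ (by simp; omega)]
    rw [show (x1 :: (X' ++ Y.reverse))[X'.length + 1 + k]'(by simp; omega) =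
      ((x1 :: X') ++ Y.reverse)[X'.length + 1 + k]'(by simp; omega) from rfl]
    rw [List.getElem_append_right (by simp)]
    simp
  have rng : ∀ m : ZMod n, ∃ u, f m = u ∧ (u ∈ x1 :: X' ∨ u ∈ Y) := by
    intro m
    obtain ⟨m, hm, rfl⟩ := zrep (by omega) m
    rcases Nat.lt_or_ge m (X'.length + 1) with h | h
    · exact ⟨_, hfX m (by simpa using h), Or.inl (List.getElem_mem _)⟩
    · obtain ⟨r, rfl⟩ : ∃ r, m = X'.length + 1 + r := ⟨m - (X'.length + 1), by omega⟩
      exact ⟨_, hfY r (by omega), Or.inr (List.getElem_mem _)⟩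
  obtain ⟨g0, ex1⟩ := head_getElem hx1
  obtain ⟨g1, ex2⟩ := last_getElem hx2
  obtain ⟨g2, ey1⟩ := head_getElem hy1
  obtain ⟨g3, ey2⟩ := last_getElem hy2
  have c1 : ((X'.length : ℕ) : ZMod n) + 1 = ((X'.length + 1 : ℕ) : ZMod n) := by push_cast; rfl
  have c2 : ((n - 1 : ℕ) : ZMod n) + 1 = ((0 : ℕ) : ZMod n) := by
    symm; rw [zcast_succ (by omega) (by omega)]; omega
  refine hG ⟨n, f, k, hf, ?_, ((X'.length : ℕ) : ZMod n), ((n - 1 : ℕ) : ZMod n), ?_⟩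
  · rintro ⟨m, hm⟩
    obtain ⟨u, hu, h⟩ := rng m
    rcases h with h | h
    · exact (kX u h).1 (by rw [← hu, hm])
    · exact (kY u h).1 (by rw [← hu, hm])
  · rw [c1, c2]
    simp only [ne_eq]
    rw [zcast_eq (by omega) (by omega), zcast_eq (by omega) (by omega), zcast_eq (by omega) (by omega), zcast_eq (by omega) (by omega)]
    refine ⟨by omega, by omega, by omega, by omega, ?_, ?_, ?_⟩
    · rw [hf.2.2, zcast_succ (by omega) (by omega), zcast_succ (by omega) (by omega)]; omega
    · rw [hf.2.2, zcast_succ (by omega) (by omega), zcast_succ (by omega) (by omega)]; omega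
    · intro m
      obtain ⟨m, hm, rfl⟩ := zrep (by omega) m
      rw [zcast_eq hm (by omega), zcast_eq hm (by omega), zcast_eq hm (by omega), zcast_eq hm (by omega)]
      rcases Nat.lt_or_ge m (X'.length + 1) with h | h
      · have hnd := indP_nodup hX
        rw [hfX m (by simpa using h), (kX _ (List.getElem_mem _)).2]
        have q1 : (x1 :: X')[m] = x1 ↔ m = 0 := hnd.getElem_inj_iff (i := m) (j := 0) (hj := g0)
        rw [q1, ← ex2, hnd.getElem_inj_iff]
        simp; omega
      · obtain ⟨r, rfl⟩ : ∃ r, m = X'.length + 1 + r := ⟨m - (X'.length + 1), by omega⟩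
        have hnd := indP_nodup hY
        rw [hfY r (by omega), (kY _ (List.getElem_mem _)).2]
        rw [← ey1, ← ey2]
        rw [hnd.getElem_inj_iff, hnd.getElem_inj_iff]
        omega
end holes


section sides
variable {U : Type} {G : SimpleGraph U}

structure ClawGen (G : SimpleGraph U) (A : Set U) (t : Finset U) (c : U) (E : U → List U) : Prop where
  hc : c ∈ A ∨ c ∈ t
  ind : ∀ i ∈ t, IndP G (E i)
  hd : ∀ i ∈ t, (E i).head? = some c
  lst : ∀ i ∈ t, (E i).getLast? = some i
  mem : ∀ i ∈ t, ∀ u ∈ E i, u ∈ A ∨ u = c ∨ u = i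
  cross : ∀ i ∈ t, ∀ j ∈ t, i ≠ j → ∀ u ∈ E i, ∀ v ∈ E j, u ≠ c → v ≠ c → u ≠ v ∧ ¬G.Adj u v

structure TriGen (G : SimpleGraph U) (A : Set U) (t : Finset U) (d : U → U) (E : U → List U) : Prop where
  adj : ∀ i ∈ t, ∀ j ∈ t, i ≠ j → G.Adj (d i) (d j)
  ind : ∀ i ∈ t, IndP G (E i)
  hd : ∀ i ∈ t, (E i).head? = some (d i)
  lst : ∀ i ∈ t, (E i).getLast? = some i
  mem : ∀ i ∈ t, ∀ u ∈ E i, u ∈ A ∨ u = i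
  cross : ∀ i ∈ t, ∀ j ∈ t, i ≠ j → ∀ u ∈ E i, ∀ v ∈ E j, u ≠ v ∧ (G.Adj u v → u = d i ∧ v = d j)

structure Cfg (G : SimpleGraph U) (A B : Set U) (t : Finset U) : Prop where
  dis : ∀ a ∈ A, a ∉ B
  anti : ∀ a ∈ A, ∀ b ∈ B, ¬G.Adj a b
  tA : ∀ i ∈ t, i ∉ A
  tB : ∀ i ∈ t, i ∉ B
  ind : ∀ i ∈ t, ∀ j ∈ t, ¬G.Adj i j

theorem Cfg.symm {A B : Set U} {t : Finset U} (h : Cfg G A B t) : Cfg G B A t :=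
  ⟨fun b hb ha => h.dis b ha hb, fun b hb a ha hab => h.anti a ha b hb hab.symm, h.tB, h.tA, h.ind⟩

theorem Cfg.mono {A B : Set U} {t t' : Finset U} (h : Cfg G A B t) (ht : t' ⊆ t) : Cfg G A B t' :=
  ⟨h.dis, h.anti, fun i hi => h.tA i (ht hi), fun i hi => h.tB i (ht hi),
    fun i hi j hj => h.ind i (ht hi) j (ht hj)⟩

theorem indP_ends {L : List U} (h : IndP G L) {a b : U} (ha : L.head? = some a)
    (hb : L.getLast? = some b) (hl : 2 ≤ L.length) : a ≠ b ∧ (3 ≤ L.length → ¬G.Adj a b) := by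
  obtain ⟨h0, e0⟩ := head_getElem ha
  obtain ⟨h1, e1⟩ := last_getElem hb
  have := (indP_idx h (i := 0) (j := L.length - 1) (by omega) h1)
  rw [e0, e1] at this
  refine ⟨this.1, fun h3 => ?_⟩
  rw [this.2]; omega

theorem len_pos_of_head {L : List U} {a : U} (ha : L.head? = some a) : 1 ≤ L.length := by
  obtain ⟨h0, e0⟩ := head_getElem ha; exact h0

theorem single_of {L : List U} {a b : U} (ha : L.head? = some a)
    (hb : L.getLast? = some b) (hl : L.length ≤ 1) : a = b ∧ L = [a] := by
  match L, hl with
  | [], _ => simp at ha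
  | [x], _ => simp at ha hb; simp [← ha, hb]

theorem len_ge_two {L : List U} {a b : U} (ha : L.head? = some a)
    (hb : L.getLast? = some b) (hab : a ≠ b) : 2 ≤ L.length := by
  by_contra h
  exact hab (single_of ha hb (by omega)).1

theorem len_ge_three {L : List U} (h : IndP G L) {a b : U} (ha : L.head? = some a)
    (hb : L.getLast? = some b) (hab : a ≠ b) (hn : ¬G.Adj a b) : 3 ≤ L.length := by
  have := len_ge_two ha hb hab
  by_contra h3
  match L, (by omega : L.length = 2) with
  | [x, y], _ => 
    simp at ha hb; subst ha hb
    exact hn ((h.2.1 y (by simp)).2 rfl)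

theorem len_two_adj {L : List U} (h : IndP G L) {a b : U} (ha : L.head? = some a)
    (hb : L.getLast? = some b) (hl : L.length = 2) : G.Adj a b := by
  match L, hl with
  | [x, y], _ => 
    simp at ha hb; subst ha hb
    exact ((h.2.1 y (by simp)).2 rfl)

theorem ClawGen.self_len {A : Set U} {t : Finset U} {c : U} {E : U → List U}
    (h : ClawGen G A t c E) (hc : c ∈ t) : (E c).length = 1 := by
  have h1 := len_pos_of_head (h.hd c hc)
  by_contra h2
  exact (indP_ends (h.ind c hc) (h.hd c hc) (h.lst c hc) (by omega)).1 rfl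

theorem ClawGen.mem_last {A : Set U} {t : Finset U} {c : U} {E : U → List U}
    (h : ClawGen G A t c E) {i : U} (hi : i ∈ t) : i ∈ E i := List.mem_of_getLast? (h.lst i hi)

theorem TriGen.mem_last {A : Set U} {t : Finset U} {d : U → U} {E : U → List U}
    (h : TriGen G A t d E) {i : U} (hi : i ∈ t) : i ∈ E i := List.mem_of_getLast? (h.lst i hi)

theorem claw_aux {A B : Set U} {t : Finset U} {c c' : U} {E E' : U → List U}
    (h : ClawGen G A t c E) (h' : ClawGen G B t c' E')
    (hE : ∀ i ∈ t, 4 ≤ (E i).length + (E' i).length) (hc : c ∈ t) {i : U} (hi : i ∈ t) (hic : i ≠ c)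
    {v : U} (hv : v ∈ E' i) : c ≠ v ∧ ¬G.Adj c v := by
  have h1 := h.self_len hc
  have h2 := hE c hc
  have h3 := indP_ends (h'.ind c hc) (h'.hd c hc) (h'.lst c hc) (by omega)
  by_cases hvc : v = c'
  · subst hvc; exact ⟨h3.1.symm, fun h => h3.2 (by omega) h.symm⟩
  · exact h'.cross c hc i hi hic.symm c (h'.mem_last hc) v hv h3.1.symm hvc

theorem claw_claw (hG : InClassC G) {A B : Set U} {t : Finset U} (ht : t.card = 3)
    (hC : Cfg G A B t) {c c' : U} {E E' : U → List U}
    (h : ClawGen G A t c E) (h' : ClawGen G B t c' E')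
    (hE : ∀ i ∈ t, 4 ≤ (E i).length + (E' i).length) : False := by
  have hE' : ∀ i ∈ t, 4 ≤ (E' i).length + (E i).length := fun i hi => by have := hE i hi; omega
  have hj : ∀ i ∈ t, ∃ J, IndP G J ∧ J.head? = (E i).head? ∧ J.getLast? = (E' i).head? ∧
      (∀ u, u ∈ J ↔ u ∈ E i ∨ u ∈ E' i) ∧ J.length + 1 = (E i).length + (E' i).length := by
    intro i hi
    refine indP_join (h.ind i hi) (h'.ind i hi) (h.lst i hi) (h'.lst i hi) ?_
    intro u hu v hv hui hvi
    by_cases hcu : u = c ∧ c ∈ t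
    · obtain ⟨rfl, hc⟩ := hcu
      exact claw_aux h h' hE hc hi hui.symm hv
    by_cases hcv : v = c' ∧ c' ∈ t
    · obtain ⟨rfl, hc⟩ := hcv
      have := claw_aux h' h hE' hc hi hvi.symm hu
      exact ⟨this.1.symm, fun h => this.2 h.symm⟩
    have huA : u ∈ A := by
      rcases h.mem i hi u hu with h1 | h1 | h1
      · exact h1
      · rcases h.hc with h2 | h2
        · exact h1 ▸ h2
        · exact absurd ⟨h1, h2⟩ hcu
      · exact absurd h1 hui
    have hvB : v ∈ B := by
      rcases h'.mem i hi v hv with h1 | h1 | h1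
      · exact h1
      · rcases h'.hc with h2 | h2
        · exact h1 ▸ h2
        · exact absurd ⟨h1, h2⟩ hcv
      · exact absurd h1 hvi
    exact ⟨fun huv => hC.dis u huA (huv ▸ hvB), hC.anti u huA v hvB⟩
  choose! J j1 j2 j3 j4 j5 using hj
  have half : ∀ i ∈ t, ∀ j ∈ t, i ≠ j → ∀ u ∈ E i, ∀ v ∈ E' j, u ≠ c → u ≠ c' → v ≠ c → v ≠ c' →
      u ≠ v ∧ ¬G.Adj u v := by
    intro i hi j hj hij u hu v hv uc uc' vc vc'
    rcases h.mem i hi u hu with h1 | h1 | h1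
    · rcases h'.mem j hj v hv with h2 | h2 | h2
      · exact ⟨fun huv => hC.dis u h1 (huv ▸ h2), hC.anti u h1 v h2⟩
      · exact absurd h2 vc'
      · subst h2
        exact h.cross i hi v hj hij u hu v (h.mem_last hj) uc vc
    · exact absurd h1 uc
    · subst h1
      exact h'.cross u hi j hj hij u (h'.mem_last hi) v hv uc' vc'
  have cross : ∀ i ∈ t, ∀ j ∈ t, i ≠ j → ∀ u ∈ J i, ∀ v ∈ J j, u ≠ c → u ≠ c' → v ≠ c → v ≠ c' →
      u ≠ v ∧ ¬G.Adj u v := by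
    intro i hi j hj hij u hu v hv uc uc' vc vc'
    rw [j4 i hi] at hu
    rw [j4 j hj] at hv
    rcases hu with hu | hu <;> rcases hv with hv | hv
    · exact h.cross i hi j hj hij u hu v hv uc vc
    · exact half i hi j hj hij u hu v hv uc uc' vc vc'
    · have := half j hj i hi hij.symm v hv u hu vc vc' uc uc'
      exact ⟨this.1.symm, fun h => this.2 h.symm⟩
    · exact h'.cross i hi j hj hij u hu v hv uc' vc'
  classical
  obtain ⟨x, y, z, hxy, hxz, hyz, rfl⟩ := Finset.card_eq_three.1 ht
  have hx : x ∈ ({x, y, z} : Finset U) := by simp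
  have hy : y ∈ ({x, y, z} : Finset U) := by simp
  have hz : z ∈ ({x, y, z} : Finset U) := by simp
  refine theta_false hG.1 (a := c) (b := c') (j1 x hx) (j1 y hy) (j1 z hz)
    ((j2 x hx).trans (h.hd x hx)) ((j2 y hy).trans (h.hd y hy)) ((j2 z hz).trans (h.hd z hz))
    ((j3 x hx).trans (h'.hd x hx)) ((j3 y hy).trans (h'.hd y hy)) ((j3 z hz).trans (h'.hd z hz))
    ?_ ?_ ?_ (cross x hx y hy hxy) (cross x hx z hz hxz) (cross y hy z hz hyz)
  · have := hE x hx; have := j5 x hx; omega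
  · have := hE y hy; have := j5 y hy; omega
  · have := hE z hz; have := j5 z hz; omega

theorem TriGen.two_long {A B : Set U} {t : Finset U} {d : U → U} {E : U → List U} (hC : Cfg G A B t)
    (h : TriGen G A t d E) {i j : U} (hi : i ∈ t) (hj : j ∈ t) (hij : i ≠ j) :
    2 ≤ (E i).length ∨ 2 ≤ (E j).length := by
  by_contra hc
  push Not at hc
  have e1 := (single_of (h.hd i hi) (h.lst i hi) (by omega)).1
  have e2 := (single_of (h.hd j hj) (h.lst j hj) (by omega)).1
  have := h.adj i hi j hj hij
  rw [e1, e2] at this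
  exact hC.ind i hi j hj this

theorem claw_tri (hG : InClassC G) {A B : Set U} {t : Finset U} (ht : t.card = 3)
    (hC : Cfg G A B t) {c : U} {d : U → U} {E E' : U → List U}
    (h : ClawGen G A t c E) (h' : TriGen G B t d E')
    (hE : ∀ i ∈ t, 3 ≤ (E i).length + (E' i).length) : False := by
  have hj : ∀ i ∈ t, ∃ J, IndP G J ∧ J.head? = (E i).head? ∧ J.getLast? = (E' i).head? ∧
      (∀ u, u ∈ J ↔ u ∈ E i ∨ u ∈ E' i) ∧ J.length + 1 = (E i).length + (E' i).length := by
    intro i hi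
    refine indP_join (h.ind i hi) (h'.ind i hi) (h.lst i hi) (h'.lst i hi) ?_
    intro u hu v hv hui hvi
    by_cases hcu : u = c ∧ c ∈ t
    · obtain ⟨rfl, hc⟩ := hcu
      have := h'.cross u hc i hi hui u (h'.mem_last hc) v hv
      refine ⟨this.1, fun hadj => ?_⟩
      have h1 := (this.2 hadj).1
      have h2 := hE u hc
      have h3 := h.self_len hc
      have := indP_ends (h'.ind u hc) (h'.hd u hc) (h'.lst u hc) (by omega)
      exact this.1 h1.symm
    have huA : u ∈ A := by
      rcases h.mem i hi u hu with h1 | h1 | h1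
      · exact h1
      · rcases h.hc with h2 | h2
        · exact h1 ▸ h2
        · exact absurd ⟨h1, h2⟩ hcu
      · exact absurd h1 hui
    have hvB : v ∈ B := by
      rcases h'.mem i hi v hv with h1 | h1
      · exact h1
      · exact absurd h1 hvi
    exact ⟨fun huv => hC.dis u huA (huv ▸ hvB), hC.anti u huA v hvB⟩
  choose! J j1 j2 j3 j4 j5 using hj
  have half : ∀ i ∈ t, ∀ j ∈ t, i ≠ j → ∀ u ∈ E i, ∀ v ∈ E' j, u ≠ c → v ≠ c → 
      u ≠ v ∧ (G.Adj u v → u = d i ∧ v = d j) := by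
    intro i hi j hj hij u hu v hv uc vc
    rcases h.mem i hi u hu with h1 | h1 | h1
    · rcases h'.mem j hj v hv with h2 | h2
      · exact ⟨fun huv => hC.dis u h1 (huv ▸ h2), fun h => absurd h (hC.anti u h1 v h2)⟩
      · subst h2
        have := h.cross i hi v hj hij u hu v (h.mem_last hj) uc vc
        exact ⟨this.1, fun h => absurd h this.2⟩
    · exact absurd h1 uc
    · subst h1
      exact h'.cross u hi j hj hij u (h'.mem_last hi) v hv
  have cross : ∀ i ∈ t, ∀ j ∈ t, i ≠ j → ∀ u ∈ J i, ∀ v ∈ J j, u ≠ c → v ≠ c →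
      u ≠ v ∧ (G.Adj u v → u = d i ∧ v = d j) := by
    intro i hi j hj hij u hu v hv uc vc
    rw [j4 i hi] at hu
    rw [j4 j hj] at hv
    rcases hu with hu | hu <;> rcases hv with hv | hv
    · have := h.cross i hi j hj hij u hu v hv uc vc
      exact ⟨this.1, fun h => absurd h this.2⟩
    · exact half i hi j hj hij u hu v hv uc vc
    · have := half j hj i hi hij.symm v hv u hu vc uc
      exact ⟨this.1.symm, fun h => (this.2 h.symm).symm⟩
    · exact h'.cross i hi j hj hij u hu v hv
  have good : ∀ i ∈ t, ∀ j ∈ t, i ≠ j → 3 ≤ (J i).length ∨ 3 ≤ (J j).length := by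
    intro i hi j hj hij
    have a1 := j5 i hi
    have a2 := j5 j hj
    have b1 := len_pos_of_head (h'.hd i hi)
    have b2 := len_pos_of_head (h'.hd j hj)
    by_cases hc : c ∈ t
    · have key : ∀ k ∈ t, k ≠ c → 3 ≤ (E k).length := fun k hk hkc =>
        len_ge_three (h.ind k hk) (h.hd k hk) (h.lst k hk) hkc.symm (hC.ind c hc k hk)
      by_cases hic : i = c
      · have := key j hj (fun h => hij (hic.trans h.symm)); omega
      · have := key i hi hic; omega
    · have hcA : c ∈ A := h.hc.resolve_right hc
      have key : ∀ k ∈ t, 2 ≤ (E k).length := fun k hk =>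
        len_ge_two (h.hd k hk) (h.lst k hk) (fun hh => hc (hh ▸ hk))
      have k1 := key i hi
      have k2 := key j hj
      rcases h'.two_long hC.symm hi hj hij with h0 | h0 <;> omega
  classical
  obtain ⟨x, y, z, hxy, hxz, hyz, rfl⟩ := Finset.card_eq_three.1 ht
  have hx : x ∈ ({x, y, z} : Finset U) := by simp
  have hy : y ∈ ({x, y, z} : Finset U) := by simp
  have hz : z ∈ ({x, y, z} : Finset U) := by simp
  have g1 := good x hx y hy hxy
  have g2 := good x hx z hz hxz
  have g3 := good y hy z hz hyz
  refine pyramid_false hG.2.2.1 (a := c) (b1 := d x) (b2 := d y) (b3 := d z)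
    (j1 x hx) (j1 y hy) (j1 z hz)
    ((j2 x hx).trans (h.hd x hx)) ((j2 y hy).trans (h.hd y hy)) ((j2 z hz).trans (h.hd z hz))
    ((j3 x hx).trans (h'.hd x hx)) ((j3 y hy).trans (h'.hd y hy)) ((j3 z hz).trans (h'.hd z hz))
    ?_ ?_ ?_ (by omega) (h'.adj x hx y hy hxy) (h'.adj y hy z hz hyz) (h'.adj x hx z hz hxz)
    (cross x hx y hy hxy) (cross x hx z hz hxz) (cross y hy z hz hyz)
  · have := hE x hx; have := j5 x hx; omega
  · have := hE y hy; have := j5 y hy; omega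
  · have := hE z hz; have := j5 z hz; omega

theorem tri_tri (hG : InClassC G) {A B : Set U} {t : Finset U} (ht : t.card = 3)
    (hC : Cfg G A B t) {d d' : U → U} {E E' : U → List U}
    (h : TriGen G A t d E) (h' : TriGen G B t d' E') : False := by
  have hj : ∀ i ∈ t, ∃ J, IndP G J ∧ J.head? = (E i).head? ∧ J.getLast? = (E' i).head? ∧
      (∀ u, u ∈ J ↔ u ∈ E i ∨ u ∈ E' i) ∧ J.length + 1 = (E i).length + (E' i).length := by
    intro i hi
    refine indP_join (h.ind i hi) (h'.ind i hi) (h.lst i hi) (h'.lst i hi) ?_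
    intro u hu v hv hui hvi
    have huA : u ∈ A := (h.mem i hi u hu).resolve_right hui
    have hvB : v ∈ B := (h'.mem i hi v hv).resolve_right hvi
    exact ⟨fun huv => hC.dis u huA (huv ▸ hvB), hC.anti u huA v hvB⟩
  choose! J j1 j2 j3 j4 j5 using hj
  have half : ∀ i ∈ t, ∀ j ∈ t, i ≠ j → ∀ u ∈ E i, ∀ v ∈ E' j,
      u ≠ v ∧ (G.Adj u v → (u = d i ∧ v = d j) ∨ (u = d' i ∧ v = d' j)) := by
    intro i hi j hj hij u hu v hv 
    rcases h.mem i hi u hu with h1 | h1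
    · rcases h'.mem j hj v hv with h2 | h2
      · exact ⟨fun huv => hC.dis u h1 (huv ▸ h2), fun h => absurd h (hC.anti u h1 v h2)⟩
      · subst h2
        have := h.cross i hi v hj hij u hu v (h.mem_last hj)
        exact ⟨this.1, fun h => Or.inl (this.2 h)⟩
    · subst h1
      have := h'.cross u hi j hj hij u (h'.mem_last hi) v hv
      exact ⟨this.1, fun h => Or.inr (this.2 h)⟩
  have cross : ∀ i ∈ t, ∀ j ∈ t, i ≠ j → ∀ u ∈ J i, ∀ v ∈ J j, 
      u ≠ v ∧ (G.Adj u v → (u = d i ∧ v = d j) ∨ (u = d' i ∧ v = d' j)) := by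
    intro i hi j hj hij u hu v hv 
    rw [j4 i hi] at hu
    rw [j4 j hj] at hv
    rcases hu with hu | hu <;> rcases hv with hv | hv
    · have := h.cross i hi j hj hij u hu v hv
      exact ⟨this.1, fun h => Or.inl (this.2 h)⟩
    · exact half i hi j hj hij u hu v hv
    · have := half j hj i hi hij.symm v hv u hu
      refine ⟨this.1.symm, fun h => ?_⟩
      rcases this.2 h.symm with h1 | h1
      · exact Or.inl h1.symm
      · exact Or.inr h1.symm
    · have := h'.cross i hi j hj hij u hu v hv
      exact ⟨this.1, fun h => Or.inr (this.2 h)⟩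
  by_cases hE : ∀ i ∈ t, 2 ≤ (J i).length
  · classical
    obtain ⟨x, y, z, hxy, hxz, hyz, rfl⟩ := Finset.card_eq_three.1 ht
    have hx : x ∈ ({x, y, z} : Finset U) := by simp
    have hy : y ∈ ({x, y, z} : Finset U) := by simp
    have hz : z ∈ ({x, y, z} : Finset U) := by simp
    exact prism_false hG.2.1 
      (j1 x hx) (j1 y hy) (j1 z hz)
      ((j2 x hx).trans (h.hd x hx)) ((j2 y hy).trans (h.hd y hy)) ((j2 z hz).trans (h.hd z hz))
      ((j3 x hx).trans (h'.hd x hx)) ((j3 y hy).trans (h'.hd y hy)) ((j3 z hz).trans (h'.hd z hz))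
      (hE x hx) (hE y hy) (hE z hz)
      (h.adj x hx y hy hxy) (h.adj y hy z hz hyz) (h.adj x hx z hz hxz)
      (h'.adj x hx y hy hxy) (h'.adj y hy z hz hyz) (h'.adj x hx z hz hxz)
      (cross x hx y hy hxy) (cross x hx z hz hxz) (cross y hy z hz hyz)
  · push Not at hE
    obtain ⟨k, hk, hkl⟩ := hE
    have p1 := len_pos_of_head (h.hd k hk)
    have p2 := len_pos_of_head (h'.hd k hk)
    have p3 := j5 k hk
    have dk := (single_of (h.hd k hk) (h.lst k hk) (by omega)).1
    have dk' := (single_of (h'.hd k hk) (h'.lst k hk) (by omega)).1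
    have hkJ : k ∈ J k := (j4 k hk k).2 (Or.inl (h.mem_last hk))
    have long : ∀ i ∈ t, i ≠ k → 3 ≤ (J i).length := by
      intro i hi hik
      have h1 := h.two_long hC hi hk hik
      have h2 := h'.two_long hC.symm hi hk hik
      have := j5 i hi
      omega
    have hkk : ∀ i ∈ t, i ≠ k → ∀ u ∈ J i, k ≠ u ∧ (G.Adj k u ↔ u = d i ∨ u = d' i) := by
      intro i hi hik u hu
      have := cross k hk i hi hik.symm k hkJ u hu
      refine ⟨this.1, fun hh => ?_, ?_⟩
      · rcases this.2 hh with h1 | h1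
        · exact Or.inl h1.2
        · exact Or.inr h1.2
      · have q1 := h.adj k hk i hi hik.symm
        have q2 := h'.adj k hk i hi hik.symm
        rw [dk] at q1
        rw [dk'] at q2
        rintro (rfl | rfl)
        · exact q1
        · exact q2
    have : ∃ x ∈ t, ∃ y ∈ t, x ≠ y ∧ x ≠ k ∧ y ≠ k := by
      classical
      have hcard : (t.erase k).card = 2 := by rw [Finset.card_erase_of_mem hk, ht]
      obtain ⟨x, y, hxy, he⟩ := Finset.card_eq_two.1 hcard
      have hx : x ∈ t.erase k := by rw [he]; simp
      have hy : y ∈ t.erase k := by rw [he]; simp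
      exact ⟨x, Finset.mem_of_mem_erase hx, y, Finset.mem_of_mem_erase hy, hxy,
        Finset.ne_of_mem_erase hx, Finset.ne_of_mem_erase hy⟩
    obtain ⟨x, hx, y, hy, hxy, hxk, hyk⟩ := this
    refine butterfly_false hG.2.2.2.1 (j1 x hx) (j1 y hy) ((j2 x hx).trans (h.hd x hx))
      ((j3 x hx).trans (h'.hd x hx)) ((j2 y hy).trans (h.hd y hy)) ((j3 y hy).trans (h'.hd y hy))
      (long x hx hxk) (long y hy hyk) ?_ (hkk x hx hxk) (hkk y hy hyk)
    intro u hu v hv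
    have := cross x hx y hy hxy u hu v hv
    refine ⟨this.1, this.2, ?_⟩
    rintro (⟨rfl, rfl⟩ | ⟨rfl, rfl⟩)
    · exact h.adj x hx y hy hxy
    · exact h'.adj x hx y hy hxy

def Strong (G : SimpleGraph U) (A : Set U) (t : Finset U) (k : U) : Prop :=
  k ∈ t ∧ ∃ E, ClawGen G A t k E

def Weak (G : SimpleGraph U) (A : Set U) (t : Finset U) (M : U → Prop) : Prop :=
  (∃ c E, c ∈ A ∧ ClawGen G A t c E ∧ ∀ i ∈ t, (E i).length ≤ 2 → M i) ∨
  (∃ d E, TriGen G A t d E ∧ ∀ i ∈ t, (E i).length ≤ 1 → M i)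

theorem T1 (hG : InClassC G) {A B : Set U} {t : Finset U} (ht : t.card = 3)
    (hC : Cfg G A B t) {M M' : U → Prop} (h : Weak G A t M) (h' : Weak G B t M') : False := by
  have two : ∀ {A B : Set U} {c : U} {E : U → List U}, Cfg G A B t → c ∈ A → ClawGen G A t c E →
      ∀ i ∈ t, 2 ≤ (E i).length := by
    intro A B c E hC hc h k hk
    exact len_ge_two (h.hd k hk) (h.lst k hk) (fun hh => hC.tA c (hh ▸ hk) hc)
  rcases h with ⟨c, E, hc, h, -⟩ | ⟨d, E, h, -⟩ <;> rcases h' with ⟨c', E', hc', h', -⟩ | ⟨d', E', h', -⟩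
  · refine claw_claw hG ht hC h h' (fun i hi => ?_)
    have := two hC hc h i hi
    have := two hC.symm hc' h' i hi
    omega
  · refine claw_tri hG ht hC h h' (fun i hi => ?_)
    have := two hC hc h i hi
    have := len_pos_of_head (h'.hd i hi)
    omega
  · refine claw_tri hG ht hC.symm h' h (fun i hi => ?_)
    have := two hC.symm hc' h' i hi
    have := len_pos_of_head (h.hd i hi)
    omega
  · exact tri_tri hG ht hC h h'

theorem T2 (hG : InClassC G) {A B : Set U} {t : Finset U} (ht : t.card = 3)
    (hC : Cfg G A B t) {k : U} {M' : U → Prop} (h : Strong G A t k) (h' : Weak G B t M') : M' k := by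
  obtain ⟨hk, E, h⟩ := h
  by_contra hM
  have three : ∀ i ∈ t, i ≠ k → 3 ≤ (E i).length := fun i hi hik =>
    len_ge_three (h.ind i hi) (h.hd i hi) (h.lst i hi) hik.symm (hC.ind k hk i hi)
  have one := h.self_len hk
  rcases h' with ⟨c', E', hc', h', hm⟩ | ⟨d', E', h', hm⟩
  · refine claw_claw hG ht hC h h' (fun i hi => ?_)
    by_cases hik : i = k
    · subst hik
      have : ¬ (E' i).length ≤ 2 := fun h => hM (hm i hi h)
      omega
    · have := three i hi hik
      have := len_pos_of_head (h'.hd i hi)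
      omega
  · refine claw_tri hG ht hC h h' (fun i hi => ?_)
    by_cases hik : i = k
    · subst hik
      have : ¬ (E' i).length ≤ 1 := fun h => hM (hm i hi h)
      omega
    · have := three i hi hik
      omega

theorem T3 (hG : InClassC G) {A B : Set U} {t : Finset U} (ht : t.card = 3)
    (hC : Cfg G A B t) {k k' : U} (h : Strong G A t k) (h' : Strong G B t k') : k = k' := by
  obtain ⟨hk, E, h⟩ := h
  obtain ⟨hk', E', h'⟩ := h'
  by_contra hkk
  refine claw_claw hG ht hC h h' (fun i hi => ?_)
  have p1 := len_pos_of_head (h'.hd i hi)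
  have p2 := len_pos_of_head (h.hd i hi)
  by_cases hik : i = k
  · have := len_ge_three (h'.ind i hi) (h'.hd i hi) (h'.lst i hi) (fun h => hkk (h.trans hik).symm)
      (hC.ind k' hk' i hi)
    omega
  · have := len_ge_three (h.ind i hi) (h.hd i hi) (h.lst i hi) (fun h => hik h.symm)
      (hC.ind k hk i hi)
    omega

end sides

set_option linter.unusedSectionVars false
set_option linter.unusedVariables false
set_option linter.style.whitespace false

section pathside
variable {U : Type} [DecidableEq U] {G : SimpleGraph U}

theorem gl_append (P R : List U) (c : U) : (P ++ c :: R).getLast? = (c :: R).getLast? := by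
  rw [List.getLast?_append, List.getLast?_cons]; rfl
theorem gl_snoc (P : List U) (c : U) : (P ++ [c]).getLast? = some c := by
  rw [gl_append]; rfl
theorem gl_csnoc (P : List U) (a c : U) : (a :: (P ++ [c])).getLast? = some c := by
  rw [← List.cons_append, gl_snoc]

/-- first element satisfying `q` -/
theorem first_sat {L : List U} {q : U → Prop} (h : ∃ x ∈ L, q x) :
    ∃ L1 c L2, L = L1 ++ c :: L2 ∧ q c ∧ ∀ x ∈ L1, ¬ q x := by
  induction L with
  | nil => simp at h
  | cons a l ih =>
    by_cases ha : q a
    · exact ⟨[], a, l, rfl, ha, by simp⟩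
    · obtain ⟨x, hx, hq⟩ := h
      rcases List.mem_cons.1 hx with rfl | hx
      · exact absurd hq ha
      · obtain ⟨L1, c, L2, rfl, h1, h2⟩ := ih ⟨x, hx, hq⟩
        refine ⟨a :: L1, c, L2, rfl, h1, ?_⟩
        intro x hx
        rcases List.mem_cons.1 hx with rfl | hx
        · exact ha
        · exact h2 x hx

theorem last_sat {L : List U} {q : U → Prop} (h : ∃ x ∈ L, q x) :
    ∃ L1 c L2, L = L1 ++ c :: L2 ∧ q c ∧ ∀ x ∈ L2, ¬ q x := by
  obtain ⟨L1, c, L2, h1, h2, h3⟩ := first_sat (L := L.reverse) (q := q) (by simpa using h)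
  refine ⟨L2.reverse, c, L1.reverse, ?_, h2, by simpa using h3⟩
  have := congrArg List.reverse h1
  simpa using this

theorem indP_snoc {L : List U} {u : U} (h : IndP G L)
    (hu : ∀ x ∈ L, u ≠ x ∧ (G.Adj u x ↔ L.getLast? = some x)) : IndP G (L ++ [u]) := by
  rw [indP_append]
  refine ⟨h, indP_single u, ?_⟩
  intro a ha b hb
  simp only [List.mem_singleton] at hb
  subst hb
  refine ⟨(hu a ha).1.symm, ?_⟩
  rw [G.adj_comm, (hu a ha).2]; simp

def NAP (G : SimpleGraph U) (h : U) (P : List U) : Prop :=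
  ∃ a ∈ P, ∃ b ∈ P, a ≠ b ∧ ¬G.Adj a b ∧ G.Adj h a ∧ G.Adj h b

def sel (u v : U) (Eu Ev Ew : α) : U → α := fun i => if i = u then Eu else if i = v then Ev else Ew

theorem claw_mk {A : Set U} {u v w c : U} {Eu Ev Ew : List U} (huv : u ≠ v) (huw : u ≠ w) (hvw : v ≠ w)
    (hc : c ∈ A ∨ c = w) (iu : IndP G Eu) (iv : IndP G Ev) (iw : IndP G Ew)
    (du : Eu.head? = some c) (dv : Ev.head? = some c) (dw : Ew.head? = some c)
    (lu : Eu.getLast? = some u) (lv : Ev.getLast? = some v) (lw : Ew.getLast? = some w)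
    (mu : ∀ x ∈ Eu, x ∈ A ∨ x = c ∨ x = u) (mv : ∀ x ∈ Ev, x ∈ A ∨ x = c ∨ x = v)
    (mw : ∀ x ∈ Ew, x ∈ A ∨ x = c ∨ x = w)
    (xuv : ∀ x ∈ Eu, ∀ y ∈ Ev, x ≠ c → y ≠ c → x ≠ y ∧ ¬G.Adj x y)
    (xuw : ∀ x ∈ Eu, ∀ y ∈ Ew, x ≠ c → y ≠ c → x ≠ y ∧ ¬G.Adj x y)
    (xvw : ∀ x ∈ Ev, ∀ y ∈ Ew, x ≠ c → y ≠ c → x ≠ y ∧ ¬G.Adj x y) :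
    ClawGen G A {u, v, w} c (sel u v Eu Ev Ew) := by
  have s1 : sel u v Eu Ev Ew u = Eu := by simp [sel]
  have s2 : sel u v Eu Ev Ew v = Ev := by simp [sel, huv.symm]
  have s3 : sel u v Eu Ev Ew w = Ew := by simp [sel, huw.symm, hvw.symm]
  have sw : ∀ {X Y : List U}, (∀ x ∈ X, ∀ y ∈ Y, x ≠ c → y ≠ c → x ≠ y ∧ ¬G.Adj x y) →
    (∀ x ∈ Y, ∀ y ∈ X, x ≠ c → y ≠ c → x ≠ y ∧ ¬G.Adj x y) := fun h x hx y hy a b =>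
      ⟨(h y hy x hx b a).1.symm, fun hh => (h y hy x hx b a).2 hh.symm⟩
  constructor
  · rcases hc with h | h
    · exact Or.inl h
    · right; simp [h]
  · intro i hi; simp only [Finset.mem_insert, Finset.mem_singleton] at hi
    rcases hi with rfl | rfl | rfl
    · rwa [s1]
    · rwa [s2]
    · rwa [s3]
  · intro i hi; simp only [Finset.mem_insert, Finset.mem_singleton] at hi
    rcases hi with rfl | rfl | rfl
    · rwa [s1]
    · rwa [s2]
    · rwa [s3]
  · intro i hi; simp only [Finset.mem_insert, Finset.mem_singleton] at hi
    rcases hi with rfl | rfl | rfl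
    · rwa [s1]
    · rwa [s2]
    · rwa [s3]
  · intro i hi; simp only [Finset.mem_insert, Finset.mem_singleton] at hi
    rcases hi with rfl | rfl | rfl
    · rwa [s1]
    · rwa [s2]
    · rwa [s3]
  · intro i hi j hj hij; simp only [Finset.mem_insert, Finset.mem_singleton] at hi hj
    rcases hi with rfl | rfl | rfl <;> rcases hj with rfl | rfl | rfl
    · exact absurd rfl hij
    · rw [s1, s2]; exact xuv
    · rw [s1, s3]; exact xuw
    · rw [s1, s2]; exact sw xuv
    · exact absurd rfl hij
    · rw [s3, s2]; exact xvw
    · rw [s1, s3]; exact sw xuw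
    · rw [s3, s2]; exact sw xvw
    · exact absurd rfl hij

theorem tri_mk {A : Set U} {u v w cu cv cw : U} {Eu Ev Ew : List U} (huv : u ≠ v) (huw : u ≠ w) (hvw : v ≠ w)
    (auv : G.Adj cu cv) (auw : G.Adj cu cw) (avw : G.Adj cv cw)
    (iu : IndP G Eu) (iv : IndP G Ev) (iw : IndP G Ew)
    (du : Eu.head? = some cu) (dv : Ev.head? = some cv) (dw : Ew.head? = some cw)
    (lu : Eu.getLast? = some u) (lv : Ev.getLast? = some v) (lw : Ew.getLast? = some w)
    (mu : ∀ x ∈ Eu, x ∈ A ∨ x = u) (mv : ∀ x ∈ Ev, x ∈ A ∨ x = v)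
    (mw : ∀ x ∈ Ew, x ∈ A ∨ x = w)
    (xuv : ∀ x ∈ Eu, ∀ y ∈ Ev, x ≠ y ∧ (G.Adj x y → x = cu ∧ y = cv))
    (xuw : ∀ x ∈ Eu, ∀ y ∈ Ew, x ≠ y ∧ (G.Adj x y → x = cu ∧ y = cw))
    (xvw : ∀ x ∈ Ev, ∀ y ∈ Ew, x ≠ y ∧ (G.Adj x y → x = cv ∧ y = cw)) :
    TriGen G A {u, v, w} (sel u v cu cv cw) (sel u v Eu Ev Ew) := by
  have s1 : sel u v Eu Ev Ew u = Eu := by simp [sel]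
  have s2 : sel u v Eu Ev Ew v = Ev := by simp [sel, huv.symm]
  have s3 : sel u v Eu Ev Ew w = Ew := by simp [sel, huw.symm, hvw.symm]
  have r1 : sel u v cu cv cw u = cu := by simp [sel]
  have r2 : sel u v cu cv cw v = cv := by simp [sel, huv.symm]
  have r3 : sel u v cu cv cw w = cw := by simp [sel, huw.symm, hvw.symm]
  have sw : ∀ {X Y : List U} {a b : U}, (∀ x ∈ X, ∀ y ∈ Y, x ≠ y ∧ (G.Adj x y → x = a ∧ y = b)) →
    (∀ x ∈ Y, ∀ y ∈ X, x ≠ y ∧ (G.Adj x y → x = b ∧ y = a)) := fun h x hx y hy =>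
      ⟨(h y hy x hx).1.symm, fun hh => ((h y hy x hx).2 hh.symm).symm⟩
  constructor
  · intro i hi j hj hij; simp only [Finset.mem_insert, Finset.mem_singleton] at hi hj
    rcases hi with rfl | rfl | rfl <;> rcases hj with rfl | rfl | rfl
    · exact absurd rfl hij
    · rw [r1, r2]; exact auv
    · rw [r1, r3]; exact auw
    · rw [r1, r2]; exact auv.symm
    · exact absurd rfl hij
    · rw [r3, r2]; exact avw
    · rw [r1, r3]; exact auw.symm
    · rw [r3, r2]; exact avw.symm
    · exact absurd rfl hij
  · intro i hi; simp only [Finset.mem_insert, Finset.mem_singleton] at hi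
    rcases hi with rfl | rfl | rfl
    · rwa [s1]
    · rwa [s2]
    · rwa [s3]
  · intro i hi; simp only [Finset.mem_insert, Finset.mem_singleton] at hi
    rcases hi with rfl | rfl | rfl
    · rwa [s1, r1]
    · rwa [s2, r2]
    · rwa [s3, r3]
  · intro i hi; simp only [Finset.mem_insert, Finset.mem_singleton] at hi
    rcases hi with rfl | rfl | rfl
    · rwa [s1]
    · rwa [s2]
    · rwa [s3]
  · intro i hi; simp only [Finset.mem_insert, Finset.mem_singleton] at hi
    rcases hi with rfl | rfl | rfl
    · rwa [s1]
    · rwa [s2]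
    · rwa [s3]
  · intro i hi j hj hij; simp only [Finset.mem_insert, Finset.mem_singleton] at hi hj
    rcases hi with rfl | rfl | rfl <;> rcases hj with rfl | rfl | rfl
    · exact absurd rfl hij
    · rw [s1, s2, r1, r2]; exact xuv
    · rw [s1, s3, r1, r3]; exact xuw
    · rw [s1, s2, r1, r2]; exact sw xuv
    · exact absurd rfl hij
    · rw [s3, s2, r3, r2]; exact xvw
    · rw [s1, s3, r1, r3]; exact sw xuw
    · rw [s3, s2, r3, r2]; exact sw xvw
    · exact absurd rfl hij

/-- Adjacent exactly to the head. -/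
def AtH (G : SimpleGraph U) (u : U) (P : List U) : Prop := ∀ p ∈ P, (G.Adj u p ↔ P.head? = some p)
/-- Adjacent exactly to the last. -/
def AtL (G : SimpleGraph U) (u : U) (P : List U) : Prop := ∀ p ∈ P, (G.Adj u p ↔ P.getLast? = some p)

theorem AtH.rev {u : U} {P : List U} (h : AtH G u P) : AtL G u P.reverse := by
  intro p hp; rw [h p (by simpa using hp)]; simp
theorem AtL.rev {u : U} {P : List U} (h : AtL G u P) : AtH G u P.reverse := by
  intro p hp; rw [h p (by simpa using hp)]; simp

theorem path_side {A : Set U} {P Z : List U} {u v w h : U}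
    (hP : IndP G P) (hPA : ∀ p ∈ P, p ∈ A)
    (hu : AtH G u P) (hv : AtL G v P)
    (hZ : IndP G Z) (hZh : Z.head? = some h) (hZw : Z.getLast? = some w)
    (hZA : ∀ z ∈ Z, z = w ∨ (z ∈ A ∧ z ∉ P))
    (hZP : ∀ z ∈ Z, z ≠ h → ∀ p ∈ P, ¬G.Adj z p) (hh : ∃ p ∈ P, G.Adj h p)
    (huZ : ∀ z ∈ Z, ¬G.Adj u z) (hvZ : ∀ z ∈ Z, ¬G.Adj v z)
    (uA : u ∉ A) (vA : v ∉ A) (wA : w ∉ A) (huv : u ≠ v) (huw : u ≠ w) (hvw : v ≠ w)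
    (nuv : ¬G.Adj u v) :
    (Z = [w] ∧ h = w ∧ Strong G A {u, v, w} w ∧ NAP G w P) ∨
    Weak G A {u, v, w} (fun i => (i = u → AtH G h P) ∧ (i = v → AtL G h P) ∧
      (i = w → Z = [w] ∨ (Z.length = 2 ∧ NAP G h P))) := by
  have uP : ∀ p ∈ P, u ≠ p := fun p hp e => uA (e ▸ hPA p hp)
  have vP : ∀ p ∈ P, v ≠ p := fun p hp e => vA (e ▸ hPA p hp)
  have uZ : ∀ z ∈ Z, u ≠ z := fun z hz e => by
    rcases hZA z hz with h1 | h1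
    · exact huw (e.trans h1)
    · exact uA (e ▸ h1.1)
  have vZ : ∀ z ∈ Z, v ≠ z := fun z hz e => by
    rcases hZA z hz with h1 | h1
    · exact hvw (e.trans h1)
    · exact vA (e ▸ h1.1)
  have PZ : ∀ p ∈ P, ∀ z ∈ Z, p ≠ z := fun p hp z hz e => by
    rcases hZA z hz with h1 | h1
    · exact wA (h1 ▸ e ▸ hPA p hp)
    · exact h1.2 (e ▸ hp)
  have hhZ : h ∈ Z := List.mem_of_head? hZh
  have hwZ : w ∈ Z := List.mem_of_getLast? hZw
  have s1 : ∀ (a b c : List U), sel u v a b c u = a := by intros; simp [sel]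
  have s2 : ∀ (a b c : List U), sel u v a b c v = b := by intros; simp [sel, huv.symm]
  have s3 : ∀ (a b c : List U), sel u v a b c w = c := by intros; simp [sel, huw.symm, hvw.symm]
  obtain ⟨P1, c, R, hPe, hc, hP1⟩ := first_sat (q := fun p => G.Adj h p) hh
  have hcP : c ∈ P := by rw [hPe]; simp
  have hP1P : ∀ x ∈ P1, x ∈ P := fun x hx => by rw [hPe]; simp [hx]
  have hRP : ∀ x ∈ R, x ∈ P := fun x hx => by rw [hPe]; simp [hx]
  have hPi := hP
  rw [hPe] at hPi
  have hPa := indP_append.1 hPi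
  have hheadeq : (c :: P1.reverse).getLast? = P.head? := by
    rw [hPe]; rw [show c :: P1.reverse = (P1 ++ [c]).reverse by simp, List.getLast?_reverse]
    cases P1 <;> simp
  have iLU : IndP G (c :: P1.reverse) := by
    have : IndP G (P1 ++ [c]) := indP_append_left (L2 := R) (by simpa using hPi)
    simpa using indP_reverse this
  have memLU : ∀ x, x ∈ c :: P1.reverse ↔ x = c ∨ x ∈ P1 := by simp
  have LUP : ∀ x ∈ c :: P1.reverse, x ∈ P := fun x hx => by
    rcases (memLU x).1 hx with rfl | hx
    · exact hcP
    · exact hP1P x hx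
  have iEu : IndP G ((c :: P1.reverse) ++ [u]) := by
    refine indP_snoc iLU ?_
    intro x hx
    refine ⟨uP x (LUP x hx), ?_⟩
    rw [hheadeq]; exact hu x (LUP x hx)
  have headmem : ∀ x, P.head? = some x → x = c ∨ x ∈ P1 := by
    intro x hx
    rw [← hheadeq] at hx
    exact (memLU x).1 (List.mem_of_getLast? hx)
  have uR : ∀ x ∈ R, ¬G.Adj u x := by
    intro x hx hux
    rw [hu x (hRP x hx)] at hux
    rcases headmem x hux with rfl | h1
    · exact hPa.2.1.1 x hx rfl
    · exact (hPa.2.2 x h1 x (by simp [hx])).1 rfl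
  have P1R : ∀ x ∈ P1, ∀ y ∈ R, x ≠ y ∧ ¬G.Adj x y := by
    intro x hx y hy
    have := hPa.2.2 x hx y (by simp [hy])
    refine ⟨this.1, fun hh => ?_⟩
    have := (this.2.1 hh).2
    simp at this
    exact hPa.2.1.1 y hy this
  have P1Z : ∀ x ∈ P1, ∀ z ∈ Z, ¬G.Adj x z := by
    intro x hx z hz hxz
    by_cases hzh : z = h
    · subst hzh; exact hP1 x hx hxz.symm
    · exact hZP z hz hzh x (hP1P x hx) hxz.symm
  by_cases hR : ∃ p ∈ R, G.Adj h p
  swap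
  · -- single neighbour
    push Not at hR
    right; left
    have RZ : ∀ x ∈ R, ∀ z ∈ Z, ¬G.Adj x z := by
      intro x hx z hz hxz
      by_cases hzh : z = h
      · subst hzh; exact hR x hx hxz.symm
      · exact hZP z hz hzh x (hRP x hx) hxz.symm
    have hlasteq : (c :: R).getLast? = P.getLast? := by rw [hPe, gl_append]
    have vP1 : ∀ x ∈ P1, ¬G.Adj v x := by
      intro x hx hux
      rw [hv x (hP1P x hx), ← hlasteq] at hux
      exact (hPa.2.2 x hx x (List.mem_of_getLast? hux)).1 rfl
    have cRP : ∀ x ∈ c :: R, x ∈ P := fun x hx => by rw [hPe]; exact List.mem_append_right _ hx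
    refine ⟨c, sel u v ((c :: P1.reverse) ++ [u]) ((c :: R) ++ [v]) (c :: Z), hPA c hcP, ?_, ?_⟩
    · refine claw_mk huv huw hvw (Or.inl (hPA c hcP)) iEu ?_ ?_ rfl rfl rfl (gl_snoc _ _) (gl_snoc _ _) ?_ ?_ ?_ ?_
        ?_ ?_ ?_
      · refine indP_snoc hPa.2.1 ?_
        intro x hx
        exact ⟨vP x (cRP x hx), by rw [hlasteq]; exact hv x (cRP x hx)⟩
      · refine ⟨fun b hb => PZ c hcP b hb, fun b hb => ?_, hZ⟩
        rw [hZh]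
        constructor
        · intro hcb
          by_contra hne
          exact hZP b hb (fun e => hne (by rw [e])) c hcP hcb.symm
        · intro e; simp at e; subst e; exact hc.symm
      · rw [List.getLast?_cons, hZw]; rfl
      · intro x hx
        rcases List.mem_append.1 hx with hx | hx
        · exact Or.inl (hPA x (LUP x hx))
        · simp at hx; tauto
      · intro x hx
        rcases List.mem_append.1 hx with hx | hx
        · exact Or.inl (hPA x (cRP x hx))
        · simp at hx; tauto
      · intro x hx
        rcases List.mem_cons.1 hx with hx | hx
        · tauto
        · rcases hZA x hx with h1 | h1 <;> tauto
      · intro x hx y hy hxc hyc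
        simp only [List.mem_append, memLU, List.mem_cons, List.not_mem_nil, or_false] at hx hy
        rcases hx with (hx | hx) | rfl
        · exact absurd hx hxc
        · rcases hy with (hy | hy) | rfl
          · exact absurd hy hyc
          · exact P1R x hx y hy
          · exact ⟨(vP x (hP1P x hx)).symm, fun hh => vP1 x hx hh.symm⟩
        · rcases hy with (hy | hy) | rfl
          · exact absurd hy hyc
          · exact ⟨uP y (hRP y hy), uR y hy⟩
          · exact ⟨huv, nuv⟩
      · intro x hx y hy hxc hyc
        simp only [List.mem_append, memLU, List.mem_cons, List.not_mem_nil, or_false] at hx hy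
        have hy := hy.resolve_left hyc
        rcases hx with (hx | hx) | rfl
        · exact absurd hx hxc
        · exact ⟨PZ x (hP1P x hx) y hy, P1Z x hx y hy⟩
        · exact ⟨uZ y hy, huZ y hy⟩
      · intro x hx y hy hxc hyc
        simp only [List.mem_append, List.mem_cons, List.not_mem_nil, or_false] at hx hy
        have hy := hy.resolve_left hyc
        rcases hx with (hx | hx) | rfl
        · exact absurd hx hxc
        · exact ⟨PZ x (hRP x hx) y hy, RZ x hx y hy⟩
        · exact ⟨vZ y hy, hvZ y hy⟩
    · intro i hi hl
      have adjc : ∀ p ∈ P, G.Adj h p → p = c := by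
        intro p hp hhp
        rw [hPe] at hp
        rcases List.mem_append.1 hp with h1 | h1
        · exact absurd hhp (hP1 p h1)
        · rcases List.mem_cons.1 h1 with h1 | h1
          · exact h1
          · exact absurd hhp (hR p h1)
      refine ⟨?_, ?_, ?_⟩
      · rintro rfl
        rw [s1] at hl
        have : P1 = [] := by
          have : P1.length = 0 := by simp at hl; simp [hl]
          exact List.length_eq_zero_iff.1 this
        subst this
        intro p hp
        rw [hPe]
        constructor
        · intro hhp; simp [adjc p hp hhp]
        · intro e; simp at e; rw [← e]; exact hc
      · rintro rfl
        rw [s2] at hl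
        have : R = [] := by
          have : R.length = 0 := by simp at hl; simp [hl]
          exact List.length_eq_zero_iff.1 this
        subst this
        intro p hp
        rw [hPe]
        constructor
        · intro hhp; simp [adjc p hp hhp]
        · intro e; simp at e; rw [← e]; exact hc
      · rintro rfl
        rw [s3] at hl
        left
        have := single_of hZh hZw (by simpa using hl)
        rw [← this.1]; exact this.2
  obtain ⟨P2, c', P3, hRe, hc', hP3⟩ := last_sat hR
  have hc'R : c' ∈ R := by rw [hRe]; simp
  have hP3R : ∀ x ∈ P3, x ∈ R := fun x hx => by rw [hRe]; simp [hx]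
  have hRi := hPa.2.1
  have hRI : IndP G (c :: R) := hRi
  rw [hRe] at hRi
  have hPb := (indP_append (L1 := c :: P2) (L2 := c' :: P3)).1 (by simpa using hRi)
  have hlasteq : (c' :: P3).getLast? = P.getLast? := by
    rw [hPe, hRe, gl_append, ← List.cons_append, gl_append]
  have cP3R : ∀ x ∈ c' :: P3, x ∈ R := fun x hx => by rw [hRe]; exact List.mem_append_right _ hx
  have P3Z : ∀ x ∈ P3, ∀ z ∈ Z, ¬G.Adj x z := by
    intro x hx z hz hxz
    by_cases hzh : z = h
    · subst hzh; exact hP3 x hx hxz.symm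
    · exact hZP z hz hzh x (hRP x (hP3R x hx)) hxz.symm
  have cZ : ∀ z ∈ Z, G.Adj c z → z = h := fun z hz hh => by
    by_contra hne; exact hZP z hz hne c hcP hh.symm
  have c'Z : ∀ z ∈ Z, G.Adj c' z → z = h := fun z hz hh => by
    by_contra hne; exact hZP z hz hne c' (hRP c' hc'R) hh.symm
  have iEv : IndP G ((c' :: P3) ++ [v]) := by
    refine indP_snoc hPb.2.1 ?_
    intro x hx
    exact ⟨vP x (hRP x (cP3R x hx)), by rw [hlasteq]; exact hv x (hRP x (cP3R x hx))⟩
  have vc : ¬G.Adj v c := by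
    intro hvc
    rw [hv c hcP, ← hlasteq] at hvc
    exact (hPb.2.2 c (by simp) c (List.mem_of_getLast? hvc)).1 rfl
  have vP1 : ∀ x ∈ P1, ¬G.Adj v x := by
    intro x hx hux
    rw [hv x (hP1P x hx), ← hlasteq] at hux
    exact (P1R x hx x (cP3R x (List.mem_of_getLast? hux))).1 rfl
  have cP3 : ∀ y ∈ P3, c ≠ y ∧ ¬G.Adj c y := by
    intro y hy
    have := hPb.2.2 c (by simp) y (by simp [hy])
    refine ⟨this.1, fun hh => ?_⟩
    have := (this.2.1 hh).2
    simp at this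
    exact hPb.2.1.1 y hy this
  have hcc' : c ≠ c' := hRI.1 c' hc'R
  have hcP2 : P2 ≠ [] → ¬G.Adj c c' := by
    intro hne hcc
    have := (hRI.2.1 c' hc'R).1 hcc
    rw [hRe] at this
    cases P2 with
    | nil => exact hne rfl
    | cons a l =>
      simp at this
      subst this
      exact (hPb.2.2 a (by simp) a (by simp)).1 rfl
  -- cross between u-branch and v-branch
  have xuv : ∀ x ∈ (c :: P1.reverse) ++ [u], ∀ y ∈ (c' :: P3) ++ [v],
      x ≠ y ∧ (G.Adj x y → x = c ∧ y = c') := by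
    intro x hx y hy
    simp only [List.mem_append, memLU, List.mem_cons, List.not_mem_nil, or_false] at hx hy
    rcases hx with (rfl | hx) | rfl
    · rcases hy with (rfl | hy) | rfl
      · exact ⟨hcc', fun _ => ⟨rfl, rfl⟩⟩
      · exact ⟨(cP3 y hy).1, fun hh => absurd hh (cP3 y hy).2⟩
      · exact ⟨(vP x hcP).symm, fun hh => absurd hh.symm vc⟩
    · rcases hy with (rfl | hy) | rfl
      · exact ⟨(P1R x hx y hc'R).1, fun hh => absurd hh (P1R x hx y hc'R).2⟩
      · exact ⟨(P1R x hx y (hP3R y hy)).1, fun hh => absurd hh (P1R x hx y (hP3R y hy)).2⟩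
      · exact ⟨(vP x (hP1P x hx)).symm, fun hh => absurd hh.symm (vP1 x hx)⟩
    · rcases hy with (rfl | hy) | rfl
      · exact ⟨uP y (hRP y hc'R), fun hh => absurd hh (uR y hc'R)⟩
      · exact ⟨uP y (hRP y (hP3R y hy)), fun hh => absurd hh (uR y (hP3R y hy))⟩
      · exact ⟨huv, fun hh => absurd hh nuv⟩
  have xuw : ∀ x ∈ (c :: P1.reverse) ++ [u], ∀ y ∈ Z, x ≠ y ∧ (G.Adj x y → x = c ∧ y = h) := by
    intro x hx y hy
    simp only [List.mem_append, memLU, List.mem_singleton] at hx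
    rcases hx with (rfl | hx) | rfl
    · exact ⟨PZ x hcP y hy, fun hh => ⟨rfl, cZ y hy hh⟩⟩
    · exact ⟨PZ x (hP1P x hx) y hy, fun hh => absurd hh (P1Z x hx y hy)⟩
    · exact ⟨uZ y hy, fun hh => absurd hh (huZ y hy)⟩
  have xvw : ∀ x ∈ (c' :: P3) ++ [v], ∀ y ∈ Z, x ≠ y ∧ (G.Adj x y → x = c' ∧ y = h) := by
    intro x hx y hy
    simp only [List.mem_append, List.mem_cons, List.not_mem_nil, or_false] at hx
    rcases hx with (rfl | hx) | rfl
    · exact ⟨PZ x (hRP x hc'R) y hy, fun hh => ⟨rfl, c'Z y hy hh⟩⟩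
    · exact ⟨PZ x (hRP x (hP3R x hx)) y hy, fun hh => absurd hh (P3Z x hx y hy)⟩
    · exact ⟨vZ y hy, fun hh => absurd hh (hvZ y hy)⟩
  have mEu : ∀ x ∈ (c :: P1.reverse) ++ [u], x ∈ A ∨ x = u := by
    intro x hx
    rcases List.mem_append.1 hx with hx | hx
    · exact Or.inl (hPA x (LUP x hx))
    · simp at hx; tauto
  have mEv : ∀ x ∈ (c' :: P3) ++ [v], x ∈ A ∨ x = v := by
    intro x hx
    rcases List.mem_append.1 hx with hx | hx
    · exact Or.inl (hPA x (hRP x (cP3R x hx)))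
    · simp at hx; tauto
  by_cases hP2 : P2 = []
  · -- triangle
    subst hP2
    right; right
    refine ⟨sel u v c c' h, sel u v ((c :: P1.reverse) ++ [u]) ((c' :: P3) ++ [v]) Z, ?_, ?_⟩
    · refine tri_mk huv huw hvw ?_ hc.symm hc'.symm iEu iEv hZ rfl rfl hZh (gl_snoc _ _) (gl_snoc _ _) hZw mEu mEv
        ?_ xuv xuw xvw
      · rw [hRI.2.1 c' hc'R, hRe]; rfl
      · intro x hx
        rcases hZA x hx with h1 | h1 <;> tauto
    · intro i hi hl
      refine ⟨?_, ?_, ?_⟩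
      · rintro rfl; rw [s1] at hl; simp at hl
      · rintro rfl; rw [s2] at hl; simp at hl
      · rintro rfl
        rw [s3] at hl
        left
        have := single_of hZh hZw hl
        rw [← this.1]; exact this.2
  · have hnap : NAP G h P := ⟨c, hcP, c', hRP c' hc'R, hcc', hcP2 hP2, hc, hc'⟩
    have hclaw : ClawGen G A {u, v, w} h (sel u v (h :: ((c :: P1.reverse) ++ [u])) (h :: ((c' :: P3) ++ [v])) Z) := by
      refine claw_mk huv huw hvw ?_ ?_ ?_ hZ rfl rfl hZh (gl_csnoc _ _ _) (gl_csnoc _ _ _) hZw ?_ ?_ ?_ ?_ ?_ ?_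
      · rcases hZA h hhZ with h1 | h1
        · exact Or.inr h1
        · exact Or.inl h1.1
      · refine ⟨fun b hb => (xuw b hb h hhZ).1.symm, fun b hb => ?_, iEu⟩
        constructor
        · intro hh; rw [((xuw b hb h hhZ).2 hh.symm).1]; rfl
        · intro e; simp at e; subst e; exact hc
      · refine ⟨fun b hb => (xvw b hb h hhZ).1.symm, fun b hb => ?_, iEv⟩
        constructor
        · intro hh; rw [((xvw b hb h hhZ).2 hh.symm).1]; rfl
        · intro e; simp at e; subst e; exact hc'
      · intro x hx
        rcases List.mem_cons.1 hx with hx | hx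
        · tauto
        · rcases mEu x hx with h1 | h1 <;> tauto
      · intro x hx
        rcases List.mem_cons.1 hx with hx | hx
        · tauto
        · rcases mEv x hx with h1 | h1 <;> tauto
      · intro x hx
        rcases hZA x hx with h1 | h1 <;> tauto
      · intro x hx y hy hxc hyc
        have hx := (List.mem_cons.1 hx).resolve_left hxc
        have hy := (List.mem_cons.1 hy).resolve_left hyc
        refine ⟨(xuv x hx y hy).1, fun hh => ?_⟩
        obtain ⟨rfl, rfl⟩ := (xuv x hx y hy).2 hh
        exact hcP2 hP2 hh
      · intro x hx y hy hxc hyc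
        have hx := (List.mem_cons.1 hx).resolve_left hxc
        exact ⟨(xuw x hx y hy).1, fun hh => hyc ((xuw x hx y hy).2 hh).2⟩
      · intro x hx y hy hxc hyc
        have hx := (List.mem_cons.1 hx).resolve_left hxc
        exact ⟨(xvw x hx y hy).1, fun hh => hyc ((xvw x hx y hy).2 hh).2⟩
    by_cases hZ1 : Z.length ≤ 1
    · have := single_of hZh hZw hZ1
      left
      obtain ⟨e1, e2⟩ := this
      subst e1
      exact ⟨e2, rfl, ⟨by simp, _, hclaw⟩, hnap⟩
    · right; left
      have hne : h ≠ w := fun e => (indP_ends hZ hZh hZw (by omega)).1 e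
      refine ⟨h, _, ((hZA h hhZ).resolve_left hne).1, hclaw, ?_⟩
      intro i hi hl
      refine ⟨?_, ?_, ?_⟩
      · rintro rfl; rw [s1] at hl; simp at hl
      · rintro rfl; rw [s2] at hl; simp at hl
      · rintro rfl; rw [s3] at hl
        exact Or.inr ⟨by omega, hnap⟩

end pathside

set_option linter.unusedSectionVars false
set_option linter.unusedVariables false

section conn
variable {U : Type} [DecidableEq U] {G : SimpleGraph U}

/-- reachability inside `A` -/
def Rch (G : SimpleGraph U) (A : Set U) : U → U → Prop :=
  Relation.ReflTransGen (fun x y => G.Adj x y ∧ x ∈ A ∧ y ∈ A)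

def Conn (G : SimpleGraph U) (A : Set U) : Prop :=
  A.Nonempty ∧ ∀ a ∈ A, ∀ b ∈ A, Rch G A a b

def Att (G : SimpleGraph U) (z : U) (A : Set U) : Prop := ∃ a ∈ A, G.Adj z a

theorem Rch.symm {A : Set U} {a b : U} (h : Rch G A a b) : Rch G A b a := by
  induction h with
  | refl => exact .refl
  | tail _ h ih => exact .head ⟨h.1.symm, h.2.2, h.2.1⟩ ih

theorem Rch.trans {A : Set U} {a b c : U} (h : Rch G A a b) (h' : Rch G A b c) : Rch G A a c :=
  Relation.ReflTransGen.trans h h'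

theorem Rch.mono {A B : Set U} (hAB : A ⊆ B) {a b : U} (h : Rch G A a b) : Rch G B a b := by
  induction h with
  | refl => exact .refl
  | tail _ h ih => exact Relation.ReflTransGen.tail ih ⟨h.1, hAB h.2.1, hAB h.2.2⟩

theorem Rch.single {A : Set U} {a b : U} (h : G.Adj a b) (ha : a ∈ A) (hb : b ∈ A) : Rch G A a b :=
  Relation.ReflTransGen.single ⟨h, ha, hb⟩

theorem Rch.mem {A : Set U} {a b : U} (h : Rch G A a b) (ha : a ∈ A) : b ∈ A := by
  induction h with
  | refl => exact ha
  | tail _ h ih => exact h.2.2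

theorem conn_singleton (a : U) : Conn G {a} := by
  refine ⟨⟨a, rfl⟩, ?_⟩
  rintro x rfl y rfl; exact .refl

theorem conn_of_root {A : Set U} {r : U} (hr : r ∈ A) (h : ∀ a ∈ A, Rch G A r a) : Conn G A :=
  ⟨⟨r, hr⟩, fun a ha b hb => (h a ha).symm.trans (h b hb)⟩

theorem conn_union {A B : Set U} (hA : Conn G A) (hB : Conn G B) {a b : U} (ha : a ∈ A) (hb : b ∈ B)
    (hab : a = b ∨ G.Adj a b) : Conn G (A ∪ B) := by
  refine conn_of_root (Or.inl ha : a ∈ A ∪ B) ?_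
  have hab : Rch G (A ∪ B) a b := by
    rcases hab with rfl | h
    · exact .refl
    · exact Rch.single h (Or.inl ha) (Or.inr hb)
  rintro x (hx | hx)
  · exact (hA.2 a ha x hx).mono Set.subset_union_left
  · exact hab.trans ((hB.2 b hb x hx).mono Set.subset_union_right)

theorem conn_insert {A : Set U} (hA : Conn G A) {a b : U} (ha : a ∈ A) (hab : G.Adj a b) :
    Conn G (insert b A) := by
  have := conn_union hA (conn_singleton (G := G) b) ha rfl (Or.inr hab)
  rwa [Set.union_singleton] at this

/-- component of `a` in `X` -/
def cpt (G : SimpleGraph U) (X : Set U) (a : U) : Set U := {b | Rch G X a b}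

theorem cpt_self {X : Set U} (a : U) : a ∈ cpt G X a := Relation.ReflTransGen.refl

theorem cpt_sub {X : Set U} {a : U} (ha : a ∈ X) : cpt G X a ⊆ X := fun b hb => Rch.mem hb ha

theorem cpt_closed {X : Set U} {a b c : U} (ha : a ∈ X) (hb : b ∈ cpt G X a) (hc : c ∈ X) (h : G.Adj b c) :
    c ∈ cpt G X a := Rch.trans hb (Rch.single h (cpt_sub ha hb) hc)

theorem cpt_conn {X : Set U} {a : U} (ha : a ∈ X) : Conn G (cpt G X a) := by
  refine conn_of_root (cpt_self a) ?_
  intro b hb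
  have hb' : Rch G X a b := hb
  clear hb
  induction hb' with
  | refl => exact .refl
  | tail h h2 ih => 
    exact ih.trans (Rch.single h2.1 h (cpt_closed ha h h2.2.2 h2.1))

theorem conn_sub_cpt {X S : Set U} (hS : Conn G S) (hX : S ⊆ X) {a : U} (ha : a ∈ S) : S ⊆ cpt G X a :=
  fun b hb => (hS.2 a ha b hb).mono hX

/-- leaving a set -/
theorem rch_leave {A T : Set U} {a b : U} (h : Rch G A a b) (haA : a ∈ A) (ha : a ∉ T) (hb : b ∈ T) :
    ∃ c d, Rch G (A \ T) a c ∧ c ∈ A ∧ c ∉ T ∧ G.Adj c d ∧ d ∈ T ∧ d ∈ A := by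
  induction h using Relation.ReflTransGen.head_induction_on with
  | refl => exact absurd hb ha
  | head h h2 ih => 
    rename_i x y
    by_cases hy : y ∈ T
    · exact ⟨x, y, .refl, haA, ha, h.1, hy, h.2.2⟩
    · obtain ⟨c, d, h3, h4, h5, h6, h7⟩ := ih h.2.2 hy
      exact ⟨c, d, (Rch.single (A := A \ T) h.1 ⟨haA, ha⟩ ⟨h.2.2, hy⟩).trans h3, h4, h5, h6, h7⟩

theorem conn_step {A S : Set U} (hA : Conn G A) (hS : S ⊆ A) (hn : S.Nonempty) (hne : S ≠ A) :
    ∃ s ∈ S, ∃ b ∈ A, b ∉ S ∧ G.Adj s b := by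
  obtain ⟨s, hs⟩ := hn
  have : ∃ b ∈ A, b ∉ S := by
    by_contra hcon; push Not at hcon; exact hne (hS.antisymm hcon)
  obtain ⟨b, hb, hbS⟩ := this
  obtain ⟨c, d, _, h2, h3, h4, h5, h6⟩ := rch_leave (hA.2 b hb s (hS hs)) hb hbS hs
  exact ⟨d, h5, c, h2, h3, h4.symm⟩

theorem rch_path {A : Set U} {a b : U} (ha : a ∈ A) (h : Rch G A a b) :
    ∃ L, IndP G L ∧ L.head? = some a ∧ L.getLast? = some b ∧ ∀ x ∈ L, x ∈ A := by
  induction h using Relation.ReflTransGen.head_induction_on with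
  | refl => exact ⟨[b], indP_single b, rfl, rfl, by simpa using ha⟩
  | head h h2 ih =>
    rename_i x y
    obtain ⟨L, h3, h4, h5, h6⟩ := ih h.2.2
    obtain ⟨L1, c, L2, rfl, h7, h8⟩ := last_sat (L := L) (q := fun z => z = x ∨ G.Adj x z)
      ⟨y, List.mem_of_head? h4, Or.inr h.1⟩
    have h9 := indP_append_right h3
    rw [gl_append] at h5
    have h6' : ∀ z ∈ c :: L2, z ∈ A := fun z hz => h6 z (List.mem_append_right _ hz)
    by_cases hcx : c = x
    · subst hcx
      exact ⟨c :: L2, h9, rfl, h5, h6'⟩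
    · have hxc := h7.resolve_left hcx
      push Not at h8
      refine ⟨x :: c :: L2, ⟨?_, ?_, h9⟩, rfl, ?_, ?_⟩
      · intro z hz
        rcases List.mem_cons.1 hz with rfl | hz
        · exact fun e => hcx e.symm
        · exact (h8 z hz).1.symm
      · intro z hz
        rcases List.mem_cons.1 hz with rfl | hz
        · simp [hxc]
        · have := (h8 z hz).2
          simp only [this, false_iff]
          simp; exact h9.1 z hz
      · rw [List.getLast?_cons, h5]; rfl
      · intro z hz
        rcases List.mem_cons.1 hz with rfl | hz
        · exact ha
        · exact h6' z hz

/-- shortest attachment path from `w` to `P` -/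
theorem att_path {A : Set U} (hA : Conn G A) {w : U} (hw : Att G w A) (hwA : w ∉ A) {P : List U}
    (hP : ∀ p ∈ P, p ∈ A) (hn : P ≠ []) :
    ∃ Z h, IndP G Z ∧ Z.head? = some h ∧ Z.getLast? = some w ∧ (∀ z ∈ Z, z = w ∨ (z ∈ A ∧ z ∉ P)) ∧
      (∀ z ∈ Z, z ≠ h → ∀ p ∈ P, ¬G.Adj z p) ∧ ∃ p ∈ P, G.Adj h p := by
  obtain ⟨a, ha, hwa⟩ := hw
  obtain ⟨p, hp⟩ := List.exists_mem_of_ne_nil P hn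
  have hc := conn_insert hA ha hwa.symm
  obtain ⟨c, d, h1, h2, h3, h4, h5, h6⟩ := rch_leave (T := {x | x ∈ P})
    (hc.2 w (by simp) p (by simp [hP p hp])) (by simp) (fun h => hwA (hP w h)) hp
  obtain ⟨L, l1, l2, l3, l4⟩ := rch_path (A := insert w A \ {x | x ∈ P}) ⟨by simp, fun h => hwA (hP w h)⟩ h1
  obtain ⟨L1, e, L2, rfl, h7, h8⟩ := first_sat (L := L) (q := fun x => ∃ p ∈ P, G.Adj x p)
    ⟨c, List.mem_of_getLast? l3, d, h5, h4⟩
  have l5 : IndP G (L1 ++ [e]) := indP_append_left (L2 := L2) (by simpa using l1)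
  refine ⟨(L1 ++ [e]).reverse, e, indP_reverse l5, by simp, ?_, ?_, ?_, h7⟩
  · rw [List.getLast?_reverse, ← l2]; cases L1 <;> simp
  · intro z hz
    have := l4 z (by simp at hz ⊢; tauto)
    rcases this with ⟨h | h, h'⟩
    · exact Or.inl h
    · exact Or.inr ⟨h, h'⟩
  · intro z hz hze p hp
    have : z ∈ L1 := by simp at hz; tauto
    intro hh; exact h8 z this ⟨p, hp, hh⟩

def MinConn (G : SimpleGraph U) (A : Set U) (I : Finset U) : Prop :=
  Conn G A ∧ (∀ z ∈ I, Att G z A) ∧ ∀ S ⊆ A, Conn G S → (∀ z ∈ I, Att G z S) → S = A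

theorem exists_minConn [Finite U] {A : Set U} {I : Finset U} (hA : Conn G A) (h : ∀ z ∈ I, Att G z A) :
    ∃ A' ⊆ A, MinConn G A' I := by
  obtain ⟨m, hm⟩ := (Set.toFinite {S : Set U | S ⊆ A ∧ Conn G S ∧ ∀ z ∈ I, Att G z S}).exists_minimal
    ⟨A, subset_rfl, hA, h⟩
  refine ⟨m, hm.1.1, hm.1.2.1, hm.1.2.2, ?_⟩
  intro S hS h1 h2
  exact hS.antisymm (hm.2 ⟨hS.trans hm.1.1, h1, h2⟩ hS)

def Priv (G : SimpleGraph U) (A : Set U) (z q : U) : Prop := q ∈ A ∧ ∀ a ∈ A, (G.Adj z a ↔ a = q)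

theorem priv_of {A : Set U} {I : Finset U} (h : MinConn G A I) {q : U} (hq : q ∈ A) (hc : Conn G (A \ {q})) :
    ∃ z ∈ I, Priv G A z q := by
  by_contra hcon
  push Not at hcon
  have : A \ {q} = A := by
    refine h.2.2 _ Set.diff_subset hc ?_
    intro z hz
    by_contra hza
    refine hcon z hz ⟨hq, ?_⟩
    have h2 : ∀ a ∈ A, G.Adj z a → a = q := by
      intro a ha haz
      by_contra hne
      exact hza ⟨a, ⟨ha, hne⟩, haz⟩
    obtain ⟨a0, ha0, haz0⟩ := h.2.1 z hz
    intro a ha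
    refine ⟨h2 a ha, ?_⟩
    rintro rfl
    rw [← h2 a0 ha0 haz0]; exact haz0
  have hq' := hq
  rw [← this] at hq'
  exact hq'.2 rfl

theorem exists_noncut [Finite U] {A S : Set U} (hA : Conn G A) (hS : Conn G S) (hSA : S ⊆ A) (hne : S ≠ A) :
    ∃ q ∈ A, q ∉ S ∧ Conn G (A \ {q}) := by
  obtain ⟨m, hm⟩ := (Set.toFinite {T : Set U | S ⊆ T ∧ T ⊆ A ∧ T ≠ A ∧ Conn G T}).exists_maximal
    ⟨S, subset_rfl, hSA, hne, hS⟩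
  obtain ⟨h1, h2, h3, h4⟩ := hm.1
  obtain ⟨s, hs, b, hb, hbm, hsb⟩ := conn_step hA h2 h4.1 h3
  have h5 := conn_insert h4 hs hsb
  have h6 : insert b m = A := by
    by_contra hne
    have := hm.2 (y := insert b m) ⟨h1.trans (Set.subset_insert _ _), Set.insert_subset hb h2, hne, h5⟩
      (Set.subset_insert _ _)
    exact hbm (this (by simp))
  refine ⟨b, hb, fun h => hbm (h1 h), ?_⟩
  have : A \ {b} = m := by rw [← h6]; ext x; simp; grind
  rwa [this]

def Side (G : SimpleGraph U) (B : Set U) (t : Finset U) : Prop :=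
  (∃ k, Strong G B t k) ∨ Weak G B t (fun _ => True)

theorem ClawGen.mono {A B : Set U} (hAB : A ⊆ B) {t : Finset U} {c : U} {E : U → List U}
    (h : ClawGen G A t c E) : ClawGen G B t c E :=
  ⟨h.hc.imp_left (fun x => hAB x), h.ind, h.hd, h.lst, fun i hi u hu => (h.mem i hi u hu).imp_left (fun x => hAB x), h.cross⟩

theorem TriGen.mono {A B : Set U} (hAB : A ⊆ B) {t : Finset U} {c : U → U} {E : U → List U}
    (h : TriGen G A t c E) : TriGen G B t c E :=
  ⟨h.adj, h.ind, h.hd, h.lst, fun i hi u hu => (h.mem i hi u hu).imp_left (fun x => hAB x), h.cross⟩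

theorem Strong.mono {A B : Set U} (hAB : A ⊆ B) {t : Finset U} {k : U} (h : Strong G A t k) : Strong G B t k := by
  obtain ⟨h1, E, h2⟩ := h
  exact ⟨h1, E, h2.mono hAB⟩

theorem Weak.mono {A B : Set U} (hAB : A ⊆ B) {t : Finset U} {M M' : U → Prop} (hM : ∀ i ∈ t, M i → M' i)
    (h : Weak G A t M) : Weak G B t M' := by
  rcases h with ⟨c, E, h1, h2, h3⟩ | ⟨c, E, h2, h3⟩
  · exact Or.inl ⟨c, E, hAB h1, h2.mono hAB, fun i hi hl => hM i hi (h3 i hi hl)⟩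
  · exact Or.inr ⟨c, E, h2.mono hAB, fun i hi hl => hM i hi (h3 i hi hl)⟩

theorem Side.mono {A B : Set U} (hAB : A ⊆ B) {t : Finset U} (h : Side G A t) : Side G B t := by
  rcases h with ⟨k, h⟩ | h
  · exact Or.inl ⟨k, h.mono hAB⟩
  · exact Or.inr (h.mono hAB (fun _ _ h => h))

theorem third {t : Finset U} (ht : t.card = 3) {u v : U} (hu : u ∈ t) (hv : v ∈ t) (huv : u ≠ v) :
    ∃ w ∈ t, u ≠ w ∧ v ≠ w ∧ t = {u, v, w} := by
  have : ((t.erase u).erase v).card = 1 := by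
    rw [Finset.card_erase_of_mem (by simp [hv, huv.symm]), Finset.card_erase_of_mem hu, ht]
  obtain ⟨w, hw⟩ := Finset.card_eq_one.1 this
  have hw' : w ∈ (t.erase u).erase v := by rw [hw]; simp
  simp at hw'
  refine ⟨w, hw'.2.2, fun e => hw'.2.1 e.symm, fun e => hw'.1 e.symm, ?_⟩
  ext x
  have := Finset.ext_iff.1 hw x
  simp at this ⊢
  by_cases h1 : x = u
  · simp [h1, hu]
  · by_cases h2 : x = v
    · simp [h2, hv]
    · simp [h1, h2] at this ⊢; exact this

theorem Priv.atH {A : Set U} {z q : U} (h : Priv G A z q) {P : List U} (hP : ∀ p ∈ P, p ∈ A) (hq : P.head? = some q) :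
    AtH G z P := by
  intro p hp; rw [h.2 p (hP p hp), hq]; simp [eq_comm]
theorem Priv.atL {A : Set U} {z q : U} (h : Priv G A z q) {P : List U} (hP : ∀ p ∈ P, p ∈ A) (hq : P.getLast? = some q) :
    AtL G z P := by
  intro p hp; rw [h.2 p (hP p hp), hq]; simp [eq_comm]

theorem exists_side [Finite U] {B : Set U} (hB : Conn G B) {t : Finset U} (ht : t.card = 3)
    (hatt : ∀ z ∈ t, Att G z B) (htB : ∀ z ∈ t, z ∉ B) (hind : ∀ i ∈ t, ∀ j ∈ t, ¬G.Adj i j) : Side G B t := by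
  obtain ⟨A, hAB, hA⟩ := exists_minConn hB hatt
  refine Side.mono hAB ?_
  have tA : ∀ z ∈ t, z ∉ A := fun z hz h => htB z hz (hAB h)
  suffices h : ∃ P u v, IndP G P ∧ (∀ p ∈ P, p ∈ A) ∧ u ∈ t ∧ v ∈ t ∧ u ≠ v ∧
      AtH G u P ∧ AtL G v P ∧ (∀ z ∈ A, z ∉ P → ¬G.Adj u z) ∧ (∀ z ∈ A, z ∉ P → ¬G.Adj v z) ∧ P ≠ [] by
    obtain ⟨P, u, v, h1, h2, hu, hv, huv, h3, h4, h5, h6, h7⟩ := h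
    obtain ⟨w, hw, huw, hvw, rfl⟩ := third ht hu hv huv
    obtain ⟨Z, h, z1, z2, z3, z4, z5, z6⟩ := att_path hA.1 (hA.2.1 w hw) (tA w hw) h2 h7
    have := path_side h1 h2 h3 h4 z1 z2 z3 z4 z5 z6 ?_ ?_ (tA u hu) (tA v hv) (tA w hw) huv huw hvw (hind u hu v hv)
    · rcases this with h | h
      · exact Or.inl ⟨w, h.2.2.1⟩
      · exact Or.inr (h.mono subset_rfl (fun _ _ _ => trivial))
    · intro z hz
      rcases z4 z hz with rfl | ⟨h8, h9⟩
      · exact hind u hu z hw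
      · exact h5 z h8 h9
    · intro z hz
      rcases z4 z hz with rfl | ⟨h8, h9⟩
      · exact hind v hv z hw
      · exact h6 z h8 h9
  obtain ⟨b, hb⟩ := hA.1.1
  by_cases hbA : {b} = A
  · obtain ⟨u, v, huv, hu, hv⟩ : ∃ u v, u ≠ v ∧ u ∈ t ∧ v ∈ t := by
      obtain ⟨u, hu, v, hv, h⟩ := Finset.one_lt_card.1 (by omega : 1 < t.card)
      exact ⟨u, v, h, hu, hv⟩
    have adj : ∀ z ∈ t, G.Adj z b := by
      intro z hz
      obtain ⟨a, ha, h⟩ := hA.2.1 z hz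
      rw [← hbA] at ha; rwa [← (ha : a = b)]
    refine ⟨[b], u, v, indP_single b, by simpa using hb, hu, hv, huv, ?_, ?_, ?_, ?_, by simp⟩
    · intro p hp; simp at hp; subst hp; simpa using adj u hu
    · intro p hp; simp at hp; subst hp; simpa using adj v hv
    · intro z hz; rw [← hbA] at hz; simp at hz; simp [hz]
    · intro z hz; rw [← hbA] at hz; simp at hz; simp [hz]
  · obtain ⟨q1, hq1, -, hc1⟩ := exists_noncut hA.1 (conn_singleton b) (by simpa using hb) hbA
    have hbA' : {q1} ≠ A := by
      intro e; have := hc1.1; rw [e] at this; simp at this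
    obtain ⟨q2, hq2, hne, hc2⟩ := exists_noncut hA.1 (conn_singleton q1) (by simpa using hq1) hbA'
    obtain ⟨u, hu, hpu⟩ := priv_of hA hq1 hc1
    obtain ⟨v, hv, hpv⟩ := priv_of hA hq2 hc2
    obtain ⟨P, p1, p2, p3, p4⟩ := rch_path hq1 (hA.1.2 q1 hq1 q2 hq2)
    refine ⟨P, u, v, p1, p4, hu, hv, ?_, hpu.atH p4 p2, hpv.atL p4 p3, ?_, ?_, ?_⟩
    · rintro rfl
      exact hne (((hpu.2 q2 hq2).1 ((hpv.2 q2 hq2).2 rfl)))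
    · intro z hz hzP hh
      rw [hpu.2 z hz] at hh; subst hh; exact hzP (List.mem_of_head? p2)
    · intro z hz hzP hh
      rw [hpv.2 z hz] at hh; subst hh; exact hzP (List.mem_of_getLast? p3)
    · rintro rfl; simp at p2

end conn

set_option linter.unusedSectionVars false
set_option linter.unusedVariables false

section poc
variable {U : Type} [DecidableEq U] {G : SimpleGraph U}

theorem card3 {u v w : U} (huv : u ≠ v) (huw : u ≠ w) (hvw : v ≠ w) : ({u, v, w} : Finset U).card = 3 :=
  Finset.card_eq_three.2 ⟨u, v, w, huv, huw, hvw, rfl⟩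

theorem ps_side (hG : InClassC G) {A B : Set U} {P Z : List U} {u v w h : U} {t : Finset U}
    (ht : t = {u, v, w}) (hC : Cfg G A B t) (hB : Side G B t)
    (hP : IndP G P) (hPA : ∀ p ∈ P, p ∈ A)
    (hu : AtH G u P) (hv : AtL G v P)
    (hZ : IndP G Z) (hZh : Z.head? = some h) (hZw : Z.getLast? = some w)
    (hZA : ∀ z ∈ Z, z = w ∨ (z ∈ A ∧ z ∉ P))
    (hZP : ∀ z ∈ Z, z ≠ h → ∀ p ∈ P, ¬G.Adj z p) (hh : ∃ p ∈ P, G.Adj h p)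
    (huZ : ∀ z ∈ Z, ¬G.Adj u z) (hvZ : ∀ z ∈ Z, ¬G.Adj v z)
    (huv : u ≠ v) (huw : u ≠ w) (hvw : v ≠ w) :
    (Z = [w] ∧ h = w ∧ Strong G A t w ∧ NAP G w P) ∨
    ((∃ k, Strong G B t k) ∧ ∀ k, Strong G B t k →
      (k = u ∧ AtH G h P) ∨ (k = v ∧ AtL G h P) ∨
      (k = w ∧ (Z = [w] ∨ (Z.length = 2 ∧ NAP G h P)))) := by
  subst ht
  have h3 := card3 huv huw hvw
  rcases path_side hP hPA hu hv hZ hZh hZw hZA hZP hh huZ hvZ (hC.tA u (by simp)) (hC.tA v (by simp))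
    (hC.tA w (by simp)) huv huw hvw (hC.ind u (by simp) v (by simp)) with h1 | h1
  · exact Or.inl h1
  · right
    constructor
    · rcases hB with h2 | h2
      · exact h2
      · exact (T1 hG h3 hC h1 h2).elim
    · intro k hk
      have := T2 hG h3 hC.symm hk h1
      have hkt := hk.1
      simp only [Finset.mem_insert, Finset.mem_singleton] at hkt
      rcases hkt with rfl | rfl | rfl
      · exact Or.inl ⟨rfl, this.1 rfl⟩
      · exact Or.inr (Or.inl ⟨rfl, this.2.1 rfl⟩)
      · exact Or.inr (Or.inr ⟨rfl, this.2.2 rfl⟩)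

theorem Priv.ne {A : Set U} {u v a b : U} (hu : Priv G A u a) (hv : Priv G A v b) (h : a ≠ b) : u ≠ v := by
  rintro rfl
  exact h ((hv.2 a hu.1).1 ((hu.2 a hu.1).2 rfl))

theorem pq (hG : InClassC G) {A B : Set U} {I t : Finset U} (hC : Cfg G A B I)
    (hB : ∀ t ⊆ I, t.card = 3 → Side G B t) {P : List U} {u v w cu cv q : U} (ht : t = {u, v, w})
    (hu : u ∈ I) (hv : v ∈ I) (hw : w ∈ I) (hP : IndP G P) (hPA : ∀ p ∈ P, p ∈ A)
    (pu : Priv G A u cu) (hcu : P.head? = some cu) (pv : Priv G A v cv) (hcv : P.getLast? = some cv)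
    (pw : Priv G A w q) (hq : q ∉ P) (hh : ∃ p ∈ P, G.Adj q p) (hne : cu ≠ cv) :
    (∃ k, Strong G B t k) ∧ ∀ k, Strong G B t k →
      (k = u ∧ AtH G q P) ∨ (k = v ∧ AtL G q P) ∨ (k = w ∧ NAP G q P) := by
  have cuP := List.mem_of_head? hcu
  have cvP := List.mem_of_getLast? hcv
  have cuq : cu ≠ q := fun e => hq (e ▸ cuP)
  have cvq : cv ≠ q := fun e => hq (e ▸ cvP)
  have huv := pu.ne pv hne
  have huw := pu.ne pw cuq
  have hvw := pv.ne pw cvq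
  have htI : t ⊆ I := by
    rw [ht]; intro x hx; simp only [Finset.mem_insert, Finset.mem_singleton] at hx
    rcases hx with rfl | rfl | rfl <;> assumption
  have aqw : G.Adj q w := ((pw.2 q pw.1).2 rfl).symm
  have wP : ∀ p ∈ P, ¬G.Adj w p := fun p hp h => hq (((pw.2 p (hPA p hp)).1 h) ▸ hp)
  have key := ps_side hG ht (hC.mono htI) (hB t htI (by rw [ht]; exact card3 huv huw hvw)) hP hPA
    (pu.atH hPA hcu) (pv.atL hPA hcv) (Z := [q, w]) (h := q)
    ⟨by simpa using aqw.ne, by simpa using aqw, indP_single w⟩ rfl rfl (by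
      intro z hz; simp at hz; rcases hz with rfl | rfl
      · exact Or.inr ⟨pw.1, hq⟩
      · exact Or.inl rfl) (by
      intro z hz hzq p hp; simp at hz; rcases hz with rfl | rfl
      · exact absurd rfl hzq
      · exact wP p hp) hh (by
      intro z hz; simp at hz; rcases hz with rfl | rfl
      · intro h; exact cuq ((pu.2 z pw.1).1 h).symm
      · exact hC.ind u hu z hw) (by
      intro z hz; simp at hz; rcases hz with rfl | rfl
      · intro h; exact cvq ((pv.2 z pw.1).1 h).symm
      · exact hC.ind v hv z hw) huv huw hvw
  rcases key with h | h
  · simp at h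
  · refine ⟨h.1, fun k hk => ?_⟩
    rcases h.2 k hk with h | h | h
    · exact Or.inl h
    · exact Or.inr (Or.inl h)
    · refine Or.inr (Or.inr ⟨h.1, ?_⟩)
      rcases h.2 with h | h
      · simp at h
      · exact h.2

theorem indP_conn {L : List U} (h : IndP G L) (hn : L ≠ []) : Conn G {x | x ∈ L} := by
  induction L with
  | nil => exact absurd rfl hn
  | cons a l ih =>
    cases l with
    | nil => simpa using conn_singleton (G := G) a
    | cons b l =>
      have := conn_insert (ih h.2.2 (by simp)) (a := b) (b := a) (by simp) ((h.2.1 b (by simp)).2 rfl).symm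
      convert this using 1
      ext x; simp

theorem conn_dom {S T : Set U} (hS : Conn G S) (hST : S ⊆ T) (h : ∀ t ∈ T, t ∈ S ∨ ∃ s ∈ S, G.Adj t s) : Conn G T := by
  obtain ⟨r, hr⟩ := hS.1
  refine conn_of_root (hST hr) ?_
  intro t ht
  rcases h t ht with h | ⟨s, hs, hts⟩
  · exact (hS.2 r hr t h).mono hST
  · exact ((hS.2 r hr s hs).mono hST).trans (Rch.single hts.symm (hST hs) ht)

theorem exists_longest {p : List U → Prop} {N : ℕ} (h : ∃ L, p L) (hb : ∀ L, p L → L.length ≤ N) :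
    ∃ L, p L ∧ ∀ L', p L' → L'.length ≤ L.length := by
  by_contra hcon
  push Not at hcon
  have : ∀ n, ∃ L, p L ∧ n ≤ L.length := by
    intro n
    induction n with
    | zero => obtain ⟨L, hL⟩ := h; exact ⟨L, hL, by omega⟩
    | succ n ih =>
      obtain ⟨L, h1, h2⟩ := ih
      obtain ⟨L', h3, h4⟩ := hcon L h1
      exact ⟨L', h3, by omega⟩
  obtain ⟨L, h1, h2⟩ := this (N + 1)
  have := hb L h1
  omega

/-- induced path of length at least two with private ends -/
def GoodP (G : SimpleGraph U) (A : Set U) (I : Finset U) (P : List U) : Prop :=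
  IndP G P ∧ (∀ p ∈ P, p ∈ A) ∧ ∃ x ∈ I, ∃ y ∈ I, ∃ a b, a ≠ b ∧ P.head? = some a ∧ P.getLast? = some b ∧
    Priv G A x a ∧ Priv G A y b

theorem GoodP.rev {A : Set U} {I : Finset U} {P : List U} (h : GoodP G A I P) : GoodP G A I P.reverse := by
  obtain ⟨h1, h2, x, hx, y, hy, a, b, hab, h3, h4, h5, h6⟩ := h
  exact ⟨indP_reverse h1, by simpa using h2, y, hy, x, hx, b, a, hab.symm, by simpa using h4, by simpa using h3, h6, h5⟩

theorem ext_path {A : Set U} {I : Finset U} {P Z : List U} (hP : GoodP G A I P)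
    (hl : ∀ P', GoodP G A I P' → P'.length ≤ P.length) {z q h : U} (hz : z ∈ I) (pz : Priv G A z q) (hq : q ∉ P)
    (z1 : IndP G Z) (z2 : Z.head? = some h) (z3 : Z.getLast? = some z)
    (z4 : ∀ a ∈ Z, a = z ∨ (a ∈ A ∧ a ∉ P)) (hn : z ∉ A) (z5 : ∀ a ∈ Z, a ≠ h → ∀ p ∈ P, ¬G.Adj a p)
    (zl : 2 ≤ Z.length) (hH : AtH G h P) : False := by
  obtain ⟨h1, h2, x, hx, y, hy, a, b, hab, h3, h4, h5, h6⟩ := hP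
  obtain ⟨Z1, rfl⟩ : ∃ Z1, Z = Z1 ++ [z] := by
    have hZ : Z ≠ [] := by rintro rfl; simp at zl
    refine ⟨Z.dropLast, ?_⟩
    have := List.dropLast_append_getLast hZ
    rw [List.getLast?_eq_getLast_of_ne_nil hZ] at z3
    simp at z3
    rw [z3] at this; exact this.symm
  have hZ1 : Z1 ≠ [] := by rintro rfl; simp at zl
  have zz := indP_append.1 z1
  have Z1A : ∀ a ∈ Z1, a ∈ A ∧ a ∉ P := by
    intro a ha
    rcases z4 a (by simp [ha]) with h | h
    · exact absurd h (zz.2.2 a ha z (by simp)).1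
    · exact h
  have hlast : Z1.getLast? = some q := by
    obtain ⟨q', hq'⟩ : ∃ q', Z1.getLast? = some q' := ⟨_, List.getLast?_eq_getLast_of_ne_nil hZ1⟩
    have hm := List.mem_of_getLast? hq'
    have := (zz.2.2 q' hm z (by simp)).2.2 ⟨hq', rfl⟩
    rw [hq', (pz.2 q' (Z1A q' hm).1).1 this.symm]
  have hhead : Z1.head? = some h := by
    rw [← z2]; cases Z1 with
    | nil => exact absurd rfl hZ1
    | cons => rfl
  have hb : b ∈ P := List.mem_of_getLast? h4
  have : GoodP G A I (Z1.reverse ++ P) := by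
    refine ⟨indP_append.2 ⟨indP_reverse zz.1, h1, ?_⟩, ?_, z, hz, y, hy, q, b, fun e => hq (e ▸ hb), ?_, ?_, pz, h6⟩
    · intro a ha p hp
      simp only [List.mem_reverse] at ha
      refine ⟨fun e => (Z1A a ha).2 (e ▸ hp), ?_⟩
      rw [List.getLast?_reverse, hhead]
      by_cases hah : a = h
      · subst hah; simp [hH p hp]
      · have := z5 a (by simp [ha]) hah p hp
        simp [this]; intro e; exact absurd e.symm hah
    · intro p hp
      simp at hp
      rcases hp with hp | hp
      · exact (Z1A p hp).1
      · exact h2 p hp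
    · rw [List.head?_append, List.head?_reverse, hlast]; rfl
    · rw [List.getLast?_append, h4]; rfl
  have := hl _ this
  rw [List.length_append, List.length_reverse] at this
  exact hZ1 (List.length_eq_zero_iff.1 (by omega))

/-- Context of a minimal connector facing a side-providing set. -/
structure MCtx (G : SimpleGraph U) (A B : Set U) (I : Finset U) : Prop where
  hG : InClassC G
  hM : MinConn G A I
  hC : Cfg G A B I
  hB : ∀ t ⊆ I, t.card = 3 → Side G B t

structure LCtx (G : SimpleGraph U) (A B : Set U) (I : Finset U) (P : List U) : Prop extends MCtx G A B I where
  hP : GoodP G A I P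
  hl : ∀ P', GoodP G A I P' → P'.length ≤ P.length

theorem LCtx.rev {A B : Set U} {I : Finset U} {P : List U} (h : LCtx G A B I P) : LCtx G A B I P.reverse :=
  ⟨h.toMCtx, h.hP.rev, fun P' hP' => by simpa using h.hl P' hP'⟩

theorem LCtx.nap {A B : Set U} {I : Finset U} {P : List U} (h : LCtx G A B I P) {q : U} (hq : q ∈ A) (hqP : q ∉ P)
    (hc : Conn G (A \ {q})) : NAP G q P := by
  obtain ⟨z, hz, pz⟩ := priv_of h.hM hq hc
  have hPr := h.hP.rev
  obtain ⟨h1, h2, x, hx, y, hy, a, b, hab, h3, h4, h5, h6⟩ := h.hP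
  have aP := List.mem_of_head? h3
  have bP := List.mem_of_getLast? h4
  have haq : a ≠ q := fun e => hqP (e ▸ aP)
  have hbq : b ≠ q := fun e => hqP (e ▸ bP)
  have hxy := h5.ne h6 hab
  have hxz := h5.ne pz haq
  have hyz := h6.ne pz hbq
  have zA := h.hC.tA z hz
  obtain ⟨Z, hh, z1, z2, z3, z4, z5, z6⟩ := att_path h.hM.1 (h.hM.2.1 z hz) zA h2 (by rintro rfl; simp at h3)
  have htI : ({x, y, z} : Finset U) ⊆ I := by
    intro w hw; simp only [Finset.mem_insert, Finset.mem_singleton] at hw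
    rcases hw with rfl | rfl | rfl <;> assumption
  have hZ2 : 2 ≤ Z.length := by
    by_contra hlt
    obtain ⟨e1, e2⟩ := single_of z2 z3 (by omega)
    obtain ⟨p, hp, hzp⟩ := z6
    rw [e1, pz.2 p (h2 p hp)] at hzp
    exact hqP (hzp ▸ hp)
  have key := ps_side h.hG rfl (h.hC.mono htI) (h.hB _ htI (card3 hxy hxz hyz)) h1 h2 (h5.atH h2 h3) (h6.atL h2 h4)
    z1 z2 z3 z4 z5 z6 (by
      intro w hw hh
      rcases z4 w hw with rfl | ⟨hw1, hw2⟩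
      · exact h.hC.ind x hx w hz hh
      · exact hw2 (((h5.2 w hw1).1 hh) ▸ aP)) (by
      intro w hw hh
      rcases z4 w hw with rfl | ⟨hw1, hw2⟩
      · exact h.hC.ind y hy w hz hh
      · exact hw2 (((h6.2 w hw1).1 hh) ▸ bP)) hxy hxz hyz
  rcases key with ⟨e, -⟩ | ⟨⟨k, hk⟩, hall⟩
  · rw [e] at hZ2; simp at hZ2
  · rcases hall k hk with ⟨-, hH⟩ | ⟨-, hL⟩ | ⟨-, hW⟩
    · exact (ext_path h.hP h.hl hz pz hqP z1 z2 z3 z4 zA z5 hZ2 hH).elim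
    · refine (ext_path hPr h.rev.hl hz pz (by simpa using hqP) z1 z2 z3 (by simpa using z4) zA (by simpa using z5) hZ2 hL.rev).elim
    · rcases hW with hW | ⟨hW, hn⟩
      · rw [hW] at hZ2; simp at hZ2
      · match Z, hW with
        | [c, d], _ =>
          simp at z2 z3; subst z2 z3
          have hcd : G.Adj c d := by simpa [IndP] using z1.2.1 d
          have hcA : c ∈ A := by
            rcases z4 c (by simp) with e | e
            · exact absurd e hcd.ne
            · exact e.1
          rwa [← (pz.2 c hcA).1 hcd.symm]

theorem LCtx.dom [Finite U] {A B : Set U} {I : Finset U} {P : List U} (h : LCtx G A B I P) {q : U} (hq : q ∈ A) (hqP : q ∉ P) :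
    ∃ p ∈ P, G.Adj q p := by
  by_contra hcon
  have hPn : P ≠ [] := by
    rintro rfl; obtain ⟨h1, h2, x, hx, y, hy, a, b, hab, h3, h4, h5, h6⟩ := h.hP; simp at h3
  have hS : Conn G {a | a ∈ A ∧ (a ∈ P ∨ ∃ p ∈ P, G.Adj a p)} := by
    refine conn_dom (indP_conn h.hP.1 hPn) (fun x hx => ⟨h.hP.2.1 x hx, Or.inl hx⟩) ?_
    rintro t ⟨_, h | h⟩
    · exact Or.inl h
    · exact Or.inr h
  obtain ⟨q', h1, h2, h3⟩ := exists_noncut h.hM.1 hS (fun x hx => hx.1) (fun e => by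
    have : q ∈ {a | a ∈ A ∧ (a ∈ P ∨ ∃ p ∈ P, G.Adj a p)} := by rw [e]; exact hq
    exact this.2.elim hqP hcon)
  have hq'P : q' ∉ P := fun e => h2 ⟨h1, Or.inl e⟩
  obtain ⟨a, ha, -, -, -, -, haq, -⟩ := h.nap h1 hq'P h3
  exact h2 ⟨h1, Or.inr ⟨a, ha, haq⟩⟩

theorem LCtx.noncut [Finite U] {A B : Set U} {I : Finset U} {P : List U} (h : LCtx G A B I P) {q : U} (hq : q ∈ A) (hqP : q ∉ P) :
    Conn G (A \ {q}) := by
  have hPn : P ≠ [] := by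
    rintro rfl; obtain ⟨h1, h2, x, hx, y, hy, a, b, hab, h3, h4, h5, h6⟩ := h.hP; simp at h3
  refine conn_dom (indP_conn h.hP.1 hPn) (fun x hx => ⟨h.hP.2.1 x hx, fun e => hqP ((e : x = q) ▸ hx)⟩) ?_
  rintro t ⟨ht, _⟩
  by_cases htP : t ∈ P
  · exact Or.inl htP
  · exact Or.inr (h.dom ht htP)

/-- interior vertices bypassed by `q` are noncut -/
theorem LCtx.bypass [Finite U] {A B : Set U} {I : Finset U} {L1 L2 : List U} {s : U} (h : LCtx G A B I (L1 ++ s :: L2))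
    {q c c' : U} (hq : q ∈ A) (hqP : q ∉ L1 ++ s :: L2) (hc : c ∈ L1) (hqc : G.Adj q c) (hc' : c' ∈ L2) (hqc' : G.Adj q c') :
    ∃ z ∈ I, Priv G A z s := by
  have hPA := h.hP.2.1
  have hi := indP_append.1 h.hP.1
  refine priv_of h.hM (hPA s (by simp)) ?_
  have k1 : Conn G ({x | x ∈ L1} ∪ {q}) := conn_union (indP_conn hi.1 (List.ne_nil_of_mem hc)) (conn_singleton q)
    (show c ∈ {x | x ∈ L1} from hc) rfl (Or.inr hqc.symm)
  have k2 : Conn G (({x | x ∈ L1} ∪ {q}) ∪ {x | x ∈ L2}) := conn_union k1 (indP_conn hi.2.1.2.2 (List.ne_nil_of_mem hc'))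
    (Or.inr rfl) (show c' ∈ {x | x ∈ L2} from hc') (Or.inr hqc')
  refine conn_dom k2 ?_ ?_
  · rintro x ((hx | hx) | hx)
    · exact ⟨hPA x (by simp at hx; simp [hx]), (hi.2.2 x hx s (by simp)).1⟩
    · have hx : x = q := hx
      subst hx; exact ⟨hq, fun e => hqP (by rw [(e : x = s)]; simp)⟩
    · exact ⟨hPA x (by simp at hx; simp [hx]), (hi.2.1.1 x hx).symm⟩
  · rintro t ⟨ht, hts⟩
    have hts : t ≠ s := hts
    by_cases htP : t ∈ L1 ++ s :: L2
    · left; simp at htP; simp; tauto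
    · right
      obtain ⟨a, ha, b, hb, hab, -, hta, htb⟩ := h.nap ht htP (h.noncut ht htP)
      have : ∃ p ∈ L1 ++ s :: L2, p ≠ s ∧ G.Adj t p := by
        by_cases has : a = s
        · exact ⟨b, hb, fun e => hab (has.trans e.symm), htb⟩
        · exact ⟨a, ha, has, hta⟩
      obtain ⟨p, hp, hps, htp⟩ := this
      refine ⟨p, ?_, htp⟩
      simp at hp ⊢; tauto

theorem LCtx.stepA [Finite U] {A B : Set U} {I : Finset U} {P1 R : List U} {c s : U} (h : LCtx G A B I (P1 ++ c :: s :: R))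
    {q c' : U} (hq : q ∈ A) (hqP : q ∉ P1 ++ c :: s :: R) (hqc : G.Adj q c) (hP1 : ∀ x ∈ P1, ¬G.Adj q x)
    (hc' : c' ∈ R) (hqc' : G.Adj q c') : P1 = [] ∧ ¬G.Adj q s := by
  have h' : LCtx G A B I ((P1 ++ [c]) ++ s :: R) := by simpa using h
  obtain ⟨xs, hxs, ps⟩ := h'.bypass hq (by simpa using hqP) (c := c) (by simp) hqc hc' hqc'
  obtain ⟨z, hz, pz⟩ := priv_of h.hM hq (h.noncut hq hqP)
  obtain ⟨h1, h2, x, hx, y, hy, a, b, hab, h3, h4, h5, h6⟩ := h.hP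
  have iL : IndP G (P1 ++ [c, s]) := indP_append_left (L2 := R) (by simpa using h1)
  have hcs : G.Adj c s := by
    have := indP_append_right iL
    exact (this.2.1 s (by simp)).2 rfl
  have nL := indP_nodup iL
  have hL : (P1 ++ [c, s]).head? = some a := by rw [← h3]; cases P1 <;> rfl
  have hLl : (P1 ++ [c, s]).getLast? = some s := by rw [gl_append]; rfl
  have has : a ≠ s := (indP_ends iL hL hLl (by simp)).1
  have hqL : q ∉ P1 ++ [c, s] := fun e => hqP (by simp at e ⊢; tauto)
  have key := pq h.hG h.hC h.hB (u := x) (v := xs) (w := z) rfl hx hxs hz iL (fun p hp => h2 p (by simp at hp ⊢; tauto)) h5 hL ps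
    hLl pz hqL ⟨c, by simp, hqc⟩ has
  obtain ⟨⟨k, hk⟩, hall⟩ := key
  rcases hall k hk with ⟨-, hH⟩ | ⟨-, hH⟩ | ⟨-, hH⟩
  · have e1 := (hH c (by simp)).1 hqc
    constructor
    · cases P1 with
      | nil => rfl
      | cons d P1 => simp at e1; subst e1; simp at nL
    · intro hqs
      have e2 := (hH s (by simp)).1 hqs
      rw [e1] at e2; simp at e2; exact hcs.ne e2
  · have e1 := (hH c (by simp)).1 hqc
    rw [hLl] at e1; simp at e1; exact absurd e1.symm hcs.ne
  · obtain ⟨d, hd, e, he, hde, hn, hqd, hqe⟩ := hH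
    have : ∀ d ∈ P1 ++ [c, s], G.Adj q d → d = c ∨ d = s := by
      intro d hd hqd
      simp at hd
      rcases hd with hd | hd
      · exact absurd hqd (hP1 d hd)
      · exact hd
    rcases this d hd hqd with rfl | rfl <;> rcases this e he hqe with rfl | rfl
    · exact absurd rfl hde
    · exact absurd hcs hn
    · exact absurd hcs.symm hn
    · exact absurd rfl hde

def C4 (G : SimpleGraph U) (A : Set U) (I : Finset U) : Prop :=
  ∃ c1 c2 c3 c4 x1 x2 x3 x4, G.Adj c1 c2 ∧ G.Adj c2 c3 ∧ G.Adj c3 c4 ∧ G.Adj c4 c1 ∧ ¬G.Adj c1 c3 ∧ ¬G.Adj c2 c4 ∧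
    c1 ≠ c3 ∧ c2 ≠ c4 ∧ x1 ∈ I ∧ x2 ∈ I ∧ x3 ∈ I ∧ x4 ∈ I ∧ Priv G A x1 c1 ∧ Priv G A x2 c2 ∧ Priv G A x3 c3 ∧ Priv G A x4 c4

theorem LCtx.c4 [Finite U] {A B : Set U} {I : Finset U} {P : List U} (h : LCtx G A B I P)
    {q : U} (hq : q ∈ A) (hqP : q ∉ P) : C4 G A I := by
  obtain ⟨z, hz, pz⟩ := priv_of h.hM hq (h.noncut hq hqP)
  have hnap := h.nap hq hqP (h.noncut hq hqP)
  -- first neighbour and normal form on the left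
  have left : ∀ P : List U, LCtx G A B I P → q ∉ P → NAP G q P →
      ∃ c s R c', P = c :: s :: R ∧ G.Adj q c ∧ ¬G.Adj q s ∧ c' ∈ R ∧ G.Adj q c' := by
    intro P h hqP hnap
    obtain ⟨a, ha, b, hb, hab, nab, hqa, hqb⟩ := hnap
    obtain ⟨P1, c, R, rfl, hqc, hP1⟩ := first_sat (q := fun x => G.Adj q x) ⟨a, ha, hqa⟩
    have hi := indP_append.1 h.hP.1
    have : ∃ c' ∈ R, G.Adj q c' ∧ ¬G.Adj c c' := by
      have ha' : a = c ∨ a ∈ R := by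
        simp at ha; rcases ha with h | h | h
        · exact absurd hqa (hP1 a h)
        · exact Or.inl h
        · exact Or.inr h
      have hb' : b = c ∨ b ∈ R := by
        simp at hb; rcases hb with h | h | h
        · exact absurd hqb (hP1 b h)
        · exact Or.inl h
        · exact Or.inr h
      rcases ha' with rfl | ha' <;> rcases hb' with rfl | hb'
      · exact absurd rfl hab
      · exact ⟨b, hb', hqb, nab⟩
      · exact ⟨a, ha', hqa, fun h => nab h.symm⟩
      · by_cases hca : G.Adj c a
        · refine ⟨b, hb', hqb, fun hcb => ?_⟩
          rw [hi.2.1.2.1 a ha'] at hca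
          rw [hi.2.1.2.1 b hb', hca] at hcb
          simp at hcb; exact hab hcb
        · exact ⟨a, ha', hqa, hca⟩
    obtain ⟨c', hc', hqc', ncc'⟩ := this
    cases R with
    | nil => simp at hc'
    | cons s R =>
      have hcs : G.Adj c s := (hi.2.1.2.1 s (by simp)).2 rfl
      have hc'R : c' ∈ R := by
        rcases List.mem_cons.1 hc' with rfl | h
        · exact absurd hcs ncc'
        · exact h
      obtain ⟨e1, e2⟩ := h.stepA hq hqP hqc hP1 hc'R hqc'
      subst e1
      exact ⟨c, s, R, c', rfl, hqc, e2, hc'R, hqc'⟩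
  obtain ⟨c, s, T, c0, rfl, hqc, hqs, hc0, hqc0⟩ := left P h hqP hnap
  have hrev := left _ h.rev (fun h => hqP (List.mem_reverse.1 h)) (by
    obtain ⟨a, ha, b, hb, h⟩ := hnap
    exact ⟨a, List.mem_reverse.2 ha, b, List.mem_reverse.2 hb, h⟩)
  obtain ⟨c', s', T2, c1, hT2, hqc', hqs', -, -⟩ := hrev
  obtain ⟨h1, h2, x, hx, y, hy, a, b, hab, h3, h4, h5, h6⟩ := h.hP
  have ea : c = a := by simpa using h3
  subst ea
  have eb : c' = b := by
    have : (c :: s :: T).reverse.head? = some b := by rw [List.head?_reverse]; exact h4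
    rw [hT2] at this; simpa using this
  subst eb
  have hT : T ≠ [] := List.ne_nil_of_mem hc0
  have hTl : T.getLast? = some c' := by
    rw [← h4]; cases T with
    | nil => exact absurd rfl hT
    | cons d T => rw [show c :: s :: d :: T = [c, s] ++ d :: T from rfl, gl_append]
  have iT : IndP G T := h1.2.2.2.2
  have hcs : G.Adj c s := (h1.2.1 s (by simp)).2 rfl
  have cT : ∀ d ∈ T, c ≠ d ∧ ¬G.Adj c d := by
    intro d hd
    refine ⟨h1.1 d (by simp [hd]), ?_⟩
    rw [h1.2.1 d (by simp [hd])]; simp; exact h1.2.2.1 d hd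
  have c'T : c' ∈ T := List.mem_of_getLast? hTl
  have cA := h2 c (by simp)
  have hqc : G.Adj q c := hqc
  -- q is adjacent only to c' in T
  have qT : ∀ d ∈ T, G.Adj q d → d = c' := by
    intro d hd hqd
    by_contra hdc
    obtain ⟨D1, D2, rfl⟩ := List.append_of_mem hd
    have hD2 : c' ∈ D2 := by
      rw [gl_append] at hTl
      rcases List.mem_cons.1 (List.mem_of_getLast? hTl) with h | h
      · exact absurd h.symm hdc
      · exact h
    have h' : LCtx G A B I ((c :: s :: D1) ++ d :: D2) := h
    obtain ⟨xd, hxd, pd⟩ := h'.bypass hq hqP (c := c) (by simp) hqc hD2 hqc'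
    have ndc' : ¬G.Adj d c' := by
      intro hdc'
      -- then d = s' or so
      have e : (c :: s :: (D1 ++ d :: D2)) = T2.reverse ++ [s', c'] := by
        have := congrArg List.reverse hT2
        simpa using this
      rw [e] at h1 h2
      have hi := indP_append.1 h1
      have hdm : d ∈ T2.reverse ++ [s', c'] := by rw [← e]; simp
      rcases List.mem_append.1 hdm with hdm | hdm
      · have := (hi.2.2 d hdm c' (by simp)).2.1 hdc'
        have h7 := this.2
        simp at h7
        have := hi.2.1.1 c' (by simp)
        exact this h7
      · simp at hdm
        rcases hdm with rfl | rfl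
        · exact hqs' hqd
        · exact hdc rfl
    have key := pq h.hG h.hC h.hB (P := [c, q, c']) (u := x) (v := y) (w := xd) (q := d) rfl hx hy hxd
      ⟨by simp; exact ⟨hqc.ne', hab⟩, by
        intro b hb
        simp at hb
        rcases hb with rfl | rfl
        · simp [hqc.symm]
        · simp [(cT b c'T).2, hqc'.ne],
       by simp [IndP, hqc', hqc'.ne]⟩
      (by intro p hp; simp at hp; rcases hp with rfl | rfl | rfl
          · exact cA
          · exact hq
          · exact h6.1) h5 rfl h6 rfl pd
      (by simp; exact ⟨(cT d hd).1.symm, hqd.ne', hdc⟩) ⟨q, by simp, hqd.symm⟩ hab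
    obtain ⟨⟨k, hk⟩, hall⟩ := key
    rcases hall k hk with ⟨-, hH⟩ | ⟨-, hH⟩ | ⟨-, hH⟩
    · have := (hH q (by simp)).1 hqd.symm
      simp at this; exact hqc.ne' this
    · have := (hH q (by simp)).1 hqd.symm
      simp at this; exact hqc'.ne' this
    · obtain ⟨e, he, f, hf, hef, hn, hde, hdf⟩ := hH
      have only : ∀ e ∈ [c, q, c'], G.Adj d e → e = q := by
        intro e he hde
        simp at he
        rcases he with rfl | rfl | rfl
        · exact absurd hde.symm (cT d hd).2
        · rfl
        · exact absurd hde ndc'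
      exact hef ((only e he hde).trans (only f hf hdf).symm)
  have h' : LCtx G A B I ([c] ++ s :: T) := h
  obtain ⟨xs, hxs, ps⟩ := h'.bypass hq hqP (c := c) (by simp) hqc c'T hqc'
  cases T with
  | nil => exact absurd rfl hT
  | cons s2 T =>
  cases T with
  | nil =>
    simp at hTl; subst hTl
    have hss : G.Adj s s2 := (h1.2.2.2.1 s2 (by simp)).2 rfl
    exact ⟨c, s, s2, q, x, xs, y, z, hcs, hss, hqc'.symm, hqc, (cT s2 (by simp)).2, fun h => hqs h.symm, hab,
      fun e => hqP (by simp [← e]), hx, hxs, hy, hz, h5, ps, h6, pz⟩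
  | cons s3 T =>
    exfalso
    have hc'3 : c' ∈ s3 :: T := by
      rw [show s2 :: s3 :: T = [s2] ++ s3 :: T from rfl, gl_append] at hTl
      exact List.mem_of_getLast? hTl
    have s2c' : s2 ≠ c' := iT.1 c' hc'3
    have h'' : LCtx G A B I ([c, s] ++ s2 :: s3 :: T) := h
    obtain ⟨x2, hx2, p2⟩ := h''.bypass hq hqP (c := c) (by simp) hqc hc'3 hqc'
    have hqs2 : ¬G.Adj q s2 := fun hh => s2c' (qT s2 (by simp) hh)
    have i3 : IndP G [c, s, s2] := indP_append_left (L2 := s3 :: T) (by simpa using h1)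
    have cs2 := (cT s2 (by simp))
    have key1 := pq h.hG h.hC h.hB (P := [c, s, s2]) (u := x) (v := x2) (w := z) (q := q) rfl hx hx2 hz
      i3 (fun p hp => h2 p (by simp at hp ⊢; tauto)) h5 rfl p2 rfl pz (fun e => hqP (by simp at e ⊢; tauto))
      ⟨c, by simp, hqc⟩ cs2.1
    obtain ⟨⟨k, hk⟩, hall⟩ := key1
    have k1 : k = x := by
      rcases hall k hk with ⟨e, -⟩ | ⟨-, hH⟩ | ⟨-, hH⟩
      · exact e
      · have := (hH c (by simp)).1 hqc
        simp at this; exact absurd this.symm cs2.1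
      · obtain ⟨e, he, f, hf, hef, hn, hde, hdf⟩ := hH
        have only : ∀ e ∈ [c, s, s2], G.Adj q e → e = c := by
          intro e he hde
          simp at he
          rcases he with rfl | rfl | rfl
          · rfl
          · exact absurd hde hqs
          · exact absurd hde hqs2
        exact absurd ((only e he hde).trans (only f hf hdf).symm) hef
    have qT' : ∀ d ∈ s2 :: s3 :: T, q ≠ d := fun d hd e => hqP (by rw [e]; exact List.mem_cons_of_mem _ (List.mem_cons_of_mem _ hd))
    have iq : IndP G (q :: (s2 :: s3 :: T).reverse) := by
      refine ⟨fun d hd => qT' d (List.mem_reverse.1 hd), fun d hd => ?_, indP_reverse iT⟩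
      rw [List.head?_reverse, hTl]
      constructor
      · intro hh; rw [qT d (List.mem_reverse.1 hd) hh]
      · intro e; simp at e; rw [← e]; exact hqc'
    have gl : (q :: (s2 :: s3 :: T).reverse).getLast? = some s2 := by
      rw [List.reverse_cons, gl_csnoc]
    have key2 := pq h.hG h.hC h.hB (P := q :: (s2 :: s3 :: T).reverse) (u := z) (v := x2) (w := x) (q := c) (t := {x, x2, z})
      (by ext; simp; tauto) hz hx2 hx
      iq (fun p hp => by
        rcases List.mem_cons.1 hp with rfl | hp
        · exact hq
        · exact h2 p (by rw [List.mem_reverse] at hp; exact List.mem_cons_of_mem _ (List.mem_cons_of_mem _ hp))) pz rfl p2 gl h5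
      (fun e => by
        rcases List.mem_cons.1 e with e | e
        · exact hqc.ne' e
        · exact (cT c (List.mem_reverse.1 e)).1 rfl)
      ⟨q, by simp, hqc.symm⟩ (qT' s2 (by simp))
    rcases key2.2 k hk with ⟨e, -⟩ | ⟨-, hH⟩ | ⟨-, hH⟩
    · exact (h5.ne pz hqc.ne').symm (e.symm.trans k1)
    · have := (hH q (by simp)).1 hqc.symm
      rw [gl] at this; simp at this; exact qT' s2 (by simp) this.symm
    · obtain ⟨e, he, f, hf, hef, hn, hde, hdf⟩ := hH
      have only : ∀ e ∈ q :: (s2 :: s3 :: T).reverse, G.Adj c e → e = q := by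
        intro e he hde
        rcases List.mem_cons.1 he with rfl | he
        · rfl
        · exact absurd hde (cT e (List.mem_reverse.1 he)).2
      exact absurd ((only e he hde).trans (only f hf hdf).symm) hef

/-- path connector -/
structure PathC (G : SimpleGraph U) (A : Set U) (I : Finset U) (P : List U) (x y : U) : Prop where
  ind : IndP G P
  mem : ∀ a, a ∈ A ↔ a ∈ P
  hx : x ∈ I
  hy : y ∈ I
  xy : x ≠ y
  atH : AtH G x P
  atL : AtL G y P

theorem path_or_c4 [Finite U] {A B : Set U} {I : Finset U} (h : MCtx G A B I) (hI : 2 ≤ I.card) :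
    (∃ P x y, PathC G A I P x y) ∨ C4 G A I := by
  obtain ⟨b, hb⟩ := h.hM.1.1
  by_cases hbA : {b} = A
  · left
    obtain ⟨u, hu, v, hv, huv⟩ := Finset.one_lt_card.1 (by omega : 1 < I.card)
    have adj : ∀ z ∈ I, G.Adj z b := by
      intro z hz
      obtain ⟨a, ha, h⟩ := h.hM.2.1 z hz
      rw [← hbA] at ha; rwa [← (ha : a = b)]
    refine ⟨[b], u, v, indP_single b, ?_, hu, hv, huv, ?_, ?_⟩
    · rw [← hbA]; simp
    · intro p hp; simp at hp; subst hp; simpa using adj u hu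
    · intro p hp; simp at hp; subst hp; simpa using adj v hv
  · have hex : ∃ P, GoodP G A I P := by
      obtain ⟨q1, hq1, -, hc1⟩ := exists_noncut h.hM.1 (conn_singleton b) (by simpa using hb) hbA
      have hbA' : {q1} ≠ A := by
        intro e; have := hc1.1; rw [e] at this; simp at this
      obtain ⟨q2, hq2, hne, hc2⟩ := exists_noncut h.hM.1 (conn_singleton q1) (by simpa using hq1) hbA'
      obtain ⟨u, hu, hpu⟩ := priv_of h.hM hq1 hc1
      obtain ⟨v, hv, hpv⟩ := priv_of h.hM hq2 hc2
      obtain ⟨P, p1, p2, p3, p4⟩ := rch_path hq1 (h.hM.1.2 q1 hq1 q2 hq2)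
      exact ⟨P, p1, p4, u, hu, v, hv, q1, q2, fun e => hne e.symm, p2, p3, hpu, hpv⟩
    obtain ⟨P, hP, hl⟩ := exists_longest (N := Nat.card U) hex (by
      intro L hL
      have := indP_nodup hL.1
      cases nonempty_fintype U
      rw [Nat.card_eq_fintype_card]
      exact this.length_le_card)
    have hL : LCtx G A B I P := ⟨h, hP, hl⟩
    by_cases hq : ∃ q ∈ A, q ∉ P
    · obtain ⟨q, h1, h2⟩ := hq
      exact Or.inr (hL.c4 h1 h2)
    · left
      push Not at hq
      obtain ⟨h1, h2, x, hx, y, hy, a, b, hab, h3, h4, h5, h6⟩ := hP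
      exact ⟨P, x, y, h1, fun a => ⟨hq a, h2 a⟩, hx, hy, h5.ne h6 hab, h5.atH h2 h3, h6.atL h2 h4⟩

end poc

set_option linter.unusedSectionVars false
set_option linter.unusedVariables false

section P7
variable {U : Type} [DecidableEq U] {G : SimpleGraph U}

theorem cyc_rot1 {a b : U} {l : List U} (h : CycL G a (b :: l)) : CycL G b (l ++ [a]) := by
  obtain ⟨h1, h2, h3, h4⟩ := h
  obtain ⟨i1, i2, i3⟩ := indP_cons.1 h1
  have hl : l ≠ [] := by rintro rfl; simp at h2
  have hlast : ∀ x ∈ l, ((b :: l).getLast? = some x ↔ l.getLast? = some x) := by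
    intro x hx
    obtain ⟨c, l', rfl⟩ := List.exists_cons_of_ne_nil hl
    rw [List.getLast?_cons_cons]
  have hhead : (l ++ [a]).head? = l.head? := by
    obtain ⟨c, l', rfl⟩ := List.exists_cons_of_ne_nil hl
    rfl
  simp only [List.mem_cons, not_or] at h3
  refine ⟨?_, by simpa using h2, ?_, ?_⟩
  · refine indP_snoc i3 ?_
    intro x hx
    refine ⟨fun e => h3.2 (e ▸ hx), ?_⟩
    rw [h4 x (List.mem_cons_of_mem _ hx), hlast x hx]
    have := i1 x hx
    simp only [List.head?_cons, Option.some.injEq]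
    tauto
  · simp only [List.mem_append, List.mem_singleton, not_or]
    exact ⟨fun h => i1 b h rfl, fun h => h3.1 h.symm⟩
  · intro c hc
    rw [hhead, gl_snoc]
    rcases List.mem_append.1 hc with hc | hc
    · rw [i2 c hc]
      have : a ≠ c := fun e => h3.2 (e ▸ hc)
      simp [this]
    · simp only [List.mem_singleton] at hc
      subst hc
      simp only [or_true, iff_true]
      exact ((h4 b (by simp)).2 (by simp)).symm

theorem cyc_rot {l1 : List U} : ∀ {a b : U} {l2 : List U}, CycL G a (l1 ++ b :: l2) → CycL G b (l2 ++ a :: l1) := by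
  induction l1 with
  | nil => intro a b l2 h; exact cyc_rot1 h
  | cons c l ih =>
    intro a b l2 h
    have := cyc_rot1 (a := a) (b := c) (l := l ++ b :: l2) (by simpa using h)
    have := ih (a := c) (b := b) (l2 := l2 ++ [a]) (by simpa using this)
    simpa using this

theorem cyc_theta (hG : ¬ContainsTheta G) {a b v : U} {P Q : List U} (h : CycL G a (P ++ b :: Q))
    (hP : P ≠ []) (hQ : Q ≠ []) (va : G.Adj v a) (vb : G.Adj v b)
    (hv : ∀ x ∈ P ++ Q, ¬G.Adj v x) (hva : v ∉ P ++ Q) : False := by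
  obtain ⟨h1, h2, h3, h4⟩ := h
  have hab : ¬G.Adj a b := by
    intro hh
    rcases (h4 b (by simp)).1 hh with h | h
    · obtain ⟨c, l', rfl⟩ := List.exists_cons_of_ne_nil hP
      simp at h; subst h
      exact (indP_cons.1 h1).1 c (by simp) rfl
    · rw [gl_append] at h
      obtain ⟨c, l', rfl⟩ := List.exists_cons_of_ne_nil hQ
      rw [List.getLast?_cons_cons] at h
      have := List.mem_of_getLast? h
      exact (indP_cons.1 (indP_append_right h1)).1 b this rfl
  obtain ⟨iP, ibQ, cr⟩ := indP_append.1 h1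
  obtain ⟨q1, q2, iQ⟩ := indP_cons.1 ibQ
  simp only [List.mem_append, List.mem_cons, not_or] at h3 hva
  have hlast : (P ++ b :: Q).getLast? = Q.getLast? := by
    rw [gl_append]
    obtain ⟨c, l', rfl⟩ := List.exists_cons_of_ne_nil hQ
    rw [List.getLast?_cons_cons]
  have hhead : ∀ R : List U, (P ++ R).head? = P.head? := by
    intro R
    obtain ⟨c, l', rfl⟩ := List.exists_cons_of_ne_nil hP
    rfl
  have aP : ∀ c ∈ P, (G.Adj a c ↔ P.head? = some c) := by
    intro c hc
    rw [h4 c (by simp [hc]), hhead, hlast]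
    constructor
    · rintro (h | h)
      · exact h
      · exact absurd rfl (cr c hc c (List.mem_cons_of_mem _ (List.mem_of_getLast? h))).1
    · exact Or.inl
  have aQ : ∀ c ∈ Q, (G.Adj a c ↔ Q.getLast? = some c) := by
    intro c hc
    rw [h4 c (by simp [hc]), hhead, hlast]
    constructor
    · rintro (h | h)
      · exact absurd rfl (cr c (List.mem_of_head? h) c (List.mem_cons_of_mem _ hc)).1
      · exact h
    · exact Or.inr
  have i1 : IndP G (a :: (P ++ [b])) := by
    refine indP_cons.2 ⟨?_, ?_, ?_⟩
    · intro c hc e; subst e; simp at hc; tauto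
    · intro c hc
      rw [hhead]
      rcases List.mem_append.1 hc with hc | hc
      · exact aP c hc
      · simp only [List.mem_singleton] at hc; subst hc
        refine iff_of_false hab ?_
        intro h
        exact (cr c (List.mem_of_head? h) c (by simp)).1 rfl
    · rw [show P ++ b :: Q = (P ++ [b]) ++ Q by simp] at h1
      exact indP_append_left h1
  have i3 : IndP G (a :: (Q.reverse ++ [b])) := by
    refine indP_cons.2 ⟨?_, ?_, ?_⟩
    · intro c hc e; subst e; simp at hc; tauto
    · intro c hc
      have : (Q.reverse ++ [b]).head? = Q.getLast? := by
        rw [List.head?_append, List.head?_reverse]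
        obtain ⟨c, hc⟩ := List.getLast?_isSome.2 hQ |> Option.isSome_iff_exists.1
        rw [hc]; rfl
      rw [this]
      rcases List.mem_append.1 hc with hc | hc
      · exact aQ c (by simpa using hc)
      · simp only [List.mem_singleton] at hc; subst hc
        refine iff_of_false hab ?_
        intro h
        exact q1 c (List.mem_of_getLast? h) rfl
    · have := indP_reverse ibQ
      simpa using this
  have vna : v ≠ a := va.ne
  have vnb : v ≠ b := vb.ne
  have i2 : IndP G [a, v, b] := by
    simp only [IndP]
    have : a ≠ b := fun e => h3.2.1 e
    simp [vna.symm, vnb, vb, va.symm, hab, this]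
  refine theta_false hG (a := a) (b := b) i1 i2 i3 rfl rfl rfl (gl_csnoc _ _ _) rfl (gl_csnoc _ _ _) ?_ (by simp) ?_ ?_ ?_ ?_
  · have := List.length_pos_of_ne_nil hP; simp; omega
  · have := List.length_pos_of_ne_nil hQ; simp; omega
  · intro x hx w hw xa xb wa wb
    simp [xa, xb, wa, wb] at hx hw
    subst hw
    exact ⟨fun e => hva.1 (e ▸ hx), fun h => hv x (by simp [hx]) h.symm⟩
  · intro x hx w hw xa xb wa wb
    simp [xa, xb, wa, wb] at hx hw
    refine ⟨(cr x hx w (by simp [hw])).1, fun h => ?_⟩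
    have := ((cr x hx w (by simp [hw])).2.1 h).2
    simp at this; exact wb this.symm
  · intro w hw x hx wa wb xa xb
    simp [xa, xb, wa, wb] at hx hw
    subst hw
    exact ⟨fun e => hva.2 (e ▸ hx), fun h => hv x (by simp [hx]) h⟩

/-- two paths `P` (from `x` to `y`) and `R` (from `y` to `x`) forming a hole -/
structure RingH (G : SimpleGraph U) (x y : U) (P R : List U) : Prop where
  iP : IndP G P
  iR : IndP G R
  nP : P ≠ []
  nR : R ≠ []
  cr : ∀ a ∈ P, ∀ b ∈ R, a ≠ b ∧ ¬G.Adj a b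
  xP : x ∉ P
  xR : x ∉ R
  yP : y ∉ P
  yR : y ∉ R
  xy : x ≠ y
  nxy : ¬G.Adj x y
  hxP : AtH G x P
  hyP : AtL G y P
  hyR : AtH G y R
  hxR : AtL G x R

theorem RingH.cyc {x y : U} {P R : List U} (h : RingH G x y P R) : CycL G x (P ++ y :: R) := by
  have hlast : (P ++ y :: R).getLast? = R.getLast? := by
    rw [gl_append]
    obtain ⟨c, l', e⟩ := List.exists_cons_of_ne_nil h.nR
    rw [e, List.getLast?_cons_cons]
  have hhead : (P ++ y :: R).head? = P.head? := by
    obtain ⟨c, l', e⟩ := List.exists_cons_of_ne_nil h.nP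
    rw [e]; rfl
  refine ⟨?_, ?_, ?_, ?_⟩
  · rw [indP_append]
    refine ⟨h.iP, ?_, ?_⟩
    · refine indP_cons.2 ⟨fun b hb e => h.yR (e ▸ hb), h.hyR, h.iR⟩
    · intro a ha b hb
      rcases List.mem_cons.1 hb with rfl | hb'
      · refine ⟨fun e => h.yP (e ▸ ha), ?_⟩
        rw [G.adj_comm, h.hyP a ha]; simp
      · refine ⟨(h.cr a ha b hb').1, iff_of_false (h.cr a ha b hb').2 ?_⟩
        rintro ⟨-, h2⟩
        simp at h2; subst h2; exact h.yR hb'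
  · have := List.length_pos_of_ne_nil h.nP
    have := List.length_pos_of_ne_nil h.nR
    simp; omega
  · simp only [List.mem_append, List.mem_cons, not_or]
    exact ⟨h.xP, h.xy, h.xR⟩
  · intro b hb
    rw [hlast, hhead]
    rcases List.mem_append.1 hb with hb | hb
    · rw [h.hxP b hb]
      constructor
      · exact Or.inl
      · rintro (h1 | h1)
        · exact h1
        · exact absurd rfl (h.cr b hb b (List.mem_of_getLast? h1)).1
    · rcases List.mem_cons.1 hb with rfl | hb
      · refine iff_of_false h.nxy ?_
        rintro (h1 | h1)
        · exact h.yP (List.mem_of_head? h1)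
        · exact h.yR (List.mem_of_getLast? h1)
      · rw [h.hxR b hb]
        constructor
        · exact Or.inr
        · rintro (h1 | h1)
          · exact absurd rfl (h.cr b (List.mem_of_head? h1) b hb).1
          · exact h1

def Nb (G : SimpleGraph U) (u : U) (L : List U) (i : ℕ) : Prop := ∃ h : i < L.length, G.Adj u L[i]

theorem nb_of_mem {u a : U} {L : List U} (ha : a ∈ L) (h : G.Adj u a) : ∃ i, Nb G u L i ∧ L[i]? = some a := by
  obtain ⟨i, hi, rfl⟩ := List.getElem_of_mem ha
  exact ⟨i, ⟨hi, h⟩, by simp⟩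

theorem nb_three {v : U} {P1 P2 P3 P4 : List U} {a b c : U} (ha : G.Adj v a) (hb : G.Adj v b) (hc : G.Adj v c) :
    ∃ i j k, i < j ∧ j < k ∧ Nb G v (P1 ++ a :: (P2 ++ b :: (P3 ++ c :: P4))) i ∧
      Nb G v (P1 ++ a :: (P2 ++ b :: (P3 ++ c :: P4))) j ∧ Nb G v (P1 ++ a :: (P2 ++ b :: (P3 ++ c :: P4))) k := by
  refine ⟨P1.length, P1.length + (1 + P2.length), P1.length + (1 + P2.length + (1 + P3.length)), by omega, by omega, ⟨by simp, by simpa⟩, ⟨by simp; omega, ?_⟩, ⟨by simp; omega, ?_⟩⟩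
  · have : (P1 ++ a :: (P2 ++ b :: (P3 ++ c :: P4))) = (P1 ++ a :: P2) ++ b :: (P3 ++ c :: P4) := by simp
    simp only [this]
    rw [List.getElem_append_right (by simp)]
    simpa [show P1.length + (1 + P2.length) - (P1.length + (P2.length + 1)) = 0 by omega] using hb
  · have : (P1 ++ a :: (P2 ++ b :: (P3 ++ c :: P4))) = (P1 ++ a :: (P2 ++ b :: P3)) ++ c :: P4 := by simp
    simp only [this]
    rw [List.getElem_append_right (by simp; omega)]
    simpa [show P1.length + (1 + P2.length + (1 + P3.length)) - (P1.length + (P2.length + (P3.length + 1) + 1)) = 0 by omega] using hc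

theorem nap_three (hG : ¬ContainsTheta G) {x y v : U} {P R : List U} (h : RingH G x y P R)
    (hn : NAP G v P) (vP : v ∉ P) (vR : v ∉ R) (vx : ¬G.Adj v x) (vy : ¬G.Adj v y) (nvx : v ≠ x) (nvy : v ≠ y)
    (hR : ∀ r ∈ R, ¬G.Adj v r) : ∃ i j k, i < j ∧ j < k ∧ Nb G v P i ∧ Nb G v P j ∧ Nb G v P k := by
  obtain ⟨a0, ha0, b0, hb0, hab0, nab0, va0, vb0⟩ := hn
  obtain ⟨P1, a, T, rfl, va, hP1⟩ := first_sat (L := P) (q := G.Adj v) ⟨a0, ha0, va0⟩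
  have hT : ∃ z ∈ T, G.Adj v z := by
    by_contra hcon
    push Not at hcon
    have k : ∀ z ∈ P1 ++ a :: T, G.Adj v z → z = a := by
      intro z hz hvz
      simp only [List.mem_append, List.mem_cons] at hz
      rcases hz with hz | hz | hz
      · exact absurd hvz (hP1 z hz)
      · exact hz
      · exact absurd hvz (hcon z hz)
    exact hab0 ((k a0 ha0 va0).trans (k b0 hb0 vb0).symm)
  obtain ⟨P2, b, P3, rfl, vb, hP3⟩ := last_sat hT
  by_cases h2 : ∃ z ∈ P2, G.Adj v z
  · obtain ⟨M1, c, M2, rfl, vc, -⟩ := first_sat h2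
    have := nb_three (G := G) (P1 := P1) (P2 := M1) (P3 := M2) (P4 := P3) va vc vb
    simpa using this
  · exfalso
    push Not at h2
    have hc := h.cyc
    have hc' : CycL G x (P1 ++ a :: (P2 ++ b :: (P3 ++ y :: R))) := by simpa using hc
    have hc2 := cyc_rot hc'
    have hc3 : CycL G a (P2 ++ b :: ((P3 ++ y :: R) ++ x :: P1)) := by simpa using hc2
    refine cyc_theta hG hc3 ?_ (by simp) va vb ?_ ?_
    · rintro rfl
      have : ∀ z ∈ P1 ++ a :: ([] ++ b :: P3), G.Adj v z → z = a ∨ z = b := by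
        intro z hz hvz
        simp only [List.mem_append, List.mem_cons, List.not_mem_nil, false_or] at hz
        rcases hz with hz | hz | hz | hz
        · exact absurd hvz (hP1 z hz)
        · exact Or.inl hz
        · exact Or.inr hz
        · exact absurd hvz (hP3 z hz)
      have hadj : G.Adj a b := by
        have := indP_append_right h.iP
        exact ((indP_cons.1 this).2.1 b (by simp)).2 (by simp)
      rcases this a0 ha0 va0 with rfl | rfl <;> rcases this b0 hb0 vb0 with rfl | rfl
      · exact hab0 rfl
      · exact nab0 hadj
      · exact nab0 hadj.symm
      · exact hab0 rfl
    · intro z hz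
      simp only [List.mem_append, List.mem_cons] at hz
      rcases hz with hz | (hz | rfl | hz) | rfl | hz
      · exact h2 z hz
      · exact hP3 z hz
      · exact vy
      · exact hR z hz
      · exact vx
      · exact hP1 z hz
    · simp only [List.mem_append, List.mem_cons, not_or] at vP ⊢
      tauto

theorem nested_pos {n : ℕ} {f : ZMod n → U} {u v : U} (hn : 0 < n) (h : NestedCfg G n f u v) :
    ∃ s d : ℕ, s < n ∧ 1 ≤ d ∧ d < n ∧ (∀ k < n, G.Adj u (f (k : ZMod n)) → ∃ e ≤ d, k = s + e ∨ k + n = s + e) ∧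
      (∀ k < n, G.Adj v (f (k : ZMod n)) → ∃ e, d ≤ e ∧ e ≤ n ∧ (k = s + e ∨ k + n = s + e)) := by
  obtain ⟨i, d, h1, h2, h3, h4⟩ := h
  obtain ⟨s, hs, rfl⟩ := zrep hn i
  have key : ∀ k e : ℕ, k < n → e ≤ n → (k : ZMod n) = s + e → (k = s + e ∨ k + n = s + e) := by
    intro k e hk he h
    have h : (k : ZMod n) = ((s + e : ℕ) : ZMod n) := by push_cast; exact h
    rw [ZMod.natCast_eq_natCast_iff', Nat.mod_eq_of_lt hk] at h
    have := Nat.div_add_mod (s + e) n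
    rw [← h] at this
    have hq : (s + e) / n < 2 := by
      rw [Nat.div_lt_iff_lt_mul hn]; omega
    interval_cases hh : (s + e) / n <;> omega
  refine ⟨s, d, hs, h1, h2, ?_, ?_⟩
  · intro k hk ha
    obtain ⟨e, he, hm⟩ := h3 _ ha
    exact ⟨e, he, key k e hk (by omega) hm⟩
  · intro k hk ha
    obtain ⟨e, he, hm⟩ := h4 _ ha
    refine ⟨d + e, by omega, by omega, key k (d + e) hk (by omega) ?_⟩
    rw [hm]; push_cast; ring

theorem ncard_three {α : Type} {s : Set α} [Finite α] {a b c : α} (ha : a ∈ s) (hb : b ∈ s) (hc : c ∈ s)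
    (hab : a ≠ b) (hac : a ≠ c) (hbc : b ≠ c) : 3 ≤ s.ncard := by
  rw [← Set.ncard_eq_three.2 ⟨a, b, c, hab, hac, hbc, rfl⟩]
  refine Set.ncard_le_ncard ?_ (Set.toFinite _)
  rintro x (rfl | rfl | rfl) <;> assumption

theorem wheel_nested (hG : InClassC G) {x y : U} {P R : List U} (h : RingH G x y P R) {u v : U}
    (uL : u ∉ x :: (P ++ y :: R)) (vL : v ∉ x :: (P ++ y :: R)) (huv : u ≠ v) (nuv : ¬G.Adj u v)
    (u3 : ∃ i j k, i < j ∧ j < k ∧ Nb G u (x :: (P ++ y :: R)) i ∧ Nb G u (x :: (P ++ y :: R)) j ∧ Nb G u (x :: (P ++ y :: R)) k)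
    (v3 : ∃ i j k, i < j ∧ j < k ∧ Nb G v (x :: (P ++ y :: R)) i ∧ Nb G v (x :: (P ++ y :: R)) j ∧ Nb G v (x :: (P ++ y :: R)) k)
    (ux : ¬G.Adj u x) (uy : ¬G.Adj u y) (uP : ∃ p ∈ P, G.Adj u p) (uR : ∃ p ∈ R, G.Adj u p) :
    ∃ s d : ℕ, s < P.length + R.length + 2 ∧ 1 ≤ d ∧ d < P.length + R.length + 2 ∧
      (∀ k, Nb G u (x :: (P ++ y :: R)) k → ∃ e ≤ d, k = s + e ∨ k + (P.length + R.length + 2) = s + e) ∧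
      (∀ k, Nb G v (x :: (P ++ y :: R)) k → ∃ e, d ≤ e ∧ e ≤ P.length + R.length + 2 ∧ (k = s + e ∨ k + (P.length + R.length + 2) = s + e)) := by
  have hlen : (x :: (P ++ y :: R)).length = P.length + R.length + 2 := by simp; omega
  have hcyc := h.cyc
  set n := P.length + R.length + 2 with hn
  have hn0 : 0 < n := by omega
  have : NeZero n := ⟨by omega⟩
  obtain ⟨f, hf, hfk⟩ := hole_of_list hcyc (n := n) (by simp; omega)
  set L := x :: (P ++ y :: R) with hL
  have nbf : ∀ w k, Nb G w L k → k < n ∧ G.Adj w (f (k : ZMod n)) := by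
    rintro w k ⟨hk, h⟩
    exact ⟨by omega, by rw [hfk k hk]; exact h⟩
  have fnb : ∀ w k, k < n → G.Adj w (f (k : ZMod n)) → Nb G w L k := by
    intro w k hk h
    have hk' : k < L.length := by omega
    exact ⟨hk', by rw [← hfk k hk']; exact h⟩
  have nr : ∀ w, w ∉ L → w ∉ Set.range f := by
    rintro w hw ⟨m, rfl⟩
    obtain ⟨k, hk, rfl⟩ := zrep hn0 m
    rw [hfk k (by omega)] at hw
    exact hw (List.getElem_mem _)
  have c3 : ∀ w, (∃ i j k, i < j ∧ j < k ∧ Nb G w L i ∧ Nb G w L j ∧ Nb G w L k) →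
      3 ≤ {m : ZMod n | G.Adj w (f m)}.ncard := by
    rintro w ⟨i, j, k, hij, hjk, h1, h2, h3⟩
    obtain ⟨a1, b1⟩ := nbf _ _ h1
    obtain ⟨a2, b2⟩ := nbf _ _ h2
    obtain ⟨a3, b3⟩ := nbf _ _ h3
    refine ncard_three (a := (i : ZMod n)) (b := (j : ZMod n)) (c := (k : ZMod n)) b1 b2 b3 ?_ ?_ ?_
    · rw [Ne, zcast_eq a1 a2]; omega
    · rw [Ne, zcast_eq a1 a3]; omega
    · rw [Ne, zcast_eq a2 a3]; omega
  rcases hG.2.2.2.2 n f u v ⟨hf, huv, nr u uL, nr v vL, c3 u u3, c3 v v3⟩ nuv with hh | hh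
  · obtain ⟨s, d, h1, h2, h3, h4, h5⟩ := nested_pos hn0 hh
    refine ⟨s, d, h1, h2, h3, ?_, ?_⟩
    · intro k hk; obtain ⟨a, b⟩ := nbf _ _ hk; exact h4 k a b
    · intro k hk; obtain ⟨a, b⟩ := nbf _ _ hk; exact h5 k a b
  · exfalso
    have hc : ∃ i : ZMod n, ∀ m : ZMod n, G.Adj u (f m) ↔ (m = i ∨ m = i + 1 ∨ m = i + 2) := by
      rcases hh with ⟨i, h1, h2⟩ | ⟨i, h1, h2⟩
      · exact ⟨i, h1⟩
      · refine ⟨i + 1, fun m => ?_⟩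
        rw [h2, show i + 1 + 1 = i + 2 by ring, show i + 1 + 2 = i + 3 by ring]
    obtain ⟨i, hi⟩ := hc
    obtain ⟨s, hs, rfl⟩ := zrep hn0 i
    -- positions
    have hx0 : ¬G.Adj u (f ((0 : ℕ) : ZMod n)) := by
      rw [hfk 0 (by omega)]; simpa [hL] using ux
    have hyp : ¬G.Adj u (f ((P.length + 1 : ℕ) : ZMod n)) := by
      rw [hfk _ (by omega)]; simpa [hL] using uy
    obtain ⟨p, hp, up⟩ := uP
    obtain ⟨r, hr, ur⟩ := uR
    obtain ⟨ip, hip, rfl⟩ := List.getElem_of_mem hp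
    obtain ⟨ir, hir, rfl⟩ := List.getElem_of_mem hr
    have h1 : G.Adj u (f ((ip + 1 : ℕ) : ZMod n)) := by
      rw [hfk _ (by omega)]
      simp only [hL, List.getElem_cons_succ]
      rw [List.getElem_append_left hip]; exact up
    have h2 : G.Adj u (f ((P.length + 1 + (ir + 1) : ℕ) : ZMod n)) := by
      rw [hfk _ (by omega)]
      simp only [hL, show P.length + 1 + (ir + 1) = (P.length + (ir + 1)) + 1 by omega, List.getElem_cons_succ]
      rw [List.getElem_append_right (by omega)]
      simpa using ur
    have md : ∀ k e : ℕ, k < n → e ≤ 2 → ((k : ZMod n) = s + e ↔ (k = s + e ∨ k + n = s + e)) := by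
      intro k e hk he
      rw [show (s : ZMod n) + e = ((s + e : ℕ) : ZMod n) by push_cast; rfl, ZMod.natCast_eq_natCast_iff', Nat.mod_eq_of_lt hk]
      rcases Nat.lt_or_ge (s + e) n with h | h
      · rw [Nat.mod_eq_of_lt h]; omega
      · rw [Nat.mod_eq_sub_mod h, Nat.mod_eq_of_lt (by omega)]; omega
    have hi' : ∀ k < n, G.Adj u (f (k : ZMod n)) ↔ (k = s + 0 ∨ k + n = s + 0) ∨ (k = s + 1 ∨ k + n = s + 1) ∨ (k = s + 2 ∨ k + n = s + 2) := by
      intro k hk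
      rw [hi, ← md k 0 hk (by omega), ← md k 1 hk (by omega), ← md k 2 hk (by omega)]
      push_cast; simp
    rw [hi' _ (by omega)] at hx0 hyp h1 h2
    omega

theorem nb_ring {x y u : U} {P R : List U} {i : ℕ} (h : Nb G u P i) : Nb G u (x :: (P ++ y :: R)) (i + 1) := by
  obtain ⟨hi, h⟩ := h
  refine ⟨by simp; omega, ?_⟩
  rw [List.getElem_cons_succ, List.getElem_append_left hi]; exact h

theorem nb_ringR {x y u : U} {P R : List U} {i : ℕ} (h : Nb G u R i) : Nb G u (x :: (P ++ y :: R)) (P.length + 2 + i) := by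
  obtain ⟨hi, h⟩ := h
  refine ⟨by simp; omega, ?_⟩
  simp only [show P.length + 2 + i = (P.length + (i + 1)) + 1 by omega, List.getElem_cons_succ]
  rw [List.getElem_append_right (by omega)]
  simpa using h

theorem nap_two {u : U} {P : List U} (h : NAP G u P) : ∃ i j, i < j ∧ Nb G u P i ∧ Nb G u P j := by
  obtain ⟨a, ha, b, hb, hab, -, ua, ub⟩ := h
  obtain ⟨i, hi, rfl⟩ := List.getElem_of_mem ha
  obtain ⟨j, hj, rfl⟩ := List.getElem_of_mem hb
  rcases lt_trichotomy i j with h | rfl | h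
  · exact ⟨i, j, h, ⟨hi, ua⟩, ⟨hj, ub⟩⟩
  · exact absurd rfl hab
  · exact ⟨j, i, h, ⟨hj, ub⟩, ⟨hi, ua⟩⟩

theorem no_between (hG : InClassC G) {x y : U} {P R : List U} (h : RingH G x y P R) {u v : U}
    (uL : u ∉ x :: (P ++ y :: R)) (vL : v ∉ x :: (P ++ y :: R)) (huv : u ≠ v) (nuv : ¬G.Adj u v)
    (hu : NAP G u P) (hv : NAP G v P) (ux : ¬G.Adj u x) (uy : ¬G.Adj u y) (vx : ¬G.Adj v x) (vy : ¬G.Adj v y)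
    (uR : ∃ r ∈ R, G.Adj u r) (vR : ∀ r ∈ R, ¬G.Adj v r) :
    (∀ i j k, i < j → j < k → Nb G v P i → Nb G u P j → Nb G v P k → False) ∧
    ∃ i j k, i < j ∧ j < k ∧ Nb G v P i ∧ Nb G v P j ∧ Nb G v P k := by
  have hv3 := nap_three hG.1 h hv (by simp at vL; tauto) (by simp at vL; tauto) vx vy (by simp at vL; tauto) (by simp at vL; tauto) vR
  refine ⟨?_, hv3⟩
  obtain ⟨i0, j0, hij0, n1, n2⟩ := nap_two hu
  obtain ⟨r, hr, ur⟩ := uR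
  obtain ⟨k0, n3, -⟩ := nb_of_mem hr ur
  have n3' := nb_ringR (x := x) (y := y) (P := P) n3
  have b1 := n2.1
  obtain ⟨a1, a2, a3, a12, a23, m1, m2, m3⟩ := hv3
  obtain ⟨s, d, hs, hd, hdn, h1, h2⟩ := wheel_nested hG h uL vL huv nuv
    ⟨_, _, _, Nat.succ_lt_succ hij0, by omega, nb_ring n1, nb_ring n2, n3'⟩
    ⟨_, _, _, Nat.succ_lt_succ a12, Nat.succ_lt_succ a23, nb_ring m1, nb_ring m2, nb_ring m3⟩ ux uy
    ⟨_, List.getElem_mem n1.1, n1.2⟩ ⟨r, hr, ur⟩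
  intro i j k hij hjk e1 e2 e3
  have l3 := e3.1
  obtain ⟨x1, _, q1⟩ := h1 _ n3'
  obtain ⟨x2, _, q2⟩ := h1 _ (nb_ring e2)
  obtain ⟨x3, _, _, q3⟩ := h2 _ (nb_ring e1)
  obtain ⟨x4, _, _, q4⟩ := h2 _ (nb_ring e3)
  have := n3.1
  omega

theorem two_wheel (hG : InClassC G) {x y : U} {P R1 R2 Q P' : List U} {u v : U}
    (h1 : RingH G x y P R1) (h2 : RingH G x y P R2)
    (uL1 : u ∉ x :: (P ++ y :: R1)) (vL1 : v ∉ x :: (P ++ y :: R1))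
    (uL2 : u ∉ x :: (P ++ y :: R2)) (vL2 : v ∉ x :: (P ++ y :: R2)) (huv : u ≠ v) (nuv : ¬G.Adj u v)
    (hu : NAP G u P) (hv : NAP G v P) (ux : ¬G.Adj u x) (uy : ¬G.Adj u y) (vx : ¬G.Adj v x) (vy : ¬G.Adj v y)
    (uR : ∃ r ∈ R1, G.Adj u r) (vR : ∀ r ∈ R1, ¬G.Adj v r)
    (vR2 : ∃ r ∈ R2, G.Adj v r) (uR2 : ∀ r ∈ R2, ¬G.Adj u r)
    (hQ : P = Q ++ P') (hQn : Q ≠ []) (huQ : AtH G u Q) (hvQ : AtL G v Q) : False := by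
  obtain ⟨nv, v1, v2, v3, v12, v23, w1, w2, w3⟩ := no_between hG h1 uL1 vL1 huv nuv hu hv ux uy vx vy uR vR
  obtain ⟨nu, u1, u2, u3, u12, u23, z1, z2, z3⟩ := no_between hG h2 vL2 uL2 huv.symm (fun h => nuv h.symm) hv hu vx vy ux uy vR2 uR2
  have hq := List.length_pos_of_ne_nil hQn
  have hlt : ∀ i, i < Q.length → i < P.length := by intro i hi; rw [hQ]; simp; omega
  have idx : IndP G Q := by have := h1.iP; rw [hQ] at this; exact indP_append_left this
  have u0 : Nb G u P 0 := by
    refine ⟨hlt 0 hq, ?_⟩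
    simp only [hQ]
    rw [List.getElem_append_left hq, huQ _ (List.getElem_mem _), List.head?_eq_getElem?]; simp
  have vq : Nb G v P (Q.length - 1) := by
    refine ⟨hlt _ (by omega), ?_⟩
    simp only [hQ]
    rw [List.getElem_append_left (by omega), hvQ _ (List.getElem_mem _), List.getLast?_eq_getElem?]; simp
  have uge : ∀ i, Nb G u P i → i = 0 ∨ Q.length ≤ i := by
    rintro i ⟨hi, h⟩
    by_contra hcon
    push Not at hcon
    simp only [hQ] at h
    rw [List.getElem_append_left hcon.2, huQ _ (List.getElem_mem _), List.head?_eq_getElem?] at h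
    obtain ⟨h', h⟩ := List.getElem?_eq_some_iff.1 h
    exact (indP_idx idx (i := 0) (j := i) (by omega) hcon.2).1 h
  have := uge _ z2
  have := uge _ z3
  by_cases hq1 : Q.length = 1
  · rw [hq1] at vq
    have a : u3 ≤ v2 := by
      by_contra hcon
      exact nu 0 v2 u3 (by omega) (by omega) u0 w2 z3
    exact nv 0 u2 v3 (by omega) (by omega) vq z2 w3
  · exact nu 0 (Q.length - 1) u2 (by omega) (by omega) u0 vq z2

end P7

set_option linter.unusedSectionVars false
set_option linter.unusedVariables false

section P8
variable {U : Type} [DecidableEq U] {G : SimpleGraph U}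

theorem Cfg.monoA {A A' B : Set U} {t : Finset U} (h : Cfg G A B t) (hA : A' ⊆ A) : Cfg G A' B t :=
  ⟨fun a ha => h.dis a (hA ha), fun a ha => h.anti a (hA ha), fun i hi h' => h.tA i hi (hA h'), h.tB, h.ind⟩

theorem AtH.initial {u : U} {Q P' : List U} (h : AtH G u (Q ++ P')) (hQ : Q ≠ []) : AtH G u Q := by
  intro p hp
  rw [h p (by simp [hp])]
  obtain ⟨c, l', rfl⟩ := List.exists_cons_of_ne_nil hQ
  rfl

theorem first_pre {P : List U} {σ0 τ0 : U} (hs : ∃ p ∈ P, G.Adj σ0 p) (ht : ∃ p ∈ P, G.Adj τ0 p) (hP : IndP G P) :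
    ∃ Q P' σ τ, P = Q ++ P' ∧ Q ≠ [] ∧ ((σ = σ0 ∧ τ = τ0) ∨ (σ = τ0 ∧ τ = σ0)) ∧ AtL G τ Q ∧ ∃ p ∈ Q, G.Adj σ p := by
  have key : ∀ (τ : U) (L1 : List U) (c : U) (L2 : List U), IndP G (L1 ++ [c]) → G.Adj τ c → (∀ x ∈ L1, ¬G.Adj τ x) → AtL G τ (L1 ++ [c]) := by
    intro τ L1 c L2 hi h1 h2 p hp
    rw [gl_snoc]
    rcases List.mem_append.1 hp with h | h
    · refine iff_of_false (h2 p h) ?_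
      intro e
      have e : c = p := by simpa using e
      exact ((indP_append.1 hi).2.2 p h c (by simp)).1 e.symm
    · simp only [List.mem_singleton] at h
      subst h; simp [h1]
  obtain ⟨L1, c, L2, e1, h1, h2⟩ := first_sat hs
  obtain ⟨M1, d, M2, e2, k1, k2⟩ := first_sat ht
  have p1 : L1 ++ [c] <+: P := ⟨L2, by simp [e1]⟩
  have p2 : M1 ++ [d] <+: P := ⟨M2, by simp [e2]⟩
  have q1 : IndP G (L1 ++ [c]) := by
    have : P = (L1 ++ [c]) ++ L2 := by simp [e1]
    rw [this] at hP; exact indP_append_left hP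
  have q2 : IndP G (M1 ++ [d]) := by
    have : P = (M1 ++ [d]) ++ M2 := by simp [e2]
    rw [this] at hP; exact indP_append_left hP
  rcases le_total L1.length M1.length with h | h
  · have := List.prefix_of_prefix_length_le p1 p2 (by simpa using h)
    refine ⟨M1 ++ [d], M2, σ0, τ0, by simp [e2], by simp, Or.inl ⟨rfl, rfl⟩, key _ _ _ M2 q2 k1 k2, c, this.subset (by simp), h1⟩
  · have := List.prefix_of_prefix_length_le p2 p1 (by simpa using h)
    refine ⟨L1 ++ [c], L2, τ0, σ0, by simp [e1], by simp, Or.inr ⟨rfl, rfl⟩, key _ _ _ L2 q1 h1 h2, d, this.subset (by simp), k1⟩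

theorem tri3 {A : Set U} {P : List U} {u v w : U} {t : Finset U} (ht : t = {u, v, w})
    (hP : IndP G P) (hPA : ∀ p ∈ P, p ∈ A) (hu : AtH G u P) (hv : AtL G v P) (hw : ∃ p ∈ P, G.Adj w p)
    (tA : ∀ i ∈ t, i ∉ A) (ti : ∀ i ∈ t, ∀ j ∈ t, ¬G.Adj i j) (huv : u ≠ v) (huw : u ≠ w) (hvw : v ≠ w) :
    (Strong G A t w ∧ NAP G w P) ∨ Weak G A t (fun i => (i = u → AtH G w P) ∧ (i = v → AtL G w P)) := by
  subst ht
  rcases path_side (A := A) (Z := [w]) (h := w) hP hPA hu hv (indP_single w) rfl rfl (by simp) (by simp) hw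
    (by simpa using ti u (by simp) w (by simp)) (by simpa using ti v (by simp) w (by simp)) (tA u (by simp)) (tA v (by simp)) (tA w (by simp)) huv huw hvw
    (ti u (by simp) v (by simp)) with h | h
  · exact Or.inl h.2.2
  · exact Or.inr (h.mono subset_rfl (fun i hi h => ⟨h.1, h.2.1⟩))

theorem first_full {A : Set U} {P : List U} {x σ0 τ0 : U} {t : Finset U} (ht : t = {x, σ0, τ0})
    (hP : IndP G P) (hPA : ∀ p ∈ P, p ∈ A) (hx : AtH G x P) (hs : ∃ p ∈ P, G.Adj σ0 p) (hτ : ∃ p ∈ P, G.Adj τ0 p)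
    (tA : ∀ i ∈ t, i ∉ A) (ti : ∀ i ∈ t, ∀ j ∈ t, ¬G.Adj i j) (h1 : x ≠ σ0) (h2 : x ≠ τ0) (h3 : σ0 ≠ τ0) :
    ∃ Q P' σ τ, P = Q ++ P' ∧ Q ≠ [] ∧ ((σ = σ0 ∧ τ = τ0) ∨ (σ = τ0 ∧ τ = σ0)) ∧ AtL G τ Q ∧
      (Strong G A t σ ∨ Weak G A t (fun i => i = x → AtH G σ Q)) := by
  obtain ⟨Q, P', σ, τ, rfl, hQ, hst, hL, hσ⟩ := first_pre hs hτ hP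
  refine ⟨Q, P', σ, τ, rfl, hQ, hst, hL, ?_⟩
  have ht' : t = {x, τ, σ} := by
    rw [ht]; rcases hst with ⟨rfl, rfl⟩ | ⟨rfl, rfl⟩
    · rw [Finset.pair_comm]
    · rfl
  have d : x ≠ τ ∧ x ≠ σ ∧ τ ≠ σ := by
    rcases hst with ⟨rfl, rfl⟩ | ⟨rfl, rfl⟩
    · exact ⟨h2, h1, h3.symm⟩
    · exact ⟨h1, h2, h3⟩
  rcases tri3 (A := A) ht' (indP_append_left hP) (fun p hp => hPA p (by simp [hp])) (hx.initial hQ) hL hσ tA ti d.1 d.2.1 d.2.2 with h | h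
  · exact Or.inl h.1
  · exact Or.inr (h.mono subset_rfl (fun i hi h => h.1))

theorem head_weak_false (hG : InClassC G) {A B : Set U} {P : List U} {x σ0 τ0 : U} {t : Finset U} (ht : t = {x, σ0, τ0})
    (hC : Cfg G A B t) (hB : Weak G B t (· = x))
    (hP : IndP G P) (hPA : ∀ p ∈ P, p ∈ A) (hx : AtH G x P) (hs : ∃ p ∈ P, G.Adj σ0 p) (hτ : ∃ p ∈ P, G.Adj τ0 p)
    (h1 : x ≠ σ0) (h2 : x ≠ τ0) (h3 : σ0 ≠ τ0) : False := by
  have h3c : t.card = 3 := by rw [ht]; exact card3 h1 h2 h3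
  obtain ⟨Q, P', σ, τ, -, -, hst, -, h⟩ := first_full ht hP hPA hx hs hτ hC.tA hC.ind h1 h2 h3
  rcases h with h | h
  · have := T2 hG h3c hC h hB
    rcases hst with ⟨rfl, rfl⟩ | ⟨rfl, rfl⟩
    · exact h1 this.symm
    · exact h2 this.symm
  · exact T1 hG h3c hC h hB

/-- three consecutive vertices of a square -/
theorem weak_three {A : Set U} {c0 c1 c2 x0 x1 x2 : U} (a01 : G.Adj c0 c1) (a12 : G.Adj c1 c2) (n02 : ¬G.Adj c0 c2) (d02 : c0 ≠ c2)
    (p0 : Priv G A x0 c0) (p1 : Priv G A x1 c1) (p2 : Priv G A x2 c2) {t : Finset U} (ht : t = {x1, x0, x2})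
    (tA : ∀ i ∈ t, i ∉ A) (ti : ∀ i ∈ t, ∀ j ∈ t, ¬G.Adj i j) : Weak G A t (· = x1) := by
  have hP : IndP G [c0, c1, c2] := by
    simp only [IndP]
    simp [a01, a12, n02, d02, a01.ne, a12.ne]
  have hPA : ∀ p ∈ [c0, c1, c2], p ∈ A := by simp [p0.1, p1.1, p2.1]
  have x01 : x0 ≠ x1 := p0.ne p1 a01.ne
  have x02 : x0 ≠ x2 := p0.ne p2 d02
  have x12 : x1 ≠ x2 := p1.ne p2 a12.ne
  have ht' : t = {x0, x2, x1} := by rw [ht]; ext z; simp; tauto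
  have hn : ∀ p ∈ [c0, c1, c2], G.Adj x1 p → p = c1 := fun p hp h => (p1.2 p (hPA p hp)).1 h
  rcases tri3 (A := A) ht' hP hPA (p0.atH hPA rfl) (p2.atL hPA rfl) (w := x1) ⟨c1, by simp, (p1.2 c1 p1.1).2 rfl⟩ tA ti x02 x01 x12.symm with h | h
  · exfalso
    obtain ⟨-, a, ha, b, hb, hab, -, h1, h2⟩ := h
    exact hab ((hn a ha h1).trans (hn b hb h2).symm)
  · refine h.mono subset_rfl ?_
    intro i hi hM
    rw [ht'] at hi
    simp only [Finset.mem_insert, Finset.mem_singleton] at hi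
    rcases hi with hi | hi | hi
    · have := (hM.1 hi c0 (by simp)).2 (by simp)
      exact absurd (hn c0 (by simp) this) a01.ne
    · have := (hM.2 hi c2 (by simp)).2 (by simp)
      exact absurd (hn c2 (by simp) this) a12.ne.symm
    · exact hi

theorem MCtx.no_c4 [Finite U] {A B : Set U} {I : Finset U} (h : MCtx G A B I) (h' : MCtx G B A I) (hc : C4 G A I) : False := by
  obtain ⟨c1, c2, c3, c4, x1, x2, x3, x4, a12, a23, a34, a41, n13, n24, d13, d24, m1, m2, m3, m4, p1, p2, p3, p4⟩ := hc
  have x12 := p1.ne p2 a12.ne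
  have x13 := p1.ne p3 d13
  have x14 := p1.ne p4 a41.ne.symm
  have x23 := p2.ne p3 a23.ne
  have x24 := p2.ne p4 d24
  have x34 := p3.ne p4 a34.ne
  obtain ⟨J, hJ⟩ : ∃ J : Finset U, J = {x1, x2, x3, x4} := ⟨_, rfl⟩
  have hJI : J ⊆ I := by intro z hz; rw [hJ] at hz; simp at hz; rcases hz with rfl | rfl | rfl | rfl <;> assumption
  have hJc : J.card = 4 := by rw [hJ]; exact Finset.card_eq_of_equiv_fin (Fintype.equivFinOfCardEq (by simp [x12, x13, x14, x23, x24, x34]))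
  obtain ⟨B', hB', hM⟩ := exists_minConn (I := J) h'.hM.1 (fun z hz => h'.hM.2.1 z (hJI hz))
  have hC' : Cfg G B' A J := (h'.hC.mono hJI).monoA hB'
  have M' : MCtx G B' A J := ⟨h.hG, hM, hC', fun t ht => h'.hB t (ht.trans hJI)⟩
  -- weak triples of A
  have w1 : Weak G A {x1, x4, x2} (· = x1) := weak_three a41 a12 (fun h => n24 h.symm) d24.symm p4 p1 p2 rfl
    (fun i hi => h.hC.tA i (by simp at hi; rcases hi with rfl | rfl | rfl <;> assumption))
    (fun i hi j hj => h.hC.ind i (by simp at hi; rcases hi with rfl | rfl | rfl <;> assumption) j (by simp at hj; rcases hj with rfl | rfl | rfl <;> assumption))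
  have w2 : Weak G A {x2, x1, x3} (· = x2) := weak_three a12 a23 n13 d13 p1 p2 p3 rfl
    (fun i hi => h.hC.tA i (by simp at hi; rcases hi with rfl | rfl | rfl <;> assumption))
    (fun i hi j hj => h.hC.ind i (by simp at hi; rcases hi with rfl | rfl | rfl <;> assumption) j (by simp at hj; rcases hj with rfl | rfl | rfl <;> assumption))
  have w3 : Weak G A {x3, x2, x4} (· = x3) := weak_three a23 a34 n24 d24 p2 p3 p4 rfl
    (fun i hi => h.hC.tA i (by simp at hi; rcases hi with rfl | rfl | rfl <;> assumption))
    (fun i hi j hj => h.hC.ind i (by simp at hi; rcases hi with rfl | rfl | rfl <;> assumption) j (by simp at hj; rcases hj with rfl | rfl | rfl <;> assumption))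
  have w4 : Weak G A {x4, x3, x1} (· = x4) := weak_three a34 a41 (fun h => n13 h.symm) d13.symm p3 p4 p1 rfl
    (fun i hi => h.hC.tA i (by simp at hi; rcases hi with rfl | rfl | rfl <;> assumption))
    (fun i hi j hj => h.hC.ind i (by simp at hi; rcases hi with rfl | rfl | rfl <;> assumption) j (by simp at hj; rcases hj with rfl | rfl | rfl <;> assumption))
  rcases path_or_c4 M' (by omega) with ⟨P, u, v, hP⟩ | hc
  · have att : ∀ z ∈ J, ∃ p ∈ P, G.Adj z p := by
      intro z hz
      obtain ⟨a, ha, h⟩ := hM.2.1 z hz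
      exact ⟨a, (hP.mem a).1 ha, h⟩
    have hPB : ∀ p ∈ P, p ∈ B' := fun p hp => (hP.mem p).2 hp
    have fin : ∀ x s r, x ∈ J → s ∈ J → r ∈ J → x ≠ s → x ≠ r → s ≠ r → u = x → Weak G A {x, s, r} (· = x) → False := by
      intro x s r hx hs hr d1 d2 d3 hu hw
      subst hu
      refine head_weak_false h.hG rfl (hC'.mono ?_) hw hP.ind hPB hP.atH (att s hs) (att r hr) d1 d2 d3
      intro z hz; simp at hz; rcases hz with rfl | rfl | rfl <;> assumption
    have j1 : x1 ∈ J := by simp [hJ]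
    have j2 : x2 ∈ J := by simp [hJ]
    have j3 : x3 ∈ J := by simp [hJ]
    have j4 : x4 ∈ J := by simp [hJ]
    have hu := hP.hx
    rw [hJ] at hu
    simp only [Finset.mem_insert, Finset.mem_singleton] at hu
    rcases hu with hu | hu | hu | hu
    · exact fin x1 x4 x2 j1 j4 j2 x14 x12 x24.symm hu w1
    · exact fin x2 x1 x3 j2 j1 j3 x12.symm x23 x13 hu w2
    · exact fin x3 x2 x4 j3 j2 j4 x23.symm x34 x24 hu w3
    · exact fin x4 x3 x1 j4 j3 j1 x34.symm x14.symm x13.symm hu w4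
  · obtain ⟨e1, e2, e3, e4, y1, y2, y3, y4, b12, b23, b34, b41, o13, o24, f13, f24, k1, k2, k3, k4, q1, q2, q3, q4⟩ := hc
    have y12 := q1.ne q2 b12.ne
    have y13 := q1.ne q3 f13
    have y23 := q2.ne q3 b23.ne
    obtain ⟨t, ht⟩ : ∃ t : Finset U, t = {y2, y1, y3} := ⟨_, rfl⟩
    have htJ : t ⊆ J := by
      intro z hz; rw [ht] at hz; simp at hz; rcases hz with rfl | rfl | rfl <;> assumption
    have h3 : t.card = 3 := by rw [ht]; exact card3 y12.symm y23 y13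
    have hCt := hC'.mono htJ
    have wB : Weak G B' t (· = y2) := weak_three b12 b23 o13 f13 q1 q2 q3 ht hCt.tA hCt.ind
    have wA : ∃ m, Weak G A t (· = m) := by
      obtain ⟨z, hzJ, hz⟩ : ∃ z ∈ J, z ∉ t := by
        by_contra hcon
        push Not at hcon
        have := Finset.card_le_card (show J ⊆ t from hcon)
        omega
      have hte : t = J.erase z := by
        refine Finset.eq_of_subset_of_card_le ?_ ?_
        · intro w hw; exact Finset.mem_erase.2 ⟨fun e => hz (e ▸ hw), htJ hw⟩
        · rw [Finset.card_erase_of_mem hzJ]; omega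
      rw [hJ] at hzJ hte
      simp only [Finset.mem_insert, Finset.mem_singleton] at hzJ
      rcases hzJ with rfl | rfl | rfl | rfl
      · refine ⟨x3, ?_⟩
        convert w3 using 1
        rw [hte]; ext w; simp only [Finset.mem_erase, Finset.mem_insert, Finset.mem_singleton]
        constructor
        · tauto
        · rintro (rfl | rfl | rfl)
          · exact ⟨x13.symm, by tauto⟩
          · exact ⟨x12.symm, by tauto⟩
          · exact ⟨x14.symm, by tauto⟩
      · refine ⟨x4, ?_⟩
        convert w4 using 1
        rw [hte]; ext w; simp only [Finset.mem_erase, Finset.mem_insert, Finset.mem_singleton]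
        constructor
        · tauto
        · rintro (rfl | rfl | rfl)
          · exact ⟨x24.symm, by tauto⟩
          · exact ⟨x23.symm, by tauto⟩
          · exact ⟨x12, by tauto⟩
      · refine ⟨x1, ?_⟩
        convert w1 using 1
        rw [hte]; ext w; simp only [Finset.mem_erase, Finset.mem_insert, Finset.mem_singleton]
        constructor
        · tauto
        · rintro (rfl | rfl | rfl)
          · exact ⟨x13, by tauto⟩
          · exact ⟨x34.symm, by tauto⟩
          · exact ⟨x23, by tauto⟩
      · refine ⟨x2, ?_⟩
        convert w2 using 1
        rw [hte]; ext w; simp only [Finset.mem_erase, Finset.mem_insert, Finset.mem_singleton]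
        constructor
        · tauto
        · rintro (rfl | rfl | rfl)
          · exact ⟨x24, by tauto⟩
          · exact ⟨x14, by tauto⟩
          · exact ⟨x34, by tauto⟩
    obtain ⟨m, wA⟩ := wA
    exact T1 h.hG h3 hCt wB wA

theorem PathC.rev {A : Set U} {I : Finset U} {P : List U} {x y : U} (h : PathC G A I P x y) : PathC G A I P.reverse y x :=
  ⟨indP_reverse h.ind, fun a => by rw [h.mem]; simp, h.hy, h.hx, h.xy.symm, h.atL.rev, h.atH.rev⟩

theorem PathC.headed {A : Set U} {I : Finset U} {P : List U} {x y s : U} (h : PathC G A I P x y) (hs : s ∈ I) (hH : AtH G s P) :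
    ∃ y, PathC G A I P s y := by
  by_cases e : s = y
  · subst e
    refine ⟨x, h.ind, h.mem, hs, h.hx, h.xy.symm, hH, ?_⟩
    intro p hp
    rw [h.atH p hp, ← hH p hp, h.atL p hp]
  · exact ⟨y, h.ind, h.mem, hs, h.hy, e, hH, h.atL⟩

structure DCtx (G : SimpleGraph U) (A B : Set U) (I : Finset U) : Prop where
  mA : MCtx G A B I
  mB : MCtx G B A I

theorem DCtx.symm {A B : Set U} {I : Finset U} (h : DCtx G A B I) : DCtx G B A I := ⟨h.mB, h.mA⟩

theorem DCtx.att {A B : Set U} {I : Finset U} {P : List U} {x y : U} (h : DCtx G A B I) (hP : PathC G A I P x y) {z : U} (hz : z ∈ I) :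
    ∃ p ∈ P, G.Adj z p := by
  obtain ⟨a, ha, hh⟩ := h.mA.hM.2.1 z hz
  exact ⟨a, (hP.mem a).1 ha, hh⟩

theorem DCtx.tri {A B : Set U} {I t : Finset U} {P : List U} {x y w : U} (h : DCtx G A B I) (hP : PathC G A I P x y) (hw : w ∈ I)
    (h1 : x ≠ w) (h2 : y ≠ w) (ht : t = {x, y, w}) :
    (Strong G A t w ∧ NAP G w P) ∨ Weak G A t (fun i => (i = x → AtH G w P) ∧ (i = y → AtL G w P)) := by
  have hC : Cfg G A B t := h.mA.hC.mono (by
    intro z hz; rw [ht] at hz; simp at hz; have := hP.hx; have := hP.hy; rcases hz with rfl | rfl | rfl <;> assumption)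
  exact tri3 ht hP.ind (fun p hp => (hP.mem p).2 hp) hP.atH hP.atL (h.att hP hw) hC.tA hC.ind hP.xy h1 h2

def Match (G : SimpleGraph U) (A B : Set U) (I : Finset U) : Prop := ∃ P R x y, PathC G A I P x y ∧ PathC G B I R x y

theorem DCtx.share0 {A B : Set U} {I : Finset U} {P R : List U} {x y y' : U} (h : DCtx G A B I)
    (hP : PathC G A I P x y) (hR : PathC G B I R x y') : Match G A B I := by
  by_cases e : y = y'
  · subst e; exact ⟨P, R, x, y, hP, hR⟩
  obtain ⟨t, ht⟩ : ∃ t : Finset U, t = {x, y, y'} := ⟨_, rfl⟩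
  have ht' : t = {x, y', y} := by rw [ht, Finset.pair_comm]
  have h3 : t.card = 3 := by rw [ht]; exact card3 hP.xy hR.xy e
  have hC : Cfg G A B t := h.mA.hC.mono (by
    intro z hz; rw [ht] at hz; simp at hz; have := hP.hx; have := hP.hy; have := hR.hy; rcases hz with rfl | rfl | rfl <;> assumption)
  rcases h.tri hP hR.hy hR.xy e ht with ⟨a, -⟩ | a <;> rcases h.symm.tri hR hP.hy hP.xy (Ne.symm e) ht' with ⟨b, -⟩ | b
  · exact absurd (T3 h.mA.hG h3 hC a b).symm e
  · have := (T2 h.mA.hG h3 hC a b).2 rfl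
    exact ⟨P, R, x, y, hP, hR.ind, hR.mem, hP.hx, hP.hy, hP.xy, hR.atH, this⟩
  · have := (T2 h.mA.hG h3 hC.symm b a).2 rfl
    exact ⟨P, R, x, y', ⟨hP.ind, hP.mem, hP.hx, hR.hy, hR.xy, hP.atH, this⟩, hR⟩
  · exact (T1 h.mA.hG h3 hC a b).elim

theorem DCtx.share {A B : Set U} {I : Finset U} {P R : List U} {x y x' y' s : U} (h : DCtx G A B I)
    (hP : PathC G A I P x y) (hR : PathC G B I R x' y') (hs : s ∈ I) (h1 : AtH G s P ∨ AtL G s P) (h2 : AtH G s R ∨ AtL G s R) :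
    Match G A B I := by
  obtain ⟨P', y1, hP'⟩ : ∃ P' y1, PathC G A I P' s y1 := by
    rcases h1 with h1 | h1
    · exact ⟨P, hP.headed hs h1⟩
    · exact ⟨P.reverse, hP.rev.headed hs h1.rev⟩
  obtain ⟨R', y2, hR'⟩ : ∃ P' y1, PathC G B I P' s y1 := by
    rcases h2 with h1 | h1
    · exact ⟨R, hR.headed hs h1⟩
    · exact ⟨R.reverse, hR.rev.headed hs h1.rev⟩
  exact h.share0 hP' hR'

theorem DCtx.nosh {A B : Set U} {I : Finset U} {P R : List U} {x y x' y' : U} (h : DCtx G A B I)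
    (hP : PathC G A I P x y) (hR : PathC G B I R x' y') (n1 : ¬AtH G x' P) (n2 : ¬AtL G x' P) :
    NAP G x' P ∧ ∃ Q T σ τ, R = Q ++ T ∧ Q ≠ [] ∧ ((σ = x ∧ τ = y) ∨ (σ = y ∧ τ = x)) ∧ AtH G σ Q ∧ AtL G τ Q := by
  have d1 : x ≠ x' := by rintro rfl; exact n1 hP.atH
  have d2 : y ≠ x' := by rintro rfl; exact n2 hP.atL
  obtain ⟨t, ht⟩ : ∃ t : Finset U, t = {x, y, x'} := ⟨_, rfl⟩
  have ht' : t = {x', x, y} := by rw [ht]; ext z; simp; tauto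
  have h3 : t.card = 3 := by rw [ht]; exact card3 hP.xy d1 d2
  have hC : Cfg G A B t := h.mA.hC.mono (by
    intro z hz; rw [ht] at hz; simp at hz; have := hP.hx; have := hP.hy; have := hR.hx; rcases hz with rfl | rfl | rfl <;> assumption)
  obtain ⟨Q, T, σ, τ, e, hQ, hst, hL, hh⟩ := first_full (A := B) ht' hR.ind (fun p hp => (hR.mem p).2 hp) hR.atH (h.symm.att hR hP.hx) (h.symm.att hR hP.hy)
    hC.tB hC.ind d1.symm d2.symm hP.xy
  rcases h.tri hP hR.hx d1 d2 ht with ⟨a, a'⟩ | a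
  · refine ⟨a', Q, T, σ, τ, e, hQ, hst, ?_, hL⟩
    rcases hh with hh | hh
    · have := T3 h.mA.hG h3 hC a hh
      rcases hst with ⟨rfl, -⟩ | ⟨rfl, -⟩
      · exact absurd this.symm d1
      · exact absurd this.symm d2
    · exact T2 h.mA.hG h3 hC a hh rfl
  · exfalso
    rcases hh with hh | hh
    · have := T2 h.mA.hG h3 hC.symm hh a
      rcases hst with ⟨rfl, -⟩ | ⟨rfl, -⟩
      · exact n1 (this.1 rfl)
      · exact n2 (this.2 rfl)
    · exact T1 h.mA.hG h3 hC a hh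

theorem DCtx.ring {A B : Set U} {I : Finset U} {P R : List U} {x y : U} (h : DCtx G A B I)
    (hP : PathC G A I P x y) (hR : ∀ r ∈ R, r ∈ B) (iR : IndP G R) (nR : R ≠ []) (h1 : AtH G x R) (h2 : AtL G y R) :
    RingH G x y P R.reverse where
  iP := hP.ind
  iR := indP_reverse iR
  nP := by
    obtain ⟨p, hp, -⟩ := h.att hP hP.hx
    exact List.ne_nil_of_mem hp
  nR := by simpa using nR
  cr := by
    intro a ha b hb
    have hb := hR b (by simpa using hb)
    have ha := (hP.mem a).2 ha
    exact ⟨fun e => h.mA.hC.dis a ha (e ▸ hb), h.mA.hC.anti a ha b hb⟩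
  xP := fun hh => h.mA.hC.tA x hP.hx ((hP.mem x).2 hh)
  yP := fun hh => h.mA.hC.tA y hP.hy ((hP.mem y).2 hh)
  xR := fun hh => h.mA.hC.tB x hP.hx (hR x (by simpa using hh))
  yR := fun hh => h.mA.hC.tB y hP.hy (hR y (by simpa using hh))
  xy := hP.xy
  nxy := h.mA.hC.ind x hP.hx y hP.hy
  hxP := hP.atH
  hyP := hP.atL
  hyR := h2.rev
  hxR := h1.rev

theorem DCtx.ring' {A B : Set U} {I : Finset U} {P R : List U} {x y σ τ : U} (h : DCtx G A B I)
    (hP : PathC G A I P x y) (hR : ∀ r ∈ R, r ∈ B) (iR : IndP G R) (nR : R ≠ []) (hst : (σ = x ∧ τ = y) ∨ (σ = y ∧ τ = x))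
    (h1 : AtH G σ R) (h2 : AtL G τ R) :
    ∃ R', RingH G x y P R' ∧ ∀ r, r ∈ R' ↔ r ∈ R := by
  rcases hst with ⟨rfl, rfl⟩ | ⟨rfl, rfl⟩
  · exact ⟨R.reverse, h.ring hP hR iR nR h1 h2, by simp⟩
  · refine ⟨R.reverse.reverse, h.ring hP (by simpa using hR) (indP_reverse iR) (by simpa using nR) h2.rev h1.rev, by simp⟩

theorem last_not_initial {Q T : List U} {v : U} (hi : IndP G (Q ++ T)) (hv : AtL G v (Q ++ T)) (hT : T ≠ []) :
    ∀ r ∈ Q, ¬G.Adj v r := by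
  intro r hr hh
  have := (hv r (by simp [hr])).1 hh
  obtain ⟨c, l, rfl⟩ := List.exists_cons_of_ne_nil hT
  rw [gl_append] at this
  exact ((indP_append.1 hi).2.2 r hr r (List.mem_of_getLast? this)).1 rfl

theorem DCtx.match {A B : Set U} {I : Finset U} {P R : List U} {x y x' y' : U} (h : DCtx G A B I)
    (hP : PathC G A I P x y) (hR : PathC G B I R x' y') : Match G A B I := by
  by_contra hM
  have ns : ∀ s ∈ I, ¬((AtH G s P ∨ AtL G s P) ∧ (AtH G s R ∨ AtL G s R)) := fun s hs hh => hM (h.share hP hR hs hh.1 hh.2)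
  have sx := ns x hP.hx
  have sy := ns y hP.hy
  have sx' := ns x' hR.hx
  have sy' := ns y' hR.hy
  have ex := hP.atH
  have ey := hP.atL
  have ex' := hR.atH
  have ey' := hR.atL
  have nxR : ¬(AtH G x R ∨ AtL G x R) := fun h => sx ⟨Or.inl ex, h⟩
  have nyR : ¬(AtH G y R ∨ AtL G y R) := fun h => sy ⟨Or.inr ey, h⟩
  have nxP : ¬(AtH G x' P ∨ AtL G x' P) := fun h => sx' ⟨h, Or.inl ex'⟩
  have nyP : ¬(AtH G y' P ∨ AtL G y' P) := fun h => sy' ⟨h, Or.inr ey'⟩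
  obtain ⟨nx', R1, T1, σ1, τ1, e1, q1, s1, a1, b1⟩ := h.nosh hP hR (fun h => nxP (Or.inl h)) (fun h => nxP (Or.inr h))
  obtain ⟨ny', R2, T2, σ2, τ2, e2, q2, s2, a2, b2⟩ := h.nosh hP hR.rev (fun h => nyP (Or.inl h)) (fun h => nyP (Or.inr h))
  obtain ⟨-, Q, T, σ, τ, e, q, s, a, b⟩ := h.symm.nosh hR hP (fun h => nxR (Or.inl h)) (fun h => nxR (Or.inr h))
  have iR1 : IndP G R1 := by have := hR.ind; rw [e1] at this; exact indP_append_left this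
  have iR2 : IndP G R2 := by have := hR.rev.ind; rw [e2] at this; exact indP_append_left this
  have R1B : ∀ r ∈ R1, r ∈ B := fun r hr => (hR.mem r).2 (by rw [e1]; simp [hr])
  have R2B : ∀ r ∈ R2, r ∈ B := fun r hr => (hR.rev.mem r).2 (by rw [e2]; simp [hr])
  obtain ⟨S1, g1, m1⟩ := h.ring' hP R1B iR1 q1 s1 a1 b1
  obtain ⟨S2, g2, m2⟩ := h.ring' hP R2B iR2 q2 s2 a2 b2
  have t1 : T1 ≠ [] := by
    rintro rfl
    simp at e1; subst e1
    rcases s1 with ⟨rfl, rfl⟩ | ⟨rfl, rfl⟩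
    · exact nyR (Or.inr b1)
    · exact nxR (Or.inr b1)
  have t2 : T2 ≠ [] := by
    rintro rfl
    simp at e2
    have : R = R2.reverse := by rw [← e2]; simp
    have z := b2.rev
    rw [← this] at z
    rcases s2 with ⟨rfl, rfl⟩ | ⟨rfl, rfl⟩
    · exact nyR (Or.inl z)
    · exact nxR (Or.inl z)
  have xR1 : ∃ r ∈ S1, G.Adj x' r := by
    obtain ⟨c, l, rfl⟩ := List.exists_cons_of_ne_nil q1
    exact ⟨c, (m1 c).2 (by simp), (ex' c (by simp [e1])).2 (by simp [e1])⟩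
  have yR1 : ∀ r ∈ S1, ¬G.Adj y' r := by
    intro r hr
    have i := hR.ind; have j := hR.atL; rw [e1] at i j
    exact last_not_initial i j t1 r ((m1 r).1 hr)
  have yR2 : ∃ r ∈ S2, G.Adj y' r := by
    have j := hR.rev.atH; rw [e2] at j
    obtain ⟨c, l, rfl⟩ := List.exists_cons_of_ne_nil q2
    exact ⟨c, (m2 c).2 (by simp), (j c (by simp)).2 (by simp)⟩
  have xR2 : ∀ r ∈ S2, ¬G.Adj x' r := by
    intro r hr
    have i := hR.rev.ind; have j := hR.rev.atL; rw [e2] at i j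
    exact last_not_initial i j t2 r ((m2 r).1 hr)
  have hC := h.mA.hC
  have out : ∀ z ∈ I, z ≠ x → z ≠ y → ∀ S, (∀ r ∈ S, r ∈ B) → z ∉ x :: (P ++ y :: S) := by
    intro z hz h1 h2 S hS
    simp only [List.mem_cons, List.mem_append, not_or]
    exact ⟨h1, fun hh => hC.tA z hz ((hP.mem z).2 hh), h2, fun hh => hC.tB z hz (hS z hh)⟩
  have dxx : x' ≠ x := by rintro rfl; exact nxR (Or.inl ex')
  have dxy : x' ≠ y := by rintro rfl; exact nyR (Or.inl ex')
  have dyx : y' ≠ x := by rintro rfl; exact nxR (Or.inr ey')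
  have dyy : y' ≠ y := by rintro rfl; exact nyR (Or.inr ey')
  have S1B : ∀ r ∈ S1, r ∈ B := fun r hr => R1B r ((m1 r).1 hr)
  have S2B : ∀ r ∈ S2, r ∈ B := fun r hr => R2B r ((m2 r).1 hr)
  have ind := hC.ind
  have hx := hP.hx
  have hy := hP.hy
  have hx' := hR.hx
  have hy' := hR.hy
  rcases s with ⟨rfl, rfl⟩ | ⟨rfl, rfl⟩
  · exact two_wheel h.mA.hG g1 g2 (out _ hx' dxx dxy S1 S1B) (out _ hy' dyx dyy S1 S1B) (out _ hx' dxx dxy S2 S2B) (out _ hy' dyx dyy S2 S2B)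
      hR.xy (ind _ hx' _ hy') nx' ny' (ind _ hx' _ hx) (ind _ hx' _ hy) (ind _ hy' _ hx) (ind _ hy' _ hy) xR1 yR1 yR2 xR2 e q a b
  · exact two_wheel h.mA.hG g2 g1 (out _ hy' dyx dyy S2 S2B) (out _ hx' dxx dxy S2 S2B) (out _ hy' dyx dyy S1 S1B) (out _ hx' dxx dxy S1 S1B)
      hR.xy.symm (ind _ hy' _ hx') ny' nx' (ind _ hy' _ hx) (ind _ hy' _ hy) (ind _ hx' _ hx) (ind _ hx' _ hy) yR2 xR2 xR1 yR1 e q a b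

end P8

set_option linter.unusedSectionVars false
set_option linter.unusedVariables false

section P9
variable {U : Type} [DecidableEq U] {G : SimpleGraph U}

theorem sort_exists (S : Finset U) (r : U → U → Prop) (tot : ∀ u ∈ S, ∀ v ∈ S, u ≠ v → r u v ∨ r v u)
    (tr : ∀ u ∈ S, ∀ v ∈ S, ∀ w ∈ S, r u v → r v w → r u w) :
    ∃ L : List U, L.Nodup ∧ L.length = S.card ∧ (∀ u ∈ L, u ∈ S) ∧ L.Pairwise r := by
  classical
  let le : {w // w ∈ S} → {w // w ∈ S} → Prop := fun u v => u = v ∨ r u v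
  have i1 : Std.Total le := ⟨fun u v => by
    by_cases h : u = v
    · exact Or.inl (Or.inl h)
    · rcases tot u u.2 v v.2 (fun e => h (Subtype.ext e)) with h | h
      · exact Or.inl (Or.inr h)
      · exact Or.inr (Or.inr h)⟩
  have i2 : IsTrans _ le := ⟨fun u v w h h' => by
    rcases h with rfl | h
    · exact h'
    · rcases h' with rfl | h'
      · exact Or.inr h
      · exact Or.inr (tr u u.2 v v.2 w w.2 h h')⟩
  have hp := List.pairwise_insertionSort le S.attach.toList
  have hnd : (List.insertionSort le S.attach.toList).Nodup :=
    (List.perm_insertionSort le _).nodup_iff.2 (Finset.nodup_toList _)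
  refine ⟨(List.insertionSort le S.attach.toList).map Subtype.val, ?_, ?_, ?_, ?_⟩
  · exact hnd.map Subtype.val_injective
  · simp [List.length_insertionSort]
  · intro u hu
    obtain ⟨a, -, rfl⟩ := List.mem_map.1 hu
    exact a.2
  · rw [List.pairwise_map]
    refine (hp.and hnd).imp ?_
    rintro a b ⟨h, h'⟩
    exact h.resolve_left h'

def Prec (G : SimpleGraph U) (P R : List U) (u v : U) : Prop :=
  (∀ a1 a2, Nb G u P a1 → Nb G v P a2 → a1 ≤ a2) ∧ (∀ b1 b2, Nb G u R b1 → Nb G v R b2 → b2 ≤ b1)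

theorem prec_total (hG : InClassC G) {x y : U} {P R : List U} (h : RingH G x y P R) {u v : U}
    (uL : u ∉ x :: (P ++ y :: R)) (vL : v ∉ x :: (P ++ y :: R)) (huv : u ≠ v) (nuv : ¬G.Adj u v)
    (u3 : ∃ i j k, i < j ∧ j < k ∧ Nb G u (x :: (P ++ y :: R)) i ∧ Nb G u (x :: (P ++ y :: R)) j ∧ Nb G u (x :: (P ++ y :: R)) k)
    (v3 : ∃ i j k, i < j ∧ j < k ∧ Nb G v (x :: (P ++ y :: R)) i ∧ Nb G v (x :: (P ++ y :: R)) j ∧ Nb G v (x :: (P ++ y :: R)) k)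
    (ux : ¬G.Adj u x) (uy : ¬G.Adj u y) (uP : ∃ p ∈ P, G.Adj u p) (uR : ∃ p ∈ R, G.Adj u p)
    (vP : ∃ p ∈ P, G.Adj v p) (vR : ∃ p ∈ R, G.Adj v p) : Prec G P R u v ∨ Prec G P R v u := by
  obtain ⟨s, d, hs, hd, hd', hu, hv⟩ := wheel_nested hG h uL vL huv nuv u3 v3 ux uy uP uR
  obtain ⟨p, hp, hup⟩ := uP
  obtain ⟨r, hr, hur⟩ := uR
  obtain ⟨p', hp', hvp⟩ := vP
  obtain ⟨r', hr', hvr⟩ := vR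
  obtain ⟨i, hi, -⟩ := nb_of_mem hp hup
  obtain ⟨j, hj, -⟩ := nb_of_mem hr hur
  obtain ⟨i', hi', -⟩ := nb_of_mem hp' hvp
  obtain ⟨j', hj', -⟩ := nb_of_mem hr' hvr
  have hl : ∀ {w L k}, Nb G w L k → k < L.length := fun h => h.1
  by_contra hh
  rw [not_or] at hh
  obtain ⟨h1, h2⟩ := hh
  unfold Prec at h1 h2
  have fuP : ∀ k, Nb G u P k → ∃ e ≤ d, k + 1 = s + e ∨ k + 1 + (P.length + R.length + 2) = s + e := fun k hk => hu _ (nb_ring hk)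
  have fuR : ∀ k, Nb G u R k → ∃ e ≤ d, P.length + 2 + k = s + e ∨ P.length + 2 + k + (P.length + R.length + 2) = s + e := fun k hk => hu _ (nb_ringR hk)
  have fvP : ∀ k, Nb G v P k → ∃ e, d ≤ e ∧ e ≤ P.length + R.length + 2 ∧ (k + 1 = s + e ∨ k + 1 + (P.length + R.length + 2) = s + e) := fun k hk => hv _ (nb_ring hk)
  have fvR : ∀ k, Nb G v R k → ∃ e, d ≤ e ∧ e ≤ P.length + R.length + 2 ∧ (P.length + 2 + k = s + e ∨ P.length + 2 + k + (P.length + R.length + 2) = s + e) := fun k hk => hv _ (nb_ringR hk)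
  clear hu hv
  obtain ⟨e1, g1, g1'⟩ := fuP i hi
  obtain ⟨e2, g2, g2'⟩ := fuR j hj
  obtain ⟨e3, g3, g3'', g3'⟩ := fvP i' hi'
  obtain ⟨e4, g4, g4'', g4'⟩ := fvR j' hj'
  have l1 := hl hi
  have l2 := hl hj
  have l3 := hl hi'
  have l4 := hl hj'
  rw [not_and_or] at h1 h2
  push Not at h1 h2
  rcases h1 with ⟨a1, a2, q1, q2, q3⟩ | ⟨a1, a2, q1, q2, q3⟩
  · obtain ⟨e5, g5, g5'⟩ := fuP a1 q1
    obtain ⟨e6, g6, g6'', g6'⟩ := fvP a2 q2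
    have l5 := hl q1
    have l6 := hl q2
    rcases h2 with ⟨b1, b2, q1', q2', q3'⟩ | ⟨b1, b2, q1', q2', q3'⟩
    · obtain ⟨e7, g7, g7'⟩ := fuP b2 q2'
      obtain ⟨e8, g8, g8'', g8'⟩ := fvP b1 q1'
      have l7 := hl q1'
      have l8 := hl q2'
      omega
    · obtain ⟨e7, g7, g7'⟩ := fuR b2 q2'
      obtain ⟨e8, g8, g8'', g8'⟩ := fvR b1 q1'
      have l7 := hl q1'
      have l8 := hl q2'
      omega
  · obtain ⟨e5, g5, g5'⟩ := fuR a1 q1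
    obtain ⟨e6, g6, g6'', g6'⟩ := fvR a2 q2
    have l5 := hl q1
    have l6 := hl q2
    rcases h2 with ⟨b1, b2, q1', q2', q3'⟩ | ⟨b1, b2, q1', q2', q3'⟩
    · obtain ⟨e7, g7, g7'⟩ := fuP b2 q2'
      obtain ⟨e8, g8, g8'', g8'⟩ := fvP b1 q1'
      have l7 := hl q1'
      have l8 := hl q2'
      omega
    · obtain ⟨e7, g7, g7'⟩ := fuR b2 q2'
      obtain ⟨e8, g8, g8'', g8'⟩ := fvR b1 q1'
      have l7 := hl q1'
      have l8 := hl q2'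
      omega

theorem nb_pos {x y u : U} {P R : List U} {k : ℕ} (ux : ¬G.Adj u x) (uy : ¬G.Adj u y) (h : Nb G u (x :: (P ++ y :: R)) k) :
    (∃ i, k = i + 1 ∧ Nb G u P i) ∨ (∃ i, k = P.length + 2 + i ∧ Nb G u R i) := by
  obtain ⟨hk, h⟩ := h
  rcases k with _ | k
  · exact absurd h ux
  · rw [List.getElem_cons_succ] at h
    simp at hk
    rcases lt_trichotomy k P.length with hk' | rfl | hk'
    · rw [List.getElem_append_left hk'] at h
      exact Or.inl ⟨k, rfl, hk', h⟩
    · exact absurd (by simpa using h) uy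
    · rw [List.getElem_append_right (by omega)] at h
      obtain ⟨m, rfl⟩ : ∃ m, k = P.length + (m + 1) := ⟨k - P.length - 1, by omega⟩
      refine Or.inr ⟨m, by omega, by omega, ?_⟩
      simpa using h

theorem sep_lemma [Finite U] (hG : InClassC G) {A B : Set U} {I : Finset U} {l : ℕ} (hl : 1 ≤ l) (hI : I.card = l + 2)
    (cA : Conn G A) (cB : Conn G B) (hC : Cfg G A B I) (aA : ∀ z ∈ I, Att G z A) (aB : ∀ z ∈ I, Att G z B) :
    ∃ (n p : ℕ) (f : ZMod n → U) (c : Fin l → U), IsSpanWheel G l n p f c := by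
  obtain ⟨A', hA', mA⟩ := exists_minConn cA aA
  obtain ⟨B', hB', mB⟩ := exists_minConn cB aB
  have hC' : Cfg G A' B' I := ⟨fun a ha hb => hC.dis a (hA' ha) (hB' hb), fun a ha b hb => hC.anti a (hA' ha) b (hB' hb),
    fun i hi h => hC.tA i hi (hA' h), fun i hi h => hC.tB i hi (hB' h), hC.ind⟩
  have hD : DCtx G A' B' I := by
    refine ⟨⟨hG, mA, hC', fun t ht h3 => ?_⟩, ⟨hG, mB, hC'.symm, fun t ht h3 => ?_⟩⟩
    · exact exists_side mB.1 h3 (fun z hz => mB.2.1 z (ht hz)) (fun z hz => hC'.tB z (ht hz)) (fun i hi j hj => hC.ind i (ht hi) j (ht hj))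
    · exact exists_side mA.1 h3 (fun z hz => mA.2.1 z (ht hz)) (fun z hz => hC'.tA z (ht hz)) (fun i hi j hj => hC.ind i (ht hi) j (ht hj))
  obtain ⟨P0, x0, y0, hP0⟩ := (path_or_c4 hD.mA (by omega)).resolve_right (fun h => hD.mA.no_c4 hD.mB h)
  obtain ⟨R0, x1, y1, hR0⟩ := (path_or_c4 hD.mB (by omega)).resolve_right (fun h => hD.mB.no_c4 hD.mA h)
  obtain ⟨P, R0', x, y, hP, hR⟩ := hD.match hP0 hR0
  clear hP0 hR0
  have nR : R0' ≠ [] := by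
    rintro rfl
    obtain ⟨a, ha⟩ := mB.1.1
    simpa using (hR.mem a).1 ha
  have ring := hD.ring hP (fun r hr => (hR.mem r).2 hr) hR.ind nR hR.atH hR.atL
  obtain ⟨R, hRR⟩ : ∃ R, R = R0'.reverse := ⟨_, rfl⟩
  rw [← hRR] at ring
  have mR : ∀ r, r ∈ R ↔ r ∈ R0' := by simp [hRR]
  set S := (I.erase x).erase y with hS
  have hSI : ∀ w ∈ S, w ∈ I ∧ w ≠ x ∧ w ≠ y := by
    intro w hw; simp [hS] at hw; tauto
  have cS : S.card = l := by
    rw [hS, Finset.card_erase_of_mem (by simp [hP.xy.symm, hP.hy]), Finset.card_erase_of_mem hP.hx]; omega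
  have sP : ∀ w ∈ S, ∃ p ∈ P, G.Adj w p := fun w hw => hD.att hP (hSI w hw).1
  have sR : ∀ w ∈ S, ∃ p ∈ R, G.Adj w p := fun w hw => by
    obtain ⟨r, hr, h⟩ := hD.symm.att hR (hSI w hw).1
    exact ⟨r, (mR r).2 hr, h⟩
  have sx : ∀ w ∈ S, ¬G.Adj w x := fun w hw => hC.ind w (hSI w hw).1 x hP.hx
  have sy : ∀ w ∈ S, ¬G.Adj w y := fun w hw => hC.ind w (hSI w hw).1 y hP.hy
  have sL : ∀ w ∈ S, w ∉ x :: (P ++ y :: R) := by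
    intro w hw
    obtain ⟨h1, h2, h3⟩ := hSI w hw
    simp only [List.mem_cons, List.mem_append, not_or]
    exact ⟨h2, fun h => hC'.tA w h1 ((hP.mem w).2 h), h3, fun h => hC'.tB w h1 ((hR.mem w).2 ((mR w).1 h))⟩
  have s3 : ∀ w ∈ S, ∃ i j k, i < j ∧ j < k ∧ Nb G w (x :: (P ++ y :: R)) i ∧ Nb G w (x :: (P ++ y :: R)) j ∧
      Nb G w (x :: (P ++ y :: R)) k := by
    intro w hw
    obtain ⟨h1, h2, h3⟩ := hSI w hw
    obtain ⟨p, hp, wp⟩ := sP w hw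
    obtain ⟨r, hr, wr⟩ := sR w hw
    obtain ⟨i, hi, -⟩ := nb_of_mem hp wp
    obtain ⟨j, hj, -⟩ := nb_of_mem hr wr
    have il := hi.1
    obtain ⟨t, ht⟩ : ∃ t : Finset U, t = {x, y, w} := ⟨_, rfl⟩
    have htI : t ⊆ I := by
      intro z hz; rw [ht] at hz; simp at hz
      rcases hz with rfl | rfl | rfl
      · exact hP.hx
      · exact hP.hy
      · exact h1
    have h3c : t.card = 3 := by rw [ht]; exact Finset.card_eq_three.2 ⟨x, y, w, hP.xy, h2.symm, h3.symm, rfl⟩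
    rcases hD.tri hP h1 h2.symm h3.symm ht with ⟨-, hn⟩ | hw1
    · obtain ⟨a, b, hab, ha, hb⟩ := nap_two hn
      have bl := hb.1
      exact ⟨a + 1, b + 1, P.length + 2 + j, by omega, by omega, nb_ring ha, nb_ring hb, nb_ringR hj⟩
    · rcases hD.symm.tri hR h1 h2.symm h3.symm ht with ⟨-, hn⟩ | hw2
      · have hn' : NAP G w R := by
          obtain ⟨a, ha, b, hb, h⟩ := hn
          exact ⟨a, (mR a).2 ha, b, (mR b).2 hb, h⟩
        obtain ⟨a, b, hab, ha, hb⟩ := nap_two hn'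
        exact ⟨i + 1, P.length + 2 + a, P.length + 2 + b, by omega, by omega, nb_ring hi, nb_ringR ha, nb_ringR hb⟩
      · exact (T1 hG h3c (hC'.mono htI) hw1 hw2).elim
  obtain ⟨L, Lnd, Llen, LS, Lp⟩ := sort_exists S (Prec G P R) (fun u hu v hv huv =>
    prec_total hG ring (sL u hu) (sL v hv) huv (hC.ind u (hSI u hu).1 v (hSI v hv).1) (s3 u hu) (s3 v hv) (sx u hu) (sy u hu)
      (sP u hu) (sR u hu) (sP v hv) (sR v hv)) (by
    intro u hu v hv w hw h1 h2
    obtain ⟨p, hp, vp⟩ := sP v hv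
    obtain ⟨r, hr, vr⟩ := sR v hv
    obtain ⟨i, hi, -⟩ := nb_of_mem hp vp
    obtain ⟨j, hj, -⟩ := nb_of_mem hr vr
    exact ⟨fun a b ha hb => (h1.1 a i ha hi).trans (h2.1 i b hi hb), fun a b ha hb => (h2.2 j b hj hb).trans (h1.2 a j ha hj)⟩)
  have hn : P.length + R.length + 2 = (P ++ y :: R).length + 1 := by simp; omega
  obtain ⟨f, hf, hfk⟩ := hole_of_list ring.cyc hn
  have hlen : (x :: (P ++ y :: R)).length = P.length + R.length + 2 := by simp; omega
  have hf0 : f 0 = x := by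
    have := hfk 0 (by simp)
    simpa using this
  have hfp : f ((P.length + 1 : ℕ) : ZMod _) = y := by
    rw [hfk (P.length + 1) (by omega)]
    simp
  have : NeZero (P.length + R.length + 2) := ⟨by omega⟩
  have nbf : ∀ w k, k < P.length + R.length + 2 → (G.Adj w (f (k : ZMod _)) ↔ Nb G w (x :: (P ++ y :: R)) k) := by
    intro w k hk
    rw [hfk k (by omega)]
    exact ⟨fun h => ⟨by omega, h⟩, fun h => h.2⟩
  have P0 : 0 < P.length := List.length_pos_iff.2 ring.nP
  have R0 : 0 < R.length := List.length_pos_iff.2 ring.nR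
  have cdef : ∀ i : Fin l, (i : ℕ) < L.length := fun i => by rw [Llen, cS]; exact i.2
  have cS' : ∀ i : Fin l, L[(i:ℕ)]'(cdef i) ∈ S := fun i => LS _ (List.getElem_mem _)
  have cprec : ∀ i j : Fin l, i < j → Prec G P R (L[(i:ℕ)]'(cdef i)) (L[(j:ℕ)]'(cdef j)) := fun i j hij =>
    List.pairwise_iff_getElem.1 Lp i j (cdef i) (cdef j) hij
  refine ⟨P.length + R.length + 2, P.length + 1, f, fun i => L[(i:ℕ)]'(cdef i), hf, by omega, by omega, ?_, ?_, ?_, ?_, ?_, ?_, ?_, ?_, ?_, ?_, ?_⟩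
  · rw [hf0, hfp]; exact ring.nxy
  · intro i j hij
    exact Fin.ext ((Lnd.getElem_inj_iff).1 hij)
  · rintro i ⟨m, hm⟩
    obtain ⟨k, hk, rfl⟩ := zrep (by omega : 0 < P.length + R.length + 2) m
    rw [hfk k (by omega)] at hm
    refine sL _ (cS' i) ?_
    beta_reduce at hm
    rw [← hm]
    exact List.getElem_mem _
  · intro i j hij
    exact hC.ind _ (hSI _ (cS' i)).1 _ (hSI _ (cS' j)).1
  · intro i; rw [hf0]; exact sx _ (cS' i)
  · intro i; rw [hfp]; exact sy _ (cS' i)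
  · intro i
    obtain ⟨a, b, c, hab, hbc, ha, hb, hc⟩ := s3 _ (cS' i)
    have la := ha.1
    have lb := hb.1
    have lc := hc.1
    refine ncard_three ((nbf _ a (by omega)).2 ha) ((nbf _ b (by omega)).2 hb) ((nbf _ c (by omega)).2 hc) ?_ ?_ ?_
    · rw [Ne, zcast_eq (by omega) (by omega)]; omega
    · rw [Ne, zcast_eq (by omega) (by omega)]; omega
    · rw [Ne, zcast_eq (by omega) (by omega)]; omega
  · intro i
    obtain ⟨p, hp, wp⟩ := sP _ (cS' i)
    obtain ⟨k, hk, -⟩ := nb_of_mem hp wp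
    have lk := hk.1
    exact ⟨k + 1, by omega, by omega, (nbf _ (k + 1) (by omega)).2 (nb_ring hk)⟩
  · intro i
    obtain ⟨p, hp, wp⟩ := sR _ (cS' i)
    obtain ⟨k, hk, -⟩ := nb_of_mem hp wp
    have lk := hk.1
    exact ⟨P.length + 2 + k, by omega, by omega, (nbf _ (P.length + 2 + k) (by omega)).2 (nb_ringR hk)⟩
  · intro i j hij a b ha hb h1 h2
    rcases nb_pos (sx _ (cS' i)) (sy _ (cS' i)) ((nbf _ a (by omega)).1 h1) with ⟨a', rfl, ha'⟩ | ⟨a', rfl, ha'⟩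
    · rcases nb_pos (sx _ (cS' j)) (sy _ (cS' j)) ((nbf _ b (by omega)).1 h2) with ⟨b', rfl, hb'⟩ | ⟨b', rfl, hb'⟩
      · have := (cprec i j hij).1 a' b' ha' hb'
        omega
      · omega
    · omega
  · intro i j hij a b ha ha2 hb hb2 h1 h2
    have key : ∀ (k : Fin l) a, P.length + 1 ≤ a → a ≤ P.length + R.length + 2 → G.Adj (L[(k:ℕ)]'(cdef k)) (f (a : ZMod _)) →
        ∃ a', a = P.length + 2 + a' ∧ Nb G (L[(k:ℕ)]'(cdef k)) R a' := by
      intro k a ha ha2 h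
      rcases ha2.lt_or_eq with h' | rfl
      · rcases nb_pos (sx _ (cS' k)) (sy _ (cS' k)) ((nbf _ a h').1 h) with ⟨a', rfl, ha'⟩ | h
        · have := ha'.1; omega
        · exact h
      · rw [ZMod.natCast_self, hf0] at h
        exact absurd h (sx _ (cS' k))
    obtain ⟨a', rfl, ha'⟩ := key i a ha ha2 h1
    obtain ⟨b', rfl, hb'⟩ := key j b hb hb2 h2
    have := (cprec i j hij).2 a' b' ha' hb'
    omega

end P9

set_option linter.unusedSectionVars false
set_option linter.unusedVariables false

section P10
variable {U : Type} [DecidableEq U] {G : SimpleGraph U}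

theorem ramsey_ex (s t : ℕ) : ∃ n, ∀ (G : SimpleGraph U) (S : Finset U), n ≤ S.card →
    (∃ T ⊆ S, G.IsNClique s T) ∨ (∃ T ⊆ S, Gᶜ.IsNClique t T) := by
  classical
  induction s generalizing t with
  | zero => exact ⟨0, fun G S _ => Or.inl ⟨∅, by simp, by simp⟩⟩
  | succ s ihs =>
    induction t with
    | zero => exact ⟨0, fun G S _ => Or.inr ⟨∅, by simp, by simp⟩⟩
    | succ t iht =>
      obtain ⟨n1, h1⟩ := ihs (t + 1)
      obtain ⟨n2, h2⟩ := iht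
      refine ⟨n1 + n2 + 1, fun G S hS => ?_⟩
      obtain ⟨v, hv⟩ : S.Nonempty := Finset.card_pos.1 (by omega)
      have hc := Finset.card_filter_add_card_filter_not (s := S.erase v) (fun w => G.Adj v w)
      rw [Finset.card_erase_of_mem hv] at hc
      by_cases hh : n1 ≤ ((S.erase v).filter (fun w => G.Adj v w)).card
      · rcases h1 G _ hh with ⟨T, hT, hc⟩ | ⟨T, hT, hc⟩
        · refine Or.inl ⟨insert v T, ?_, hc.insert ?_⟩
          · intro x hx
            rcases Finset.mem_insert.1 hx with rfl | hx
            · exact hv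
            · exact Finset.mem_of_mem_erase (Finset.mem_filter.1 (hT hx)).1
          · intro x hx; exact (Finset.mem_filter.1 (hT hx)).2
        · exact Or.inr ⟨T, fun x hx => Finset.mem_of_mem_erase (Finset.mem_filter.1 (hT hx)).1, hc⟩
      · rcases h2 G ((S.erase v).filter (fun w => ¬G.Adj v w)) (by omega) with ⟨T, hT, hc⟩ | ⟨T, hT, hc⟩
        · exact Or.inl ⟨T, fun x hx => Finset.mem_of_mem_erase (Finset.mem_filter.1 (hT hx)).1, hc⟩
        · refine Or.inr ⟨insert v T, ?_, hc.insert ?_⟩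
          · intro x hx
            rcases Finset.mem_insert.1 hx with rfl | hx
            · exact hv
            · exact Finset.mem_of_mem_erase (Finset.mem_filter.1 (hT hx)).1
          · intro x hx
            have := Finset.mem_filter.1 (hT hx)
            rw [SimpleGraph.compl_adj]
            exact ⟨fun e => (Finset.mem_erase.1 this.1).1 e.symm, this.2⟩

theorem ramseyProp_number (s t : ℕ) : RamseyProp (ramseyNumber s t) s t := by
  have : {n : ℕ | RamseyProp n s t}.Nonempty := by
    obtain ⟨n, hn⟩ := ramsey_ex (U := ℕ) s t
    refine ⟨n, fun G => ?_⟩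
    have hc : (Finset.univ.map (Fin.valEmbedding (n := n))).card = n := by simp
    rcases hn (G.map Fin.valEmbedding) (Finset.univ.map (Fin.valEmbedding (n := n))) hc.ge with ⟨T, hT, h⟩ | ⟨T, hT, h⟩
    · obtain ⟨T', -, rfl⟩ := Finset.subset_map_iff.1 hT
      refine Or.inl ⟨T', ?_, by simpa using h.card_eq⟩
      intro a ha b hb hab
      have := h.isClique (Finset.mem_coe.2 (Finset.mem_map_of_mem Fin.valEmbedding (Finset.mem_coe.1 ha))) (Finset.mem_coe.2 (Finset.mem_map_of_mem Fin.valEmbedding (Finset.mem_coe.1 hb))) (by simpa [Fin.val_inj] using hab : (a : ℕ) ≠ b)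
      rw [SimpleGraph.map_adj] at this
      obtain ⟨u, v, huv, e1, e2⟩ := this
      rw [Fin.valEmbedding.injective (e1 : Fin.valEmbedding u = Fin.valEmbedding a), Fin.valEmbedding.injective (e2 : Fin.valEmbedding v = Fin.valEmbedding b)] at huv
      exact huv
    · obtain ⟨T', -, rfl⟩ := Finset.subset_map_iff.1 hT
      refine Or.inr ⟨T', ?_, by simpa using h.card_eq⟩
      intro a ha b hb hab
      have := h.isClique (Finset.mem_coe.2 (Finset.mem_map_of_mem Fin.valEmbedding (Finset.mem_coe.1 ha))) (Finset.mem_coe.2 (Finset.mem_map_of_mem Fin.valEmbedding (Finset.mem_coe.1 hb))) (by simpa [Fin.val_inj] using hab : (a : ℕ) ≠ b)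
      rw [SimpleGraph.compl_adj] at this ⊢
      exact ⟨hab, fun hh => this.2 ((SimpleGraph.map_adj _ _ _ _).2 ⟨a, b, hh, rfl, rfl⟩)⟩
  exact Nat.sInf_mem this

theorem ramsey_three {t l : ℕ} (ht : 2 ≤ t) (hl : 1 ≤ l) : 3 ≤ ramseyNumber t (l + 2) := by
  rcases ramseyProp_number t (l + 2) ⊥ with ⟨S, hS⟩ | ⟨S, hS⟩
  · exfalso
    have : 1 < S.card := by rw [hS.card_eq]; omega
    obtain ⟨a, ha, b, hb, hab⟩ := Finset.one_lt_card.1 this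
    exact hS.isClique ha hb hab
  · have := Finset.card_le_univ S
    rw [hS.card_eq, Fintype.card_fin] at this
    omega

theorem ramsey_indep {t m : ℕ} (hK : G.CliqueFree t) {S : Finset U} (hS : ramseyNumber t m ≤ S.card) :
    ∃ I ⊆ S, I.card = m ∧ ∀ i ∈ I, ∀ j ∈ I, ¬G.Adj i j := by
  obtain ⟨S', hS', hc⟩ := Finset.exists_subset_card_eq hS
  let e : Fin (ramseyNumber t m) ↪ U := (Finset.equivFinOfCardEq hc).symm.toEmbedding.trans (Function.Embedding.subtype _)
  have he : ∀ i, e i ∈ S' := fun i => ((Finset.equivFinOfCardEq hc).symm i).2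
  rcases ramseyProp_number t m (G.comap e) with ⟨T, hT⟩ | ⟨T, hT⟩
  · exfalso
    refine hK (T.map e) ⟨?_, by simpa using hT.card_eq⟩
    intro a ha b hb hab
    simp at ha hb
    obtain ⟨a, ha, rfl⟩ := ha
    obtain ⟨b, hb, rfl⟩ := hb
    exact hT.isClique ha hb (fun h => hab (by rw [h]))
  · refine ⟨T.map e, ?_, by simpa using hT.card_eq, ?_⟩
    · intro x hx
      obtain ⟨a, ha, rfl⟩ := Finset.mem_map.1 hx
      exact hS' (he a)
    · intro x hx y hy
      obtain ⟨a, ha, rfl⟩ := Finset.mem_map.1 hx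
      obtain ⟨b, hb, rfl⟩ := Finset.mem_map.1 hy
      intro hab
      have hne : a ≠ b := fun h => hab.ne (by rw [h])
      exact ((SimpleGraph.compl_adj _ _ _).1 (hT.isClique ha hb hne)).2 hab

theorem hsep [Finite U] (hG : InClassC G) {l t : ℕ} (hl : 1 ≤ l)
    (hsw : ¬∃ (n p : ℕ) (f : ZMod n → U) (c : Fin l → U), IsSpanWheel G l n p f c)
    (hK : G.CliqueFree t) {S : Finset U} {A B : Set U} (cA : Conn G A) (cB : Conn G B)
    (dis : ∀ a ∈ A, a ∉ B) (anti : ∀ a ∈ A, ∀ b ∈ B, ¬G.Adj a b) (SA : ∀ s ∈ S, s ∉ A) (SB : ∀ s ∈ S, s ∉ B)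
    (aA : ∀ s ∈ S, Att G s A) (aB : ∀ s ∈ S, Att G s B) : S.card + 1 ≤ ramseyNumber t (l + 2) := by
  by_contra h
  obtain ⟨I, hI, hc, hi⟩ := ramsey_indep (m := l + 2) hK (S := S) (by omega)
  exact hsw (sep_lemma hG hl hc cA cB ⟨dis, anti, fun i h => SA i (hI h), fun i h => SB i (hI h), hi⟩
    (fun z hz => aA z (hI hz)) (fun z hz => aB z (hI hz)))

end P10

set_option linter.unusedSectionVars false
set_option linter.unusedVariables false

section P11
variable {U : Type} [DecidableEq U] {G : SimpleGraph U}

def nbd (G : SimpleGraph U) (D : Set U) : Set U := {s | s ∉ D ∧ Att G s D}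

def Lnk (G : SimpleGraph U) (Z : Set U) (u v : U) : Prop := ∃ C, Conn G C ∧ C ⊆ Z ∧ Att G u C ∧ Att G v C

theorem Lnk.symm {Z : Set U} {u v : U} (h : Lnk G Z u v) : Lnk G Z v u := by
  obtain ⟨C, h1, h2, h3, h4⟩ := h
  exact ⟨C, h1, h2, h4, h3⟩

theorem Lnk.mono {Z Z' : Set U} {u v : U} (h : Lnk G Z u v) (hZ : Z ⊆ Z') : Lnk G Z' u v := by
  obtain ⟨C, h1, h2, h3, h4⟩ := h
  exact ⟨C, h1, h2.trans hZ, h3, h4⟩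

theorem stay {C D : Set U} (hC : Conn G C) (h : ∀ x ∈ C, x ∉ nbd G D) {c : U} (hc : c ∈ C) (hcD : c ∈ D) : C ⊆ D := by
  intro b hb
  have hr := hC.2 c hc b hb
  induction hr with
  | refl => exact hcD
  | tail _ hh ih =>
    have := ih hh.2.1
    by_contra hn
    exact h _ hb ⟨hn, _, this, hh.1.symm⟩

/-- potential-maximal-clique like set inside a connected piece -/
theorem omega_ex [Finite U] {S D : Set U} (hSD : ∀ s ∈ S, s ∉ D) :
    ∃ Ω : Set U, S ⊆ Ω ∧ Ω ⊆ S ∪ D ∧ (∀ u ∈ Ω, ∀ v ∈ Ω, u ≠ v → (u ∈ S ∧ v ∈ S) ∨ G.Adj u v ∨ Lnk G (D \ Ω) u v) ∧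
      ∀ C, Conn G C → C ⊆ D \ Ω → ¬∀ w ∈ Ω, Att G w C := by
  induction D, (Set.toFinite D) using Set.Finite.induction_on with
  | empty =>
    refine ⟨S, subset_rfl, by simp, fun u hu v hv _ => Or.inl ⟨hu, hv⟩, ?_⟩
    intro C hC h _
    obtain ⟨c, hc⟩ := hC.1
    exact (h hc).1
  | @insert a Y haY _ ih =>
    obtain ⟨Ω, h1, h2, h3, h4⟩ := ih (fun s hs h => hSD s hs (Or.inr h))
    have haS : a ∉ S := fun h => hSD a h (Or.inl rfl)
    have haO : a ∉ Ω := fun h => (h2 h).elim haS haY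
    by_cases hk : ∀ C, Conn G C → C ⊆ insert a Y \ Ω → ¬∀ w ∈ Ω, Att G w C
    · refine ⟨Ω, h1, ?_, ?_, hk⟩
      · intro x hx
        rcases h2 hx with h | h
        · exact Or.inl h
        · exact Or.inr (Or.inr h)
      · intro u hu v hv huv
        refine (h3 u hu v hv huv).imp_right (Or.imp_right fun h => h.mono ?_)
        intro x hx
        exact ⟨Or.inr hx.1, hx.2⟩
    · push Not at hk
      obtain ⟨C, hC, hCs, hfull⟩ := hk
      have haC : a ∈ C := by
        by_contra hn
        refine h4 C hC ?_ hfull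
        intro x hx
        refine ⟨(hCs hx).1.resolve_left ?_, (hCs hx).2⟩
        rintro rfl; exact hn hx
      have hpair : ∀ w ∈ Ω, G.Adj w a ∨ Lnk G (insert a Y \ insert a Ω) w a := by
        intro w hw
        obtain ⟨c, hc, hwc⟩ := hfull w hw
        by_cases e : c = a
        · subst e; exact Or.inl hwc
        · right
          have hcC : c ∈ C \ {a} := ⟨hc, e⟩
          obtain ⟨c', d, r1, -, -, r2, r3, -⟩ := rch_leave (T := {a}) (hC.2 c hc a haC) hc e rfl
          rw [Set.mem_singleton_iff] at r3
          subst r3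
          refine ⟨cpt G (C \ {d}) c, cpt_conn hcC, ?_, ⟨c, cpt_self c, hwc⟩, ⟨c', r1, r2.symm⟩⟩
          intro x hx
          have := cpt_sub hcC hx
          refine ⟨(hCs this.1).1, ?_⟩
          rintro (h | h)
          · exact this.2 h
          · exact (hCs this.1).2 h
      refine ⟨insert a Ω, h1.trans (Set.subset_insert _ _), ?_, ?_, ?_⟩
      · rintro x (rfl | hx)
        · exact Or.inr (Or.inl rfl)
        · rcases h2 hx with h | h
          · exact Or.inl h
          · exact Or.inr (Or.inr h)
      · rintro u (rfl | hu) v (rfl | hv) huv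
        · exact absurd rfl huv
        · right
          rcases hpair v hv with h | h
          · exact Or.inl h.symm
          · exact Or.inr h.symm
        · exact Or.inr (hpair u hu)
        · refine (h3 u hu v hv huv).imp_right (Or.imp_right fun h => h.mono ?_)
          intro x hx
          refine ⟨Or.inr hx.1, ?_⟩
          rintro (rfl | h)
          · exact haY hx.1
          · exact hx.2 h
      · intro C' hC' hs hf
        refine h4 C' hC' ?_ (fun w hw => hf w (Or.inr hw))
        intro x hx
        refine ⟨(hs hx).1.resolve_left ?_, fun h => (hs hx).2 (Or.inr h)⟩
        rintro rfl
        exact (hs hx).2 (Or.inl rfl)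

structure Pmc (G : SimpleGraph U) (Ω : Set U) : Prop where
  lnk : ∀ u ∈ Ω, ∀ v ∈ Ω, u ≠ v → G.Adj u v ∨ Lnk G Ωᶜ u v
  full : ∀ C, Conn G C → C ⊆ Ωᶜ → ¬∀ w ∈ Ω, Att G w C

theorem pmc_ex [Finite U] {D : Set U} (hD : Conn G D)
    (hl : ∀ u ∈ nbd G D, ∀ v ∈ nbd G D, u ≠ v → G.Adj u v ∨ Lnk G (D ∪ nbd G D)ᶜ u v) :
    ∃ Ω : Set U, nbd G D ⊆ Ω ∧ Ω ⊆ nbd G D ∪ D ∧ (∃ d ∈ D, d ∈ Ω) ∧ Pmc G Ω := by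
  obtain ⟨Ω, h1, h2, h3, h4⟩ := omega_ex (G := G) (S := nbd G D) (D := D) (fun s hs => hs.1)
  have hd : ∃ d ∈ D, d ∈ Ω := by
    by_contra hn
    push Not at hn
    refine h4 D hD (fun x hx => ⟨hx, hn x hx⟩) ?_
    intro w hw
    rcases h2 hw with h | h
    · exact h.2
    · exact absurd hw (hn w h)
  refine ⟨Ω, h1, h2, hd, ?_, ?_⟩
  · intro u hu v hv huv
    rcases h3 u hu v hv huv with ⟨a, b⟩ | h | h
    · refine (hl u a v b huv).imp_right fun h => h.mono ?_
      intro x hx hO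
      exact hx ((h2 hO).symm)
    · exact Or.inl h
    · exact Or.inr (h.mono fun x hx => hx.2)
  · intro C hC hCO hf
    obtain ⟨d, hdD, hdO⟩ := hd
    obtain ⟨c, hc, hdc⟩ := hf d hdO
    have hn : ∀ x ∈ C, x ∉ nbd G D := fun x hx h => hCO hx (h1 h)
    have hcD : c ∈ D := by
      by_contra h
      exact hn c hc ⟨h, d, hdD, hdc.symm⟩
    have := stay hC hn hc hcD
    exact h4 C hC (fun x hx => ⟨this hx, hCO hx⟩) hf

/-- The opposite side of a component of the complement of `Ω`. -/
theorem pmc_opp {Ω D : Set U} (h : Pmc G Ω) (hD : Conn G D) (hDO : D ⊆ Ωᶜ) (hN : nbd G D ⊆ Ω) :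
    ∃ E, Conn G E ∧ E ⊆ (D ∪ nbd G D)ᶜ ∧ (∀ s ∈ nbd G D, Att G s E) ∧ ∀ a ∈ D, ∀ b ∈ E, ¬G.Adj a b := by
  have hf := h.full D hD hDO
  push Not at hf
  obtain ⟨z, hz, hza⟩ := hf
  have hzS : z ∈ (nbd G D)ᶜ := fun hh => hza hh.2
  have hzD : z ∉ D := fun hh => hDO hh hz
  have hE : cpt G (nbd G D)ᶜ z ⊆ (D ∪ nbd G D)ᶜ := by
    rintro x hx (hxD | hxN)
    · have hc := cpt_conn (G := G) hzS
      exact hzD (stay hc (fun y hy => cpt_sub hzS hy) hx hxD (cpt_self z))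
    · exact cpt_sub hzS hx hxN
  refine ⟨cpt G (nbd G D)ᶜ z, cpt_conn hzS, hE, ?_, ?_⟩
  · intro s hs
    have hne : s ≠ z := by rintro rfl; exact hzS hs
    rcases h.lnk s (hN hs) z hz hne with hh | ⟨C, hC, hCs, ⟨c, hc, hsc⟩, ⟨c', hc', hzc⟩⟩
    · exact ⟨z, cpt_self z, hh⟩
    · refine ⟨c, ?_, hsc⟩
      have hCs' : C ⊆ (nbd G D)ᶜ := fun x hx hh => hCs hx (hN hh)
      have h1 : c' ∈ cpt G (nbd G D)ᶜ z := cpt_closed hzS (cpt_self z) (hCs' hc') hzc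
      exact Rch.trans h1 ((hC.2 c' hc' c hc).mono hCs')
  · intro a ha b hb hab
    exact hE hb (Or.inr ⟨fun hh => hE hb (Or.inl hh), a, ha, hab.symm⟩)

def HSep (G : SimpleGraph U) (k : ℕ) : Prop :=
  ∀ (S : Finset U) (A B : Set U), Conn G A → Conn G B → (∀ a ∈ A, a ∉ B) → (∀ a ∈ A, ∀ b ∈ B, ¬G.Adj a b) →
    (∀ s ∈ S, s ∉ A) → (∀ s ∈ S, s ∉ B) → (∀ s ∈ S, Att G s A) → (∀ s ∈ S, Att G s B) → S.card ≤ k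

theorem cpt_compl {Ω : Set U} {d : U} (hd : d ∈ Ωᶜ) : nbd G (cpt G Ωᶜ d) ⊆ Ω := by
  rintro s ⟨hs, a, ha, hsa⟩
  by_contra hn
  exact hs (cpt_closed hd ha hn hsa.symm)

theorem pmc_nbd {Ω : Set U} {k : ℕ} (hS : HSep G k) (h : Pmc G Ω) {d : U} (hd : d ∈ Ωᶜ) {S : Finset U}
    (hs : ∀ s ∈ S, s ∈ nbd G (cpt G Ωᶜ d)) : S.card ≤ k := by
  obtain ⟨E, h1, h2, h3, h4⟩ := pmc_opp h (cpt_conn hd) (cpt_sub hd) (cpt_compl hd)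
  exact hS S _ E (cpt_conn hd) h1 (fun a ha hh => h2 hh (Or.inl ha)) h4 (fun s h => (hs s h).1)
    (fun s h hh => h2 hh (Or.inr (hs s h))) (fun s h => (hs s h).2) (fun s h => h3 s (hs s h))

theorem pmc_card [Finite U] {Ω : Finset U} {k t : ℕ} (hk : 2 ≤ k) (ht : 2 ≤ t) (hK : G.CliqueFree t) (hS : HSep G k)
    (h : Pmc G (Ω : Set U)) : Ω.card ≤ (t - 1) * k ^ 3 := by
  classical
  obtain ⟨_⟩ := nonempty_fintype U
  by_cases hc : ∀ u ∈ Ω, ∀ v ∈ Ω, u ≠ v → G.Adj u v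
  · have h1 : Ω.card ≤ t - 1 := by
      by_contra hn
      obtain ⟨T, hT, hTc⟩ := Finset.exists_subset_card_eq (show t ≤ Ω.card by omega)
      exact hK T ⟨fun a ha b hb hab => hc a (hT ha) b (hT hb) hab, hTc⟩
    have h2 : 1 ≤ k ^ 3 := Nat.one_le_pow _ _ (by omega)
    nlinarith
  push Not at hc
  obtain ⟨u, hu, v, hv, huv, nuv⟩ := hc
  have huX : u ∈ (G.neighborSet v)ᶜ := fun hh => nuv (SimpleGraph.Adj.symm hh)
  set E := cpt G (G.neighborSet v)ᶜ u with hE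
  have cE : Conn G E := cpt_conn huX
  have sE : ∀ x ∈ E, ¬G.Adj v x := fun x hx => cpt_sub huX hx
  have uE : u ∈ E := cpt_self u
  have vE : v ∉ E := by
    intro hh
    have hst : E ⊆ {v} := stay cE (by
      rintro x hx ⟨-, a, rfl, ha⟩
      exact sE x hx ha.symm) hh rfl
    exact huv (hst uE)
  have hX : ∀ x ∈ nbd G E, G.Adj v x := by
    rintro x ⟨hx, a, ha, hxa⟩
    by_contra hn
    exact hx (cpt_closed huX ha hn hxa.symm)
  set X : Finset U := Finset.univ.filter (· ∈ nbd G E) with hXdef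
  have mX : ∀ x, x ∈ X ↔ x ∈ nbd G E := by simp [hXdef]
  have cX : X.card ≤ k := by
    refine hS X E {v} cE (conn_singleton v) ?_ ?_ ?_ ?_ ?_ ?_
    · rintro a ha rfl; exact vE ha
    · rintro a ha b rfl hab; exact sE a ha hab.symm
    · intro s hs; exact ((mX s).1 hs).1
    · rintro s hs rfl; exact (hX _ ((mX _).1 hs)).ne rfl
    · intro s hs; exact ((mX s).1 hs).2
    · intro s hs; exact ⟨v, rfl, (hX _ ((mX _).1 hs)).symm⟩
  have key : ∀ C, Conn G C → ∀ c1 ∈ C, ∀ c2 ∈ C, (c1 ∈ E ∨ c1 ∈ nbd G E) → c2 ∉ E → ∃ x ∈ C, x ∈ nbd G E := by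
    intro C hC c1 h1 c2 h2 h3 h4
    by_contra hn
    push Not at hn
    exact h4 (stay hC hn h1 (h3.resolve_right (hn c1 h1)) h2)
  set g : U → Finset U := fun x => if x ∈ Ω then {x} else Finset.univ.filter (· ∈ nbd G (cpt G (Ω : Set U)ᶜ x)) with hg
  have cg : ∀ x ∈ X, (g x).card ≤ k := by
    intro x hx
    by_cases hxO : x ∈ Ω
    · simp only [hg, hxO, if_true, Finset.card_singleton]; omega
    · simp only [hg, hxO, if_false]
      exact pmc_nbd hS h (d := x) (by simpa using hxO) (by simp)
  have fin : ∀ C, Conn G C → C ⊆ (Ω : Set U)ᶜ → ∀ w ∈ Ω, Att G w C → (∃ x ∈ C, x ∈ nbd G E) → ∃ x ∈ X, w ∈ g x := by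
    rintro C hC hCO w hw ⟨c, hc, hwc⟩ ⟨x, hx, hxE⟩
    refine ⟨x, (mX x).2 hxE, ?_⟩
    have hxO : x ∉ Ω := by simpa using hCO hx
    simp only [hg, hxO, if_false]
    simp only [Finset.mem_filter, Finset.mem_univ, true_and]
    have hxO' : x ∈ (Ω : Set U)ᶜ := hCO hx
    exact ⟨fun hh => cpt_sub hxO' hh (by simpa using hw), c, (hC.2 x hx c hc).mono hCO, hwc⟩
  have cover : Ω ⊆ {u, v} ∪ X.biUnion g := by
    intro w hw
    simp only [Finset.mem_union, Finset.mem_insert, Finset.mem_singleton, Finset.mem_biUnion]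
    by_cases e1 : w = u
    · exact Or.inl (Or.inl e1)
    by_cases e2 : w = v
    · exact Or.inl (Or.inr e2)
    right
    by_cases hwX : w ∈ nbd G E
    · exact ⟨w, (mX w).2 hwX, by simp [hg, hw]⟩
    by_cases hwE : w ∈ E
    · rcases h.lnk w hw v hv e2 with hh | ⟨C, hC, hCs, ⟨c, hc, hwc⟩, ⟨c', hc', hvc⟩⟩
      · exact absurd hh.symm (sE w hwE)
      · refine fin C hC hCs w hw ⟨c, hc, hwc⟩ (key C hC c hc c' hc' ?_ (fun hh => sE _ hh hvc))
        by_cases hcE : c ∈ E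
        · exact Or.inl hcE
        · exact Or.inr ⟨hcE, w, hwE, hwc.symm⟩
    · rcases h.lnk w hw u hu e1 with hh | ⟨C, hC, hCs, ⟨c, hc, hwc⟩, ⟨c', hc', huc⟩⟩
      · exact absurd ⟨hwE, u, uE, hh⟩ hwX
      · refine fin C hC hCs w hw ⟨c, hc, hwc⟩ (key C hC c' hc' c hc ?_ (fun hh => hwX ⟨hwE, c, hh, hwc⟩))
        by_cases hcE : c' ∈ E
        · exact Or.inl hcE
        · exact Or.inr ⟨hcE, u, uE, huc.symm⟩
  have h1 := Finset.card_le_card cover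
  have h2 := Finset.card_union_le {u, v} (X.biUnion g)
  have h3 := Finset.card_le_two (a := u) (b := v)
  have h4 := Finset.card_biUnion_le_card_mul X g k cg
  have h5 : X.card * k ≤ k * k := Nat.mul_le_mul_right _ cX
  have h6 : Ω.card ≤ 2 + k * k := by omega
  have h7 : 2 + k * k ≤ k ^ 3 := by
    have : k ^ 3 = k * k * k := by ring
    nlinarith
  have h8 : 1 * k ^ 3 ≤ (t - 1) * k ^ 3 := Nat.mul_le_mul_right _ (by omega)
  omega

end P11

set_option linter.unusedSectionVars false
set_option linter.unusedVariables false

section P12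
variable {U : Type} [DecidableEq U] {G : SimpleGraph U}

theorem leaf_tree {ι : Type} [Finite ι] {T : SimpleGraph ι} (hT : T.IsTree) (p : ι) :
    (T.map (Function.Embedding.some) ⊔ edge none (some p) : SimpleGraph (Option ι)).IsTree := by
  have _ := Fintype.ofFinite ι
  rw [isTree_iff_connected_and_card] at hT ⊢
  refine ⟨?_, ?_⟩
  · have key : ∀ i, (T.map (Function.Embedding.some) ⊔ edge none (some p) : SimpleGraph (Option ι)).Reachable none (some i) := by
      intro i
      have h1 : (T.map (Function.Embedding.some) ⊔ edge none (some p) : SimpleGraph (Option ι)).Adj none (some p) := by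
        simp [edge_adj]
      refine h1.reachable.trans ?_
      have h2 : (T.map (Function.Embedding.some)).Reachable (some p) (some i) :=
        (hT.1.preconnected p i).map (SimpleGraph.Embedding.map Function.Embedding.some T).toHom
      exact h2.mono le_sup_left
    have : ∀ a, (T.map (Function.Embedding.some) ⊔ edge none (some p) : SimpleGraph (Option ι)).Reachable none a := by
      rintro (_ | i)
      · exact Reachable.refl _
      · exact key i
    exact { preconnected := fun a b => (this a).symm.trans (this b), nonempty := ⟨none⟩ }
  · have e1 : (T.map (Function.Embedding.some) ⊔ edge none (some p) : SimpleGraph (Option ι)).edgeSet =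
        insert s(none, some p) (Function.Embedding.some.sym2Map '' T.edgeSet) := by
      rw [edgeSet_sup, edgeSet_map, edgeSet_edge_of_ne (by simp : (none : Option ι) ≠ some p)]
      rw [Set.union_comm]; rfl
    rw [e1]
    have hn : s(none, some p) ∉ Function.Embedding.some.sym2Map '' T.edgeSet := by
      rintro ⟨e, -, he⟩
      induction e using Sym2.ind with
      | _ a b => simp at he
    have hcard := hT.2
    rw [Nat.card_coe_set_eq] at hcard ⊢
    rw [Set.ncard_insert_of_notMem hn (Set.toFinite _), Set.ncard_image_of_injective _ (Function.Embedding.injective _), hcard]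
    simp

theorem rch_walk {A : Set U} {a b : U} (ha : a ∈ A) (h : Rch G A a b) : ∃ w : G.Walk a b, ∀ x ∈ w.support, x ∈ A := by
  induction h using Relation.ReflTransGen.head_induction_on with
  | refl => exact ⟨.nil, by simpa using ha⟩
  | head h _ ih =>
    obtain ⟨w, hw⟩ := ih h.2.2
    refine ⟨.cons h.1 w, ?_⟩
    intro x hx
    rw [Walk.support_cons, List.mem_cons] at hx
    rcases hx with rfl | hx
    · exact h.2.1
    · exact hw x hx

theorem rch_map {W : Type} {H : SimpleGraph W} (f : U → W) (hf : ∀ a b, G.Adj a b → H.Adj (f a) (f b)) {A : Set U} {B : Set W}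
    (hAB : ∀ a ∈ A, f a ∈ B) {a b : U} (h : Rch G A a b) : Rch H B (f a) (f b) := by
  induction h with
  | refl => exact .refl
  | tail _ h ih => exact Relation.ReflTransGen.tail ih ⟨hf _ _ h.1, hAB _ h.2.1, hAB _ h.2.2⟩

/-- A partial tree decomposition with bags of size at most `K`. -/
structure PTD (G : SimpleGraph U) (K : ℕ) {ι : Type} (T : SimpleGraph ι) (B : ι → Finset U) : Prop where
  fin : Finite ι
  tree : T.IsTree
  con : ∀ v i j, v ∈ B i → v ∈ B j → Rch T {x | v ∈ B x} i j
  edge : ∀ u v i j, G.Adj u v → u ∈ B i → v ∈ B j → ∃ x, u ∈ B x ∧ v ∈ B x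
  card : ∀ i, (B i).card ≤ K
  inv : ∀ d, (∀ i, d ∉ B i) → ∃ D : Set U, d ∈ D ∧ Conn G D ∧ (∀ x ∈ D, ∀ i, x ∉ B i) ∧
    (∃ i, ∀ s ∈ nbd G D, s ∈ B i) ∧ ∀ u ∈ nbd G D, ∀ v ∈ nbd G D, u ≠ v → G.Adj u v ∨ Lnk G (D ∪ nbd G D)ᶜ u v

theorem ptd_step [Finite U] {k t : ℕ} (hk : 2 ≤ k) (ht : 2 ≤ t) (hK : G.CliqueFree t) (hS : HSep G k)
    {ι : Type} {T : SimpleGraph ι} {B : ι → Finset U} (h : PTD G ((t - 1) * k ^ 3) T B) {d : U} (hd : ∀ i, d ∉ B i) :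
    ∃ (ι' : Type) (T' : SimpleGraph ι') (B' : ι' → Finset U), PTD G ((t - 1) * k ^ 3) T' B' ∧
      {v | ∃ i, v ∈ B i} ⊂ {v | ∃ i, v ∈ B' i} := by
  classical
  have _ := h.fin
  obtain ⟨_⟩ := nonempty_fintype U
  obtain ⟨D, hdD, cD, DW, ⟨p, hp⟩, hl⟩ := h.inv d hd
  obtain ⟨Ω0, h1, h2, ⟨e, heD, heO⟩, hpmc⟩ := pmc_ex cD hl
  obtain ⟨Ω, rfl⟩ : ∃ Ω : Finset U, (Ω : Set U) = Ω0 := ⟨Ω0.toFinite.toFinset, by simp⟩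
  have hmem : ∀ v i, v ∈ Ω → v ∈ B i → v ∈ B p := by
    intro v i hv hi
    rcases h2 hv with hh | hh
    · exact hp v hh
    · exact absurd hi (DW v hh i)
  let T' : SimpleGraph (Option ι) := T.map (Function.Embedding.some) ⊔ edge none (some p)
  let B' : Option ι → Finset U := fun o => o.elim Ω B
  have tadj : ∀ i j, T.Adj i j → T'.Adj (some i) (some j) := fun i j hij => Or.inl ((SimpleGraph.map_adj _ _ _ _).2 ⟨i, j, hij, rfl, rfl⟩)
  have nadj : T'.Adj none (some p) := by simp [T', edge_adj]
  refine ⟨Option ι, T', B', ⟨inferInstance, leaf_tree h.tree p, ?_, ?_, ?_, ?_⟩, ?_⟩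
  · intro v
    have hss : ∀ i j, v ∈ B i → v ∈ B j → Rch T' {x | v ∈ B' x} (some i) (some j) := fun i j hi hj =>
      rch_map some tadj (fun a ha => ha) (h.con v i j hi hj)
    have hns : ∀ j, v ∈ Ω → v ∈ B j → Rch T' {x | v ∈ B' x} none (some j) := fun j ho hj =>
      (Rch.single nadj (by exact ho) (by exact hmem v j ho hj)).trans (hss p j (hmem v j ho hj) hj)
    rintro (_ | i) (_ | j) hi hj
    · exact .refl
    · exact hns j hi hj
    · exact (hns i hj hi).symm
    · exact hss i j hi hj
  · have hno : ∀ u v j, G.Adj u v → u ∈ Ω → v ∈ B j → ∃ x, u ∈ B' x ∧ v ∈ B' x := by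
      intro u v j huv hu hv
      rcases h2 hu with hh | hh
      · obtain ⟨x, h1, h2⟩ := h.edge u v p j huv (hp u hh) hv
        exact ⟨some x, h1, h2⟩
      · exact ⟨none, hu, h1 ⟨fun hvD => DW v hvD j hv, u, hh, huv.symm⟩⟩
    rintro u v (_ | i) (_ | j) huv hi hj
    · exact ⟨none, hi, hj⟩
    · exact hno u v j huv hi hj
    · obtain ⟨x, h1, h2⟩ := hno v u i huv.symm hj hi
      exact ⟨x, h2, h1⟩
    · obtain ⟨x, h1, h2⟩ := h.edge u v i j huv hi hj
      exact ⟨some x, h1, h2⟩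
  · rintro (_ | i)
    · exact pmc_card hk ht hK hS hpmc
    · exact h.card i
  · intro d' hd'
    have hdO : d' ∈ (Ω : Set U)ᶜ := hd' none
    have hdW : ∀ i, d' ∉ B i := fun i => hd' (some i)
    by_cases hin : d' ∈ D
    · have hsub : cpt G (Ω : Set U)ᶜ d' ⊆ D := stay (cpt_conn hdO) (fun x hx hh => cpt_sub hdO hx (h1 hh)) (cpt_self d') hin
      refine ⟨cpt G (Ω : Set U)ᶜ d', cpt_self d', cpt_conn hdO, ?_, ⟨none, fun s hs => cpt_compl hdO hs⟩, ?_⟩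
      · rintro x hx (_ | i)
        · exact cpt_sub hdO hx
        · exact DW x (hsub hx) i
      · intro u hu v hv huv
        obtain ⟨E, g1, g2, g3, g4⟩ := pmc_opp hpmc (cpt_conn hdO) (cpt_sub hdO) (cpt_compl hdO)
        exact Or.inr ⟨E, g1, g2, g3 u hu, g3 v hv⟩
    · obtain ⟨D', q1, q2, q3, ⟨i, q4⟩, q5⟩ := h.inv d' hdW
      refine ⟨D', q1, q2, ?_, ⟨some i, q4⟩, q5⟩
      rintro x hx (_ | j)
      · intro hxO
        rcases h2 hxO with hh | hh
        · exact q3 x hx p (hp x hh)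
        · exact hin (stay q2 (fun y hy hyn => q3 y hy p (hp y hyn)) hx hh q1)
      · exact q3 x hx j
  · refine ⟨?_, ?_⟩
    · rintro v ⟨i, hi⟩
      exact ⟨some i, hi⟩
    · intro hsub
      obtain ⟨i, hi⟩ := hsub ⟨none, heO⟩
      exact DW e heD i hi

theorem ptd_full [Finite U] {k t : ℕ} (hk : 2 ≤ k) (ht : 2 ≤ t) (hK : G.CliqueFree t) (hS : HSep G k) (n : ℕ) :
    ∀ {ι : Type} {T : SimpleGraph ι} {B : ι → Finset U}, PTD G ((t - 1) * k ^ 3) T B → {v | ∃ i, v ∈ B i}ᶜ.ncard ≤ n →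
    ∃ (ι' : Type) (T' : SimpleGraph ι') (B' : ι' → Finset U), PTD G ((t - 1) * k ^ 3) T' B' ∧ ∀ v, ∃ i, v ∈ B' i := by
  induction n with
  | zero =>
    intro ι T B h hn
    refine ⟨ι, T, B, h, ?_⟩
    rw [Nat.le_zero, Set.ncard_eq_zero (Set.toFinite _), Set.compl_empty_iff, Set.eq_univ_iff_forall] at hn
    exact hn
  | succ n ih =>
    intro ι T B h hn
    by_cases hc : ∀ v, ∃ i, v ∈ B i
    · exact ⟨ι, T, B, h, hc⟩
    · push Not at hc
      obtain ⟨d, hd⟩ := hc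
      obtain ⟨ι', T', B', h', hs⟩ := ptd_step hk ht hK hS h hd
      refine ih h' ?_
      have := Set.ncard_lt_ncard (compl_lt_compl_iff_lt.2 hs) (Set.toFinite _)
      have h2 : {v | ∃ i, v ∈ B' i}ᶜ.ncard < {v | ∃ i, v ∈ B i}ᶜ.ncard := this
      omega

theorem ptd_start [Finite U] (K : ℕ) : PTD G K (⊥ : SimpleGraph Unit) (fun _ => (∅ : Finset U)) where
  fin := inferInstance
  tree := IsTree.of_subsingleton
  con := by intro v i j h; simp at h
  edge := by intro u v i j _ h; simp at h
  card := by simp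
  inv := by
    intro d _
    have hN : nbd G (cpt G Set.univ d) = ∅ := by
      ext s
      simp only [Set.mem_empty_iff_false, iff_false]
      rintro ⟨hs, a, ha, hsa⟩
      exact hs (cpt_closed (Set.mem_univ d) ha (Set.mem_univ s) hsa.symm)
    refine ⟨cpt G Set.univ d, cpt_self d, cpt_conn (Set.mem_univ d), by simp, ⟨(), ?_⟩, ?_⟩
    · rw [hN]; simp
    · rw [hN]; simp

end P12

theorem ptd_tw {V : Type} [Fintype V] [DecidableEq V] {G : SimpleGraph V} {K : ℕ} {ι : Type} {T : SimpleGraph ι} {B : ι → Finset V}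
    (h : PTD G (K + 1) T B) (hf : ∀ v, ∃ i, v ∈ B i) : treewidth G ≤ K := by
  classical
  have _ := h.fin
  have e := Finite.equivFin ι
  refine Nat.sInf_le ⟨Nat.card ι, T.map e.toEmbedding, fun i => B (e.symm i), ⟨?_, ?_, ?_, ?_⟩, fun i => h.card _⟩
  · exact (SimpleGraph.Iso.map e T).isTree_iff.1 h.tree
  · intro v
    obtain ⟨i, hi⟩ := hf v
    exact ⟨e i, by simpa using hi⟩
  · intro u v huv
    obtain ⟨i, hi⟩ := hf u
    obtain ⟨j, hj⟩ := hf v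
    obtain ⟨x, h1, h2⟩ := h.edge u v i j huv hi hj
    exact ⟨e x, by simpa using h1, by simpa using h2⟩
  · intro v i j hi hj p hp x hx
    have hT : (T.map e.toEmbedding).IsTree := (SimpleGraph.Iso.map e T).isTree_iff.1 h.tree
    have hr := h.con v _ _ hi hj
    have hr' : Rch (T.map e.toEmbedding) {x | v ∈ B (e.symm x)} (e (e.symm i)) (e (e.symm j)) :=
      rch_map e (fun a b hab => (SimpleGraph.map_adj _ _ _ _).2 ⟨a, b, hab, rfl, rfl⟩) (fun a ha => by simpa using ha) hr
    rw [Equiv.apply_symm_apply, Equiv.apply_symm_apply] at hr'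
    obtain ⟨w, hw⟩ := rch_walk (A := {x | v ∈ B (e.symm x)}) hi hr'
    have hu := hT.IsAcyclic.path_unique ⟨p, hp⟩ w.toPath
    have hpe : p = (w.toPath : (T.map e.toEmbedding).Walk i j) := congrArg Subtype.val hu
    rw [hpe] at hx
    exact hw x (Walk.support_toPath_subset w hx)

theorem final_tw {V : Type} [Fintype V] [DecidableEq V] (G : SimpleGraph V) (l t : ℕ) (hl : 1 ≤ l) (ht : 1 ≤ t)
    (hG : InClassC G)
    (hsw : ¬∃ (n p : ℕ) (f : ZMod n → V) (c : Fin l → V), IsSpanWheel G l n p f c)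
    (hK : G.CliqueFree t) :
    treewidth G ≤ (t - 1) * (ramseyNumber t (l + 2) - 1) ^ 3 - 1 := by
  rcases ht.lt_or_eq with ht | rfl
  · have h3 := ramsey_three (t := t) (l := l) (by omega) hl
    have hS : HSep G (ramseyNumber t (l + 2) - 1) := by
      intro S A B cA cB dis anti SA SB aA aB
      have := hsep hG hl hsw hK cA cB dis anti SA SB aA aB
      omega
    obtain ⟨ι, T, B, h, hf⟩ := ptd_full (k := ramseyNumber t (l + 2) - 1) (t := t) (by omega) (by omega) hK hS _ (ptd_start _) le_rfl
    have hpos : 1 ≤ (t - 1) * (ramseyNumber t (l + 2) - 1) ^ 3 :=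
      Nat.mul_pos (by omega) (Nat.pow_pos (by omega))
    rw [show (t - 1) * (ramseyNumber t (l + 2) - 1) ^ 3 = ((t - 1) * (ramseyNumber t (l + 2) - 1) ^ 3 - 1) + 1 by omega] at h
    exact ptd_tw h hf
  · have hV : IsEmpty V := by
      refine ⟨fun v => hK {v} ?_⟩
      simp
    exact (ptd_tw (K := 0) (ptd_start (G := G) 1) (fun v => (hV.false v).elim)).trans (Nat.zero_le _)

/-- Every (`l`-span-wheel, `K_t`)-free graph in the class 𝒞 has treewidth
at most `(t-1)·(R(t, l+2) - 1)³ - 1`. -/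
theorem statement11 (G : SimpleGraph V) (l t : ℕ) (hl : 1 ≤ l) (ht : 1 ≤ t)
    (hG : InClassC G)
    (hsw : ¬∃ (n p : ℕ) (f : ZMod n → V) (c : Fin l → V), IsSpanWheel G l n p f c)
    (hK : G.CliqueFree t) :
    treewidth G ≤ (t - 1) * (ramseyNumber t (l + 2) - 1) ^ 3 - 1 := by
  exact final_tw G l t hl ht hG hsw hK
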